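/- Let μ be a uniformly distributed measure on ℝ^d. Then there exists an integer n with 0 ≤ n ≤ d such that μ is locally uniformly n-rectifiable. -/

import Mathlib

open MeasureTheory Metric Filter Set

noncomputable section

abbrev Euc (d : ℕ) : Type := EuclideanSpace ℝ (Fin d)

/-- The support of a measure: points all of whose closed balls have positive measure. -/
def msupport {d : ℕ} (μ : Measure (Euc d)) : Set (Euc d) :=
  {x | ∀ r : ℝ, 0 < r → 0 < μ (Metric.closedBall x r)}

/-- `φ` is a distribution function of the uniformly distributed measure `μ`. -/
def IsDistributionFunction {d : ℕ} (μ : Measure (Euc d)) (φ : ℝ → ENNReal) : Prop :=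
  (msupport μ).Nonempty ∧
  (∀ r : ℝ, 0 < r → 0 < φ r ∧ φ r < ⊤) ∧
  (∀ x ∈ msupport μ, ∀ r : ℝ, 0 < r → μ (Metric.closedBall x r) = φ r)

/-- `μ` is uniformly distributed. -/
def UniformlyDistributed {d : ℕ} (μ : Measure (Euc d)) : Prop :=
  ∃ φ : ℝ → ENNReal, IsDistributionFunction μ φ

/-- `dim₀ μ = n` : the limit of `φ(r)/rⁿ` as `r → 0⁺` exists, is finite and positive. -/
def HasDim0 (φ : ℝ → ENNReal) (n : ℕ) : Prop :=
  ∃ c : ℝ, 0 < c ∧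
    Filter.Tendsto (fun r : ℝ => (φ r).toReal / r ^ n) (nhdsWithin 0 (Set.Ioi 0)) (nhds c)

/-- `dim_∞ μ = p` : the limit of `φ(r)/r^p` as `r → ∞` exists, is finite and positive. -/
def HasDimInfty (φ : ℝ → ENNReal) (p : ℕ) : Prop :=
  ∃ c : ℝ, 0 < c ∧
    Filter.Tendsto (fun r : ℝ => (φ r).toReal / r ^ p) Filter.atTop (nhds c)

/-- The affine `n`-planes of `ℝ^d`. -/
def nPlanes (d n : ℕ) : Set (AffineSubspace ℝ (Euc d)) :=
  {L | (L : Set (Euc d)).Nonempty ∧ Module.finrank ℝ L.direction = n}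

/-- Jones' beta number `β^n_μ(B(x,r))`. -/
def jonesBeta {d : ℕ} (n : ℕ) (μ : Measure (Euc d)) (x : Euc d) (r : ℝ) : ℝ :=
  ⨅ L : nPlanes d n,
    ⨆ y : (msupport μ ∩ Metric.closedBall x r : Set (Euc d)),
      Metric.infDist y.1 (L.1 : Set (Euc d)) / r

/-- The bilateral beta number `bβ^n_μ(B(x,r))`. -/
def bilateralBeta {d : ℕ} (n : ℕ) (μ : Measure (Euc d)) (x : Euc d) (r : ℝ) : ℝ :=
  ⨅ L : nPlanes d n,
    ((⨆ y : (msupport μ ∩ Metric.closedBall x r : Set (Euc d)),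
        Metric.infDist y.1 (L.1 : Set (Euc d)) / r) +
     (⨆ p : ((L.1 : Set (Euc d)) ∩ Metric.closedBall x r : Set (Euc d)),
        Metric.infDist p.1 (msupport μ) / r))

/-- `μ` is doubling with constant `C`. -/
def DoublingWith {d : ℕ} (μ : Measure (Euc d)) (C : ℝ) : Prop :=
  ∀ x ∈ msupport μ, ∀ r : ℝ, 0 < r →
    μ (Metric.closedBall x (2 * r)) ≤ ENNReal.ofReal C * μ (Metric.closedBall x r)

/-- `μ` is doubling. -/
def Doubling {d : ℕ} (μ : Measure (Euc d)) : Prop :=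
  ∃ C : ℝ, 0 < C ∧ DoublingWith μ C

/-- Weak convergence of a sequence of Radon measures. -/
def WeakConv {d : ℕ} (μs : ℕ → Measure (Euc d)) (μ : Measure (Euc d)) : Prop :=
  ∀ f : Euc d → ℝ, Continuous f → HasCompactSupport f →
    Filter.Tendsto (fun j => ∫ x, f x ∂(μs j)) Filter.atTop (nhds (∫ x, f x ∂μ))

/-- `μ` is `n`-asymptotically optimally doubling. -/
def AsympOptDoubling {d : ℕ} (n : ℕ) (μ : Measure (Euc d)) : Prop :=
  ∀ K : Set (Euc d), IsCompact K → K ⊆ msupport μ →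
    ∀ t : ℝ, t ∈ Set.Icc (1/2 : ℝ) 1 →
      Filter.Tendsto
        (fun r : ℝ => ⨆ x : K,
          |(μ (Metric.closedBall x.1 (t * r)) / μ (Metric.closedBall x.1 r)).toReal - t ^ n|)
        (nhdsWithin 0 (Set.Ioi 0)) (nhds 0)

/-- Truncated `n`-Riesz transform `R_{r,s}μ(z)`. -/
def rieszT {d : ℕ} (n : ℕ) (μ : Measure (Euc d)) (z : Euc d) (r s : ℝ) : Euc d :=
  ∫ y in {y : Euc d | r ≤ dist y z ∧ dist y z ≤ s}, (‖y - z‖ ^ (n + 1))⁻¹ • (y - z) ∂μ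

/-- `μ` is locally Ahlfors `n`-regular. -/
def LocallyAhlforsRegular {d : ℕ} (n : ℕ) (μ : Measure (Euc d)) : Prop :=
  ∀ K : Set (Euc d), IsCompact K → ∃ c : ℝ, 0 < c ∧ ∃ rK : ℝ, 0 < rK ∧
    ∀ x ∈ msupport μ ∩ K, ∀ r : ℝ, 0 < r → r ≤ rK →
      ENNReal.ofReal (c⁻¹ * r ^ n) ≤ μ (Metric.closedBall x r) ∧
      μ (Metric.closedBall x r) ≤ ENNReal.ofReal (c * r ^ n)

/-- `μ` is locally uniformly `n`-rectifiable. -/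
def LocUnifRectifiable {d : ℕ} (n : ℕ) (μ : Measure (Euc d)) : Prop :=
  LocallyAhlforsRegular n μ ∧
  ∀ K : Set (Euc d), IsCompact K →
    ∃ RK θK MK : ℝ, 0 < RK ∧ 0 < θK ∧ 0 < MK ∧
      ∀ x ∈ msupport μ ∩ K, ∀ R : ℝ, 0 < R → R ≤ RK →
        ∃ g : EuclideanSpace ℝ (Fin n) → Euc d,
          LipschitzWith (Real.toNNReal MK) g ∧
          ENNReal.ofReal (θK * R ^ n) ≤ μ (Metric.closedBall x R ∩ Set.range g)

/-- The Banach space of absolutely summable real families. -/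
abbrev L1 (I : Type*) : Type _ := lp (fun _ : I => ℝ) 1

namespace L1
variable {I V : Type*} [NormedAddCommGroup V] [NormedSpace ℝ V] [CompleteSpace V]

lemma summable_norm (g : L1 I) : Summable (fun i => |g i|) := by
  simpa using (lp.memℓp g).summable (by simp)

lemma norm_eq_tsum (g : L1 I) : ‖g‖ = ∑' i, |g i| := by
  simpa using lp.norm_eq_tsum_rpow (p := 1) (by simp) g

open Classical in
/-- The basis vector of `L1 I` at the index `i`. -/
def e (i : I) : L1 I := lp.single 1 i (1 : ℝ)

lemma norm_e (i : I) : ‖(e i : L1 I)‖ = 1 := by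
  simp [e]

lemma hasSum_e (g : L1 I) : HasSum (fun i => g i • (e i : L1 I)) g := by
  classical
  have := lp.hasSum_single (p := 1) (by simp) g
  refine this.congr_fun fun i => ?_
  rw [e, ← lp.single_smul]
  simp

lemma summable_smul (v : I → V) {C : ℝ} (hv : ∀ i, ‖v i‖ ≤ C) (g : L1 I) :
    Summable (fun i => g i • v i) := by
  refine Summable.of_norm_bounded (g := fun i => |g i| * C) (g.summable_norm.mul_right C) ?_
  intro i
  rw [norm_smul]
  exact mul_le_mul_of_nonneg_left (hv i) (abs_nonneg _)

/-- The operator on `L1 I` sending the `i`-th basis vector to `v i`, for a bounded family `v`. -/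
def lift (v : I → V) (C : ℝ) (hv : ∀ i, ‖v i‖ ≤ C) : L1 I →L[ℝ] V :=
  LinearMap.mkContinuous
    { toFun := fun g => ∑' i, g i • v i
      map_add' := fun g h => by
        rw [← (summable_smul v hv g).tsum_add (summable_smul v hv h)]
        simp [add_smul]
      map_smul' := fun c g => by
        rw [← ((summable_smul v hv g).tsum_const_smul _)]
        simp [mul_smul] } C (by
      intro g
      have hs : Summable (fun i => ‖g i • v i‖) := by
        refine Summable.of_nonneg_of_le (fun _ => norm_nonneg _) ?_ (g.summable_norm.mul_right C)
        intro i
        rw [norm_smul]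
        exact mul_le_mul_of_nonneg_left (hv i) (abs_nonneg _)
      refine (norm_tsum_le_tsum_norm hs).trans ?_
      rw [norm_eq_tsum, mul_comm, ← tsum_mul_right]
      refine hs.tsum_le_tsum (fun i => ?_) (g.summable_norm.mul_right C)
      rw [norm_smul]
      exact mul_le_mul_of_nonneg_left (hv i) (abs_nonneg _))

lemma lift_apply (v : I → V) (C : ℝ) (hv : ∀ i, ‖v i‖ ≤ C) (g : L1 I) :
    lift v C hv g = ∑' i, g i • v i := rfl

lemma hasSum_lift (v : I → V) (C : ℝ) (hv : ∀ i, ‖v i‖ ≤ C) (g : L1 I) :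
    HasSum (fun i => g i • v i) (lift v C hv g) := (summable_smul v hv g).hasSum

lemma norm_lift_le (v : I → V) (C : ℝ) (hC : 0 ≤ C) (hv : ∀ i, ‖v i‖ ≤ C) :
    ‖lift v C hv‖ ≤ C := LinearMap.mkContinuous_norm_le _ hC _

@[simp] lemma lift_e (v : I → V) (C : ℝ) (hv : ∀ i, ‖v i‖ ≤ C) (i : I) :
    lift v C hv (e i) = v i := by
  classical
  rw [lift_apply, tsum_eq_single i]
  · simp [e]
  · intro j hj
    simp [e, lp.single_apply, hj]

lemma ext_clm {A B : L1 I →L[ℝ] V} (h : ∀ i, A (e i) = B (e i)) : A = B := by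
  ext g
  have h1 := (hasSum_e g).mapL A
  have h2 := (hasSum_e g).mapL B
  simp only [map_smul, h] at h1 h2
  exact h1.unique h2

end L1

/-- The monomial with exponent multiset `s`. -/
def mon {κ : Type*} (s : Multiset κ) (x : κ → ℝ) : ℝ := (s.map x).prod

section mon
variable {κ : Type*}

@[simp] lemma mon_zero (x : κ → ℝ) : mon 0 x = 1 := by simp [mon]

lemma mon_add (s t : Multiset κ) (x : κ → ℝ) : mon (s + t) x = mon s x * mon t x := by
  simp [mon]

lemma mon_replicate (n : ℕ) (i : κ) (x : κ → ℝ) : mon (Multiset.replicate n i) x = x i ^ n := by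
  simp [mon]

@[simp] lemma mon_cons (i : κ) (s : Multiset κ) (x : κ → ℝ) : mon (i ::ₘ s) x = x i * mon s x := by
  simp [mon]

lemma mon_mul (s : Multiset κ) (x y : κ → ℝ) : mon s (fun i => x i * y i) = mon s x * mon s y := by
  simp [mon]

lemma abs_mon (s : Multiset κ) (x : κ → ℝ) : |mon s x| = mon s (fun i => |x i|) := by
  induction s using Multiset.induction with
  | empty => simp
  | cons a s ih => simp [abs_mul, ih]

lemma mon_nonneg (s : Multiset κ) {x : κ → ℝ} (hx : ∀ i ∈ s, 0 ≤ x i) : 0 ≤ mon s x := by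
  induction s using Multiset.induction with
  | empty => simp
  | cons a s ih =>
    rw [mon_cons]
    exact mul_nonneg (hx a (by simp)) (ih fun i hi => hx i (by simp [hi]))

lemma mon_le_mon (s : Multiset κ) {x y : κ → ℝ} (hx : ∀ i ∈ s, 0 ≤ x i) (hxy : ∀ i ∈ s, x i ≤ y i) :
    mon s x ≤ mon s y := by
  induction s using Multiset.induction with
  | empty => simp
  | cons a s ih =>
    rw [mon_cons, mon_cons]
    exact mul_le_mul (hxy a (by simp)) (ih (fun i hi => hx i (by simp [hi]))
      fun i hi => hxy i (by simp [hi])) (mon_nonneg _ fun i hi => hx i (by simp [hi]))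
      ((hx a (by simp)).trans (hxy a (by simp)))

lemma mon_const (s : Multiset κ) (c : ℝ) : mon s (fun _ => c) = c ^ s.card := by
  simp [mon]

lemma mon_congr {s : Multiset κ} {x y : κ → ℝ} (h : ∀ i ∈ s, x i = y i) : mon s x = mon s y := by
  unfold mon
  rw [Multiset.map_congr rfl h]

lemma abs_mon_le_one (s : Multiset κ) {x : κ → ℝ} (hx : ∀ i, |x i| ≤ 1) : |mon s x| ≤ 1 := by
  rw [abs_mon]
  refine (mon_le_mon s (y := fun _ => 1) (fun _ _ => abs_nonneg _) (fun i _ => hx i)).trans ?_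
  simp [mon_const]

lemma mon_eq_zero {s : Multiset κ} {x : κ → ℝ} {i : κ} (hi : i ∈ s) (hx : x i = 0) :
    mon s x = 0 := by
  obtain ⟨t, rfl⟩ := Multiset.exists_cons_of_mem hi
  simp [hx]

/-- Evaluation of an absolutely summable power series. -/
def evF (g : L1 (Multiset κ)) (u : κ → ℝ) : ℝ := ∑' s, g s * mon s u

/-- Evaluation at a point of the unit polydisc, as a functional. -/
def evL (u : κ → ℝ) (hu : ∀ i, |u i| ≤ 1) : L1 (Multiset κ) →L[ℝ] ℝ :=
  L1.lift (fun s => mon s u) 1 (fun s => abs_mon_le_one s hu)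

lemma evF_eq (u : κ → ℝ) (hu : ∀ i, |u i| ≤ 1) (g : L1 (Multiset κ)) : evF g u = evL u hu g := rfl

lemma hasSum_evF (u : κ → ℝ) (hu : ∀ i, |u i| ≤ 1) (g : L1 (Multiset κ)) :
    HasSum (fun s => g s * mon s u) (evF g u) := by
  rw [evF_eq u hu]
  exact L1.hasSum_lift _ 1 (fun s => abs_mon_le_one s hu) g

/-- `f` is represented by an absolutely summable power series on the polydisc of polyradius `w`. -/
def InA (w : κ → ℝ) (f : (κ → ℝ) → ℝ) : Prop :=
  ∃ g : L1 (Multiset κ), ∀ u : κ → ℝ, (∀ i, |u i| ≤ 1) → f (fun i => w i * u i) = evF g u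

variable [Fintype κ]

open Classical in
/-- The monomial with exponent multiset `s` as a multilinear map (zero in the wrong degree). -/
def monCMM (k : ℕ) (s : Multiset κ) : ContinuousMultilinearMap ℝ (fun _ : Fin k => κ → ℝ) ℝ :=
  if h : s.toList.length = k then
    (ContinuousMultilinearMap.mkPiAlgebraFin ℝ k ℝ).compContinuousLinearMap
      (fun j => ContinuousLinearMap.proj (s.toList.get (Fin.cast h.symm j)))
  else 0

open Classical in
lemma monCMM_apply (k : ℕ) (s : Multiset κ) (u : κ → ℝ) :
    monCMM k s (fun _ => u) = if s.card = k then mon s u else 0 := by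
  unfold monCMM
  by_cases h : s.card = k
  · subst h
    rw [dif_pos (by simp), if_pos rfl]
    simp only [ContinuousMultilinearMap.compContinuousLinearMap_apply,
      ContinuousMultilinearMap.mkPiAlgebraFin_apply, ContinuousLinearMap.proj_apply]
    rw [List.prod_ofFn]
    have : mon s u = (s.toList.map u).prod := by
      rw [← Multiset.prod_coe, ← Multiset.map_coe, Multiset.coe_toList, mon]
    rw [this, ← List.prod_ofFn]
    congr 1
    apply List.ext_get <;> simp
  · rw [dif_neg (by simpa using h), if_neg h]
    rfl

lemma norm_monCMM_le (k : ℕ) (s : Multiset κ) : ‖monCMM k s‖ ≤ 1 := by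
  unfold monCMM
  split_ifs with h
  · refine ContinuousMultilinearMap.opNorm_le_bound (by norm_num) fun m => ?_
    simp only [ContinuousMultilinearMap.compContinuousLinearMap_apply,
      ContinuousMultilinearMap.mkPiAlgebraFin_apply, ContinuousLinearMap.proj_apply]
    rw [List.prod_ofFn, norm_prod, one_mul]
    exact Finset.prod_le_prod (fun _ _ => norm_nonneg _) fun j _ => norm_le_pi_norm (m j) _
  · simp

/-- The Taylor series at the origin of an absolutely summable power series. -/
def evSeries (g : L1 (Multiset κ)) : FormalMultilinearSeries ℝ (κ → ℝ) ℝ :=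
  fun k => L1.lift (monCMM k) 1 (norm_monCMM_le k) g

lemma hasFPowerSeriesOnBall_evF (g : L1 (Multiset κ)) :
    HasFPowerSeriesOnBall (evF g) (evSeries g) 0 1 where
  r_le := by
    refine FormalMultilinearSeries.le_radius_of_bound (r := 1) _ ‖g‖ fun k => ?_
    simp only [NNReal.coe_one, one_pow, mul_one]
    refine (ContinuousLinearMap.le_opNorm _ _).trans ?_
    exact mul_le_of_le_one_left (norm_nonneg _) (L1.norm_lift_le _ 1 zero_le_one _)
  r_pos := by simp
  hasSum := by
    classical
    intro u hu
    have hu1 : ∀ i, |u i| ≤ 1 := by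
      intro i
      have h1 : ‖u‖ < 1 := by simpa [← ofReal_norm] using hu
      exact (norm_le_pi_norm u i).trans h1.le
    rw [zero_add]
    have h := hasSum_evF u hu1 g
    rw [← (Equiv.sigmaFiberEquiv (Multiset.card : Multiset κ → ℕ)).hasSum_iff] at h
    refine h.sigma fun k => ?_
    have h2 : evSeries g k (fun _ => u) = ∑' s : Multiset κ, (if s.card = k then g s * mon s u else 0) := by
      have h3 := (L1.hasSum_lift (monCMM k) 1 (norm_monCMM_le k) g).mapL
        (ContinuousMultilinearMap.apply ℝ (fun _ : Fin k => κ → ℝ) ℝ (fun _ => u))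
      have h4 := h3.tsum_eq
      simp only [ContinuousMultilinearMap.apply_apply, map_smul, monCMM_apply] at h4
      rw [evSeries, ← h4]
      congr 1
      ext s
      split_ifs <;> simp
    rw [h2]
    have h6 : (fun s : Multiset κ => (if s.card = k then g s * mon s u else 0)) =
        Set.indicator {s | s.card = k} (fun s => g s * mon s u) := by
      ext s
      simp [Set.indicator_apply]
    rw [h6]
    exact hasSum_subtype_iff_indicator.2
      ((hasSum_evF u hu1 g).summable.indicator {s | s.card = k}).hasSum

lemma analyticOnNhd_evF (g : L1 (Multiset κ)) : AnalyticOnNhd ℝ (evF g) (ball 0 1) := by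
  have := (hasFPowerSeriesOnBall_evF g).analyticOnNhd
  rwa [← ENNReal.ofReal_one, Metric.eball_ofReal] at this


/-- An absolutely summable family of words gives an element of `InA`. -/
lemma InA_of_hasFPowerSeriesOnBall {f : (κ → ℝ) → ℝ} {p : FormalMultilinearSeries ℝ (κ → ℝ) ℝ}
    {r : ENNReal} (hf : HasFPowerSeriesOnBall f p 0 r) {ρ : NNReal} (w : κ → ℝ)
    (hw : ∀ i, |w i| ≤ ρ) (hr : ((Fintype.card κ : NNReal) * ρ : NNReal) < r) (hρ : (ρ : ENNReal) < r) :
    InA w f := by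
  classical
  let c : (Σ k : ℕ, (Fin k → κ)) → ℝ := fun q => p q.1 (fun j => Pi.single (q.2 j) (w (q.2 j)))
  have hc : ∀ q, |c q| ≤ ‖p q.1‖ * (ρ : ℝ) ^ q.1 := by
    intro q
    refine ((p q.1).le_opNorm _).trans (mul_le_mul_of_nonneg_left ?_ (norm_nonneg _))
    refine (Finset.prod_le_prod (fun _ _ => norm_nonneg _) (g := fun _ => (ρ : ℝ)) fun j _ => ?_).trans
      (by simp)
    rw [Pi.norm_single]
    exact hw _
  have hsum : Summable (fun q => |c q|) := by
    refine Summable.of_nonneg_of_le (fun _ => abs_nonneg _) hc ?_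
    rw [summable_sigma_of_nonneg (fun _ => by positivity)]
    refine ⟨fun k => Summable.of_finite, ?_⟩
    have := p.summable_norm_mul_pow (lt_of_lt_of_le hr hf.r_le)
    refine this.congr fun k => ?_
    have h7 : ∑' _ : Fin k → κ, ‖p k‖ * (ρ : ℝ) ^ k = Fintype.card κ ^ k * (‖p k‖ * (ρ : ℝ) ^ k) := by
      simp
    refine Eq.trans ?_ h7.symm
    push_cast
    ring
  let m : (Σ k : ℕ, (Fin k → κ)) → Multiset κ := fun q => Finset.univ.val.map q.2
  have hm : ∀ q x, mon (m q) x = ∏ j, x (q.2 j) := by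
    intro q x
    simp [mon, m, Finset.prod, Function.comp_def]
  have hcs : Summable (fun q => c q • (L1.e (m q) : L1 (Multiset κ))) := by
    refine Summable.of_norm (hsum.congr fun q => ?_)
    rw [norm_smul, L1.norm_e, mul_one]
    rfl
  refine ⟨∑' q, c q • L1.e (m q), fun u hu => ?_⟩
  have h1 : HasSum (fun q => c q * mon (m q) u) (evF (∑' q, c q • L1.e (m q)) u) := by
    rw [evF_eq u hu]
    have := hcs.hasSum.mapL (evL u hu)
    simpa [evL] using this
  have hx : (fun i => w i * u i) ∈ Metric.eball (0 : κ → ℝ) r := by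
    refine lt_of_le_of_lt ?_ hρ
    rw [edist_zero_right, ← ofReal_norm, ← ENNReal.ofReal_coe_nnreal]
    refine ENNReal.ofReal_le_ofReal ((pi_norm_le_iff_of_nonneg ρ.2).2 fun i => ?_)
    rw [norm_mul]
    exact (mul_le_of_le_one_right (norm_nonneg _) (hu i)).trans (hw i)
  have h2 := hf.hasSum hx
  rw [zero_add] at h2
  refine h2.unique ?_
  refine h1.sigma fun k => ?_
  have h3 : p k (fun _ => fun i => w i * u i) = ∑ q : Fin k → κ, c ⟨k, q⟩ * mon (m ⟨k, q⟩) u := by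
    have h4 : (fun i => w i * u i) = ∑ i, u i • (Pi.single i (w i) : κ → ℝ) := by
      ext j
      simp [Finset.sum_apply, Pi.single_apply, mul_comm]
    rw [h4, ContinuousMultilinearMap.map_sum]
    refine Finset.sum_congr rfl fun q _ => ?_
    rw [ContinuousMultilinearMap.map_smul_univ, hm, smul_eq_mul, mul_comm]
  rw [h3]
  exact hasSum_fintype _

lemma exists_InA_of_analyticAt {f : (κ → ℝ) → ℝ} (hf : AnalyticAt ℝ f 0) :
    ∃ ρ : ℝ, 0 < ρ ∧ ∀ w : κ → ℝ, (∀ i, |w i| ≤ ρ) → InA w f := by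
  obtain ⟨p, r, hp⟩ := hf
  obtain ⟨ε, hε, hεr⟩ := ENNReal.lt_iff_exists_nnreal_btwn.1 hp.r_pos
  have hε' : 0 < ε := by simpa using hε
  have h0 : (0 : NNReal) < Fintype.card κ + 1 := by positivity
  refine ⟨(ε / (Fintype.card κ + 1) : NNReal), by positivity, fun w hw => ?_⟩
  refine InA_of_hasFPowerSeriesOnBall hp w hw (lt_of_le_of_lt ?_ hεr) (lt_of_le_of_lt ?_ hεr)
  · rw [ENNReal.coe_le_coe, ← mul_div_assoc, div_le_iff₀ h0, mul_comm]
    exact mul_le_mul_right (by simp) _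
  · rw [ENNReal.coe_le_coe]
    exact div_le_self zero_le (by simp)

lemma InA.analyticAt {f : (κ → ℝ) → ℝ} {w : κ → ℝ} (hw : ∀ i, 0 < w i) (hf : InA w f)
    {x : κ → ℝ} (hx : ∀ i, |x i| < w i) : AnalyticAt ℝ f x := by
  obtain ⟨g, hg⟩ := hf
  have h1 : ∀ᶠ y in nhds x, ∀ i, |y i| < w i := by
    rw [Filter.eventually_all]
    intro i
    exact ((continuous_abs.comp (continuous_apply i)).tendsto x).eventually_lt_const (hx i)
  have h2 : AnalyticAt ℝ (fun y : κ → ℝ => evF g (fun i => (w i)⁻¹ * y i)) x := by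
    refine AnalyticAt.fun_comp (f := fun y : κ → ℝ => fun i => (w i)⁻¹ * y i) ?_ ?_
    · refine analyticOnNhd_evF g _ ?_
      rw [mem_ball_zero_iff, pi_norm_lt_iff zero_lt_one]
      intro i
      rw [norm_mul, norm_inv, Real.norm_of_nonneg (hw i).le, inv_mul_lt_iff₀ (hw i), mul_one]
      exact hx i
    · rw [analyticAt_pi_iff]
      intro i
      exact analyticAt_const.mul ((ContinuousLinearMap.proj (R := ℝ) (φ := fun _ : κ => ℝ) i).analyticAt x)
  refine h2.congr ?_
  filter_upwards [h1] with y hy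
  rw [← hg]
  · congr 1
    ext i
    field_simp [(hw i).ne']
  · intro i
    rw [abs_mul, abs_inv, abs_of_pos (hw i), inv_mul_le_iff₀ (hw i), mul_one]
    exact (hy i).le

end mon

section division
variable {κ : Type*}

/-- Multiplication of a power series by a monomial. -/
def mulMon (h : L1 (Multiset κ)) (t : Multiset κ) : L1 (Multiset κ) :=
  L1.lift (fun s => L1.e (s + t)) 1 (fun s => (L1.norm_e _).le) h

lemma norm_mulMon_le (h : L1 (Multiset κ)) (t : Multiset κ) : ‖mulMon h t‖ ≤ ‖h‖ :=
  (ContinuousLinearMap.le_opNorm _ _).trans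
    (mul_le_of_le_one_left (norm_nonneg _) (L1.norm_lift_le _ 1 zero_le_one _))

@[simp] lemma evL_e (u : κ → ℝ) (hu : ∀ i, |u i| ≤ 1) (s : Multiset κ) :
    evL u hu (L1.e s) = mon s u := L1.lift_e _ _ _ _

lemma evL_mulMon (u : κ → ℝ) (hu : ∀ i, |u i| ≤ 1) (h : L1 (Multiset κ)) (t : Multiset κ) :
    evL u hu (mulMon h t) = evL u hu h * mon t u := by
  have : (evL u hu).comp (L1.lift (fun s => L1.e (s + t)) 1 (fun s => (L1.norm_e _).le)) =
      mon t u • evL u hu := by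
    apply L1.ext_clm
    intro s
    simp [mon_add, mul_comm]
  have := DFunLike.congr_fun this h
  simpa [mulMon, mul_comm] using this

variable [Fintype κ] [DecidableEq κ]

/-- The exponents of the reduced monomials: below `N i` in the directions `i ∈ S`, and zero in the
other directions. -/
def redExp (S : Finset κ) (N : κ → ℕ) : Finset (κ → ℕ) :=
  Fintype.piFinset fun i => Finset.range (if i ∈ S then N i else 1)

/-- Truncation of the exponent multiset to the directions in `S`. -/
def expOn (S : Finset κ) (s : Multiset κ) : κ → ℕ := fun i => if i ∈ S then s.count i else 0

lemma mon_split (S : Finset κ) (s : Multiset κ) (u : κ → ℝ) :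
    mon s u = (∏ i, u i ^ expOn S s i) * mon (s.filter (· ∉ S)) u := by
  conv_lhs => rw [← Multiset.filter_add_not (· ∈ S) s]
  rw [mon_add]
  congr 1
  rw [mon, Finset.prod_multiset_map_count]
  refine (Finset.prod_subset (Finset.subset_univ _) ?_).trans ?_
  · intro i _ hi
    rw [Multiset.mem_toFinset, ← Multiset.count_eq_zero] at hi
    rw [hi, pow_zero]
  · refine Finset.prod_congr rfl fun i _ => ?_
    rw [expOn, Multiset.count_filter]

/-- Abstract division step on the unit polydisc. -/
theorem division_unit (S : Finset κ) (N : κ → ℕ) (h : κ → L1 (Multiset κ))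
    (hh : ∀ i ∈ S, ‖h i‖ ≤ 1 / 2) (g : L1 (Multiset κ)) :
    ∃ R : (κ → ℕ) → L1 (Multiset κ),
      (∀ β (u v : κ → ℝ), (∀ i, |u i| ≤ 1) → (∀ i, |v i| ≤ 1) → (∀ j ∉ S, u j = v j) →
        evF (R β) u = evF (R β) v) ∧
      ∀ u : κ → ℝ, (∀ i, |u i| ≤ 1) → (∀ i ∈ S, u i ^ N i + evF (h i) u = 0) →
        evF g u = ∑ β ∈ redExp S N, evF (R β) u * ∏ i, u i ^ β i := by
  classical
  let good : Multiset κ → κ → Prop := fun s i => i ∈ S ∧ N i ≤ s.count i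
  let v : Multiset κ → L1 (Multiset κ) := fun s =>
    if hs : ∃ i, good s i then
      mulMon (h hs.choose) (s - Multiset.replicate (N hs.choose) hs.choose) else 0
  have hv : ∀ s, ‖v s‖ ≤ 1 / 2 := by
    intro s
    simp only [v]
    split_ifs with hs
    · exact (norm_mulMon_le _ _).trans (hh _ hs.choose_spec.1)
    · simp
  let K : L1 (Multiset κ) →L[ℝ] L1 (Multiset κ) := L1.lift v (1 / 2) hv
  have hK : ‖-K‖ < 1 := by
    rw [norm_neg]
    exact (L1.norm_lift_le v _ (by norm_num) hv).trans_lt (by norm_num)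
  let U := Units.oneSub (-K) hK
  obtain ⟨g', hg'⟩ : ∃ g', g' + K g' = g := by
    refine ⟨(↑U⁻¹ : L1 (Multiset κ) →L[ℝ] L1 (Multiset κ)) g, ?_⟩
    have h1 := DFunLike.congr_fun U.mul_inv g
    simpa [U, Units.val_oneSub, sub_eq_add_neg] using h1
  let vR : (κ → ℕ) → Multiset κ → L1 (Multiset κ) := fun β s =>
    if (¬ ∃ i, good s i) ∧ expOn S s = β then L1.e (s.filter (· ∉ S)) else 0
  have hvR : ∀ β s, ‖vR β s‖ ≤ 1 := by
    intro β s
    simp only [vR]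
    split_ifs
    · exact (L1.norm_e _).le
    · simp
  refine ⟨fun β => L1.lift (vR β) 1 (hvR β) g', ?_, ?_⟩
  · intro β u v' hu hv' huv
    have : (evL u hu).comp (L1.lift (vR β) 1 (hvR β)) =
        (evL v' hv').comp (L1.lift (vR β) 1 (hvR β)) := by
      apply L1.ext_clm
      intro s
      simp only [ContinuousLinearMap.comp_apply, L1.lift_e, vR]
      split_ifs
      · rw [evL_e, evL_e]
        exact mon_congr fun i hi => huv i (Multiset.mem_filter.1 hi).2
      · simp
    exact DFunLike.congr_fun this g'
  · intro u hu hP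
    have key : (evL u hu) + (evL u hu).comp K =
        ∑ β ∈ redExp S N, (∏ i, u i ^ β i) • (evL u hu).comp (L1.lift (vR β) 1 (hvR β)) := by
      apply L1.ext_clm
      intro s
      simp only [add_apply, ContinuousLinearMap.comp_apply, L1.lift_e, K,
        evL_e, sum_apply, smul_apply, smul_eq_mul]
      by_cases hs : ∃ i, good s i
      · have h0 : ∀ β, vR β s = 0 := fun β => by simp only [vR, hs, not_true, false_and, if_false]
        simp only [h0, map_zero, mul_zero, Finset.sum_const_zero]
        have h1 : v s = mulMon (h hs.choose) (s - Multiset.replicate (N hs.choose) hs.choose) :=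
          dif_pos hs
        rw [h1, evL_mulMon]
        have h2 := hP _ hs.choose_spec.1
        rw [evF_eq u hu] at h2
        have h3 : s = (s - Multiset.replicate (N hs.choose) hs.choose) +
            Multiset.replicate (N hs.choose) hs.choose :=
          (Multiset.sub_add_cancel (Multiset.le_count_iff_replicate_le.1 hs.choose_spec.2)).symm
        have h4 : mon s u = mon (s - Multiset.replicate (N hs.choose) hs.choose) u *
            u hs.choose ^ N hs.choose := by
          conv_lhs => rw [h3]
          rw [mon_add, mon_replicate]
        rw [h4]
        linear_combination mon (s - Multiset.replicate (N hs.choose) hs.choose) u * h2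
      · have h1 : v s = 0 := dif_neg hs
        rw [h1, map_zero, add_zero]
        have hmem : expOn S s ∈ redExp S N := by
          rw [redExp, Fintype.mem_piFinset]
          intro i
          rw [Finset.mem_range, expOn]
          split_ifs with hi
          · by_contra hc
            exact hs ⟨i, hi, not_lt.1 hc⟩
          · exact Nat.one_pos
        rw [Finset.sum_eq_single_of_mem _ hmem]
        · simp only [vR, hs, not_false_eq_true, and_self, if_true, evL_e]
          exact mon_split S s u
        · intro β _ hβ
          have : vR β s = 0 := if_neg fun hc => hβ hc.2.symm
          rw [this, map_zero, mul_zero]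
    have := DFunLike.congr_fun key g'
    simp only [add_apply, ContinuousLinearMap.comp_apply,
        sum_apply, smul_apply, smul_eq_mul] at this
    rw [← map_add, hg'] at this
    rw [evF_eq u hu, this]
    refine Finset.sum_congr rfl fun β _ => ?_
    rw [evF_eq u hu, mul_comm]

theorem division (S : Finset κ) (N : κ → ℕ) (P : κ → (κ → ℝ) → ℝ)
    (hP : ∀ i ∈ S, AnalyticAt ℝ (P i) 0)
    (hN : ∀ i ∈ S, ∀ᶠ x in nhds 0, (∀ j ∉ S, x j = 0) → P i x = x i ^ N i)
    {ε : ℝ} (hε : 0 < ε) :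
    ∃ w : κ → ℝ, (∀ i, 0 < w i ∧ w i ≤ ε) ∧ ∀ g, InA w g →
      ∃ r : (κ → ℕ) → (κ → ℝ) → ℝ, (∀ β, InA w (r β)) ∧
        (∀ β (x y : κ → ℝ), (∀ j ∉ S, x j = y j) → r β x = r β y) ∧
        ∀ x, (∀ i, |x i| ≤ w i) → (∀ i ∈ S, P i x = 0) →
          g x = ∑ β ∈ redExp S N, r β x * ∏ i, x i ^ β i := by
  classical
  have hN' : ∀ᶠ x in nhds (0 : κ → ℝ), ∀ i ∈ S, (∀ j ∉ S, x j = 0) → P i x = x i ^ N i := by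
    rw [Filter.eventually_all_finset]
    exact hN
  obtain ⟨δ₀, hδ₀, hδ⟩ := Metric.eventually_nhds_iff.1 hN'
  obtain ⟨ρ, hρ, hρε, hρδ, hρA⟩ : ∃ ρ : ℝ, 0 < ρ ∧ ρ ≤ ε ∧ ρ < δ₀ ∧
      ∀ i ∈ S, InA (fun _ => ρ) (P i) := by
    have h1 : ∀ i ∈ S, ∀ᶠ ρ in nhdsWithin (0 : ℝ) (Ioi 0), InA (fun _ => ρ) (P i) := by
      intro i hi
      obtain ⟨ρ₀, h0, hA⟩ := exists_InA_of_analyticAt (hP i hi)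
      filter_upwards [Ioo_mem_nhdsGT h0] with ρ hρ
      exact hA _ fun _ => by rw [abs_of_pos hρ.1]; exact hρ.2.le
    rw [← Filter.eventually_all_finset] at h1
    obtain ⟨ρ, hρ1, hρ2⟩ := (h1.and (Ioo_mem_nhdsGT (lt_min hε hδ₀))).exists
    exact ⟨ρ, hρ2.1, (hρ2.2.trans_le (min_le_left _ _)).le, hρ2.2.trans_le (min_le_right _ _), hρ1⟩
  choose! c hc using hρA
  obtain ⟨t, ht0, ht1, htc⟩ : ∃ t : ℝ, 0 < t ∧ t ≤ 1 ∧ ∀ i ∈ S, t / ρ ^ N i * ‖c i‖ ≤ 1 / 2 := by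
    have h1 : ∀ i ∈ S, ∀ᶠ t in nhdsWithin (0 : ℝ) (Ioi 0), t / ρ ^ N i * ‖c i‖ ≤ 1 / 2 := by
      intro i _
      have : Tendsto (fun t : ℝ => t / ρ ^ N i * ‖c i‖) (nhdsWithin 0 (Ioi 0)) (nhds 0) := by
        have h2 : Continuous (fun t : ℝ => t / ρ ^ N i * ‖c i‖) := by fun_prop
        have h3 := h2.tendsto 0
        simp only [zero_div, zero_mul] at h3
        exact h3.mono_left nhdsWithin_le_nhds
      exact this.eventually_le_const (by norm_num)
    rw [← Filter.eventually_all_finset] at h1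
    obtain ⟨t, ht1, ht2⟩ := (h1.and (Ioo_mem_nhdsGT zero_lt_one)).exists
    exact ⟨t, ht2.1, ht2.2.le, ht1⟩
  let τ : κ → ℝ := fun i => if i ∈ S then 1 else t
  have hτ : ∀ i, 0 < τ i ∧ τ i ≤ 1 := by
    intro i
    simp only [τ]
    split_ifs
    · simp
    · exact ⟨ht0, ht1⟩
  have hτu : ∀ u : κ → ℝ, (∀ i, |u i| ≤ 1) → ∀ i, |τ i * u i| ≤ 1 := by
    intro u hu i
    rw [abs_mul, abs_of_pos (hτ i).1]
    exact mul_le_one₀ (hτ i).2 (abs_nonneg _) (hu i)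
  let vh : ℕ → Multiset κ → L1 (Multiset κ) := fun n s =>
    if ∃ j ∈ s, j ∉ S then (mon s τ / ρ ^ n) • L1.e s else 0
  have hvh : ∀ n s, ‖vh n s‖ ≤ t / ρ ^ n := by
    intro n s
    simp only [vh]
    split_ifs with hs
    · obtain ⟨j, hj, hjS⟩ := hs
      rw [norm_smul, L1.norm_e, mul_one, norm_div, Real.norm_of_nonneg (pow_pos hρ n).le]
      refine div_le_div_of_nonneg_right ?_ (pow_pos hρ n).le
      obtain ⟨s', rfl⟩ := Multiset.exists_cons_of_mem hj
      rw [mon_cons, norm_mul]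
      have h1 : τ j = t := if_neg hjS
      rw [h1, Real.norm_of_nonneg ht0.le]
      refine mul_le_of_le_one_right ht0.le (abs_mon_le_one _ fun i => ?_)
      rw [abs_of_pos (hτ i).1]
      exact (hτ i).2
    · rw [norm_zero]
      positivity
  let h : κ → L1 (Multiset κ) := fun i => L1.lift (vh (N i)) (t / ρ ^ N i) (hvh (N i)) (c i)
  have hh : ∀ i ∈ S, ‖h i‖ ≤ 1 / 2 := fun i hi =>
    ((ContinuousLinearMap.le_opNorm _ _).trans (mul_le_mul_of_nonneg_right
      (L1.norm_lift_le _ _ (by positivity) _) (norm_nonneg _))).trans (htc i hi)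
  let w : κ → ℝ := fun i => ρ * τ i
  have hw : ∀ i, 0 < w i := fun i => mul_pos hρ (hτ i).1
  have hPh : ∀ i ∈ S, ∀ u : κ → ℝ, (∀ i, |u i| ≤ 1) →
      P i (fun j => w j * u j) = ρ ^ N i * (u i ^ N i + evF (h i) u) := by
    intro i hi u hu
    let uS : κ → ℝ := fun j => if j ∈ S then u j else 0
    have huS : ∀ j, |uS j| ≤ 1 := by
      intro j
      simp only [uS]
      split_ifs
      · exact hu j
      · simp
    have e1 : P i (fun j => w j * u j) = evF (c i) (fun j => τ j * u j) := by
      rw [← hc i hi _ (hτu u hu)]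
      congr 1
      ext j
      simp only [w]
      ring
    have e2 : evF (c i) uS = (ρ * u i) ^ N i := by
      rw [← hc i hi _ huS, hδ _ i hi]
      · simp [uS, hi]
      · intro j hj
        simp [uS, hj]
      · rw [dist_zero_right]
        refine lt_of_le_of_lt ((pi_norm_le_iff_of_nonneg hρ.le).2 fun j => ?_) hρδ
        rw [norm_mul, Real.norm_of_nonneg hρ.le]
        exact mul_le_of_le_one_right hρ.le (huS j)
    have e3 : evL _ (hτu u hu) = evL uS huS +
        ρ ^ N i • (evL u hu).comp (L1.lift (vh (N i)) (t / ρ ^ N i) (hvh (N i))) := by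
      apply L1.ext_clm
      intro s
      simp only [add_apply, smul_apply,
        ContinuousLinearMap.comp_apply, L1.lift_e, evL_e, smul_eq_mul, vh]
      split_ifs with hs
      · obtain ⟨j, hj, hjS⟩ := hs
        rw [mon_eq_zero hj (by simp [uS, hjS] : uS j = 0), map_smul, evL_e, mon_mul, smul_eq_mul]
        field_simp
        ring
      · push Not at hs
        rw [map_zero, mul_zero, add_zero]
        refine mon_congr fun j hj => ?_
        simp [τ, uS, hs j hj]
    have e4 := DFunLike.congr_fun e3 (c i)
    simp only [add_apply, smul_apply,
        ContinuousLinearMap.comp_apply, smul_eq_mul] at e4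
    rw [e1, evF_eq _ (hτu u hu), e4, ← evF_eq, e2, ← evF_eq]
    simp only [h]
    ring
  refine ⟨w, fun i => ⟨hw i, ?_⟩, fun g hg => ?_⟩
  · exact (mul_le_of_le_one_right hρ.le (hτ i).2).trans hρε
  · obtain ⟨G, hG⟩ := hg
    obtain ⟨R, hR1, hR2⟩ := division_unit S N h hh G
    refine ⟨fun β x => (∏ i, w i ^ β i)⁻¹ * evF (R β) (fun i => if i ∈ S then 0 else x i / w i),
      fun β => ?_, fun β x y hxy => ?_, fun x hx hPx => ?_⟩
    · refine ⟨(∏ i, w i ^ β i)⁻¹ • R β, fun u hu => ?_⟩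
      rw [evF_eq u hu, map_smul, ← evF_eq, smul_eq_mul]
      refine congrArg ((∏ i, w i ^ β i)⁻¹ * ·) (hR1 β _ _ (fun i => ?_) hu fun j hj => ?_)
      · split_ifs
        · simp
        · rw [mul_div_cancel_left₀ _ (hw i).ne']
          exact hu i
      · rw [if_neg hj, mul_div_cancel_left₀ _ (hw j).ne']
    · have h1 : (fun i => if i ∈ S then 0 else x i / w i) =
          fun i => if i ∈ S then 0 else y i / w i := by
        ext j
        split_ifs with hj
        · rfl
        · rw [hxy j hj]
      simp only [h1]
    · let u : κ → ℝ := fun i => x i / w i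
      have hu : ∀ i, |u i| ≤ 1 := by
        intro i
        rw [abs_div, abs_of_pos (hw i)]
        exact div_le_one_of_le₀ (hx i) (hw i).le
      have hxu : x = fun i => w i * u i := by
        ext i
        exact (mul_div_cancel₀ _ (hw i).ne').symm
      have h1 := hR2 u hu fun i hi => by
        have := hPh i hi u hu
        rw [← hxu, hPx i hi] at this
        exact (mul_eq_zero.1 this.symm).resolve_left (pow_pos hρ _).ne'
      rw [hxu, hG u hu, h1]
      refine Finset.sum_congr rfl fun β _ => ?_
      have h2 : evF (R β) u = evF (R β) (fun i => if i ∈ S then 0 else w i * u i / w i) := by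
        refine hR1 β _ _ hu (fun i => ?_) fun j hj => ?_
        · split_ifs
          · simp
          · rw [mul_div_cancel_left₀ _ (hw i).ne']
            exact hu i
        · rw [if_neg hj, mul_div_cancel_left₀ _ (hw j).ne']
      have h3 : ∏ i, w i ^ β i ≠ 0 := Finset.prod_ne_zero_iff.2 fun i _ => (pow_pos (hw i) _).ne'
      simp only [mul_pow, Finset.prod_mul_distrib]
      rw [h2]
      field_simp

end division

section noether
variable {κ : Type*} [Fintype κ] [DecidableEq κ]

/-- Hadamard-type factorisation of an analytic function along one coordinate. -/
lemma exists_analyticAt_mul_coord {f : (κ → ℝ) → ℝ} (hf : AnalyticAt ℝ f 0) (j : κ) :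
    ∃ q : (κ → ℝ) → ℝ, AnalyticAt ℝ q 0 ∧
      ∀ᶠ x in nhds 0, f x - f (Function.update x j 0) = x j * q x := by
  obtain ⟨ρ, hρ, hA⟩ := exists_InA_of_analyticAt hf
  obtain ⟨g, hg⟩ := hA (fun _ => ρ) (fun _ => (abs_of_pos hρ).le)
  let v : Multiset κ → L1 (Multiset κ) := fun s => if j ∈ s then L1.e (s.erase j) else 0
  have hv : ∀ s, ‖v s‖ ≤ 1 := by
    intro s
    simp only [v]
    split_ifs
    · exact (L1.norm_e _).le
    · simp
  let g' := L1.lift v 1 hv g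
  have key : ∀ u : κ → ℝ, (∀ i, |u i| ≤ 1) →
      evF g u - evF g (Function.update u j 0) = u j * evF g' u := by
    intro u hu
    have hu' : ∀ i, |Function.update u j 0 i| ≤ 1 := by
      intro i
      by_cases hi : i = j
      · subst hi; simp
      · simp [hi, hu i]
    have : evL u hu - evL _ hu' = u j • (evL u hu).comp (L1.lift v 1 hv) := by
      apply L1.ext_clm
      intro s
      simp only [sub_apply, smul_apply, ContinuousLinearMap.comp_apply, L1.lift_e, evL_e, v,
        smul_eq_mul]
      split_ifs with hs
      · rw [mon_eq_zero hs (by simp : Function.update u j 0 j = 0), evL_e, sub_zero, ← mon_cons,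
          Multiset.cons_erase hs]
      · rw [map_zero, mul_zero, sub_eq_zero]
        refine mon_congr fun i hi => ?_
        rw [Function.update_of_ne]
        rintro rfl
        exact hs hi
    exact DFunLike.congr_fun this g
  refine ⟨fun x => ρ⁻¹ * evF g' (ρ⁻¹ • x), ?_, ?_⟩
  · refine analyticAt_const.mul (AnalyticAt.fun_comp (g := evF g') ?_ ?_)
    · rw [smul_zero]
      exact analyticOnNhd_evF g' 0 (mem_ball_self one_pos)
    · exact ((ρ⁻¹ • ContinuousLinearMap.id ℝ (κ → ℝ)).analyticAt _)
  · filter_upwards [ball_mem_nhds (0 : κ → ℝ) hρ] with x hx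
    rw [mem_ball_zero_iff] at hx
    have hxu : ∀ y : κ → ℝ, y = fun i => ρ * (ρ⁻¹ • y) i := by
      intro y
      ext i
      simp [hρ.ne']
    have hu : ∀ i, |(ρ⁻¹ • x) i| ≤ 1 := by
      intro i
      rw [Pi.smul_apply, smul_eq_mul, abs_mul, abs_of_pos (inv_pos.2 hρ), inv_mul_le_iff₀ hρ,
        mul_one]
      exact (norm_le_pi_norm x i).trans hx.le
    have hu2 : ρ⁻¹ • Function.update x j 0 = Function.update (ρ⁻¹ • x) j 0 := by
      ext i
      by_cases hi : i = j
      · subst hi; simp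
      · simp [hi]
    have hu' : ∀ i, |(ρ⁻¹ • Function.update x j 0) i| ≤ 1 := by
      intro i
      rw [hu2]
      by_cases hi : i = j
      · subst hi; simp
      · simpa [hi] using hu i
    have e1 := hg _ hu
    have e2 := hg _ hu'
    rw [← hxu] at e1 e2
    rw [e1, e2, hu2, key _ hu]
    simp only [Pi.smul_apply, smul_eq_mul]
    ring

/-- A nonzero analytic germ has a direction along which it does not vanish identically. -/
lemma exists_line_not_eventually_zero {V : Type*} [NormedAddCommGroup V] [NormedSpace ℝ V]
    {Q : V → ℝ} (hQ : AnalyticAt ℝ Q 0)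
    (hQ0 : ¬ ∀ᶠ x in nhds 0, Q x = 0) : ∃ c : V, ¬ ∀ᶠ τ : ℝ in nhds 0, Q (τ • c) = 0 := by
  by_contra! hc
  apply hQ0
  obtain ⟨r, hr, hQr⟩ := hQ.exists_ball_analyticOnNhd
  filter_upwards [ball_mem_nhds (0 : V) hr] with c hcr
  let f : ℝ → ℝ := fun τ => Q (τ • c)
  have hU : IsPreconnected {τ : ℝ | τ • c ∈ ball (0 : V) r} := by
    have : Convex ℝ {τ : ℝ | τ • c ∈ ball (0 : V) r} :=
      (convex_ball (0 : V) r).linear_preimage (LinearMap.toSpanSingleton ℝ V c)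
    exact this.isPreconnected
  have hf : AnalyticOnNhd ℝ f {τ : ℝ | τ • c ∈ ball (0 : V) r} := fun τ hτ =>
    AnalyticAt.fun_comp (g := Q) (f := fun τ : ℝ => τ • c) (hQr _ hτ)
      ((ContinuousLinearMap.toSpanSingleton ℝ c).analyticAt _)
  have := hf.eqOn_zero_of_preconnected_of_eventuallyEq_zero hU (z₀ := 0)
    (by simp [hr]) (hc c) (x := 1) (by simpa using hcr)
  simpa [f] using this

/-- Noether-type normalisation data for a set `Z` at the origin in the linear coordinates `e`. -/
def NoetherData {V : Type*} [NormedAddCommGroup V] [NormedSpace ℝ V] (Z : Set V)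
    (S : Finset κ) (e : V ≃L[ℝ] (κ → ℝ)) (N : κ → ℕ) (P : κ → (κ → ℝ) → ℝ) : Prop :=
  (∀ i ∈ S, AnalyticAt ℝ (P i) 0) ∧
  (∀ i ∈ S, ∀ᶠ x in nhds 0, (∀ j ∉ S, x j = 0) → P i x = x i ^ N i) ∧
  (∀ i ∈ S, ∀ᶠ x in nhds 0, x ∈ Z → P i (e x) = 0)

/-- The shear `x ↦ x + x j • v` for a vector `v` with `v j = 0`. -/
def shear (j : κ) (v : κ → ℝ) (hv : v j = 0) : (κ → ℝ) ≃L[ℝ] (κ → ℝ) :=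
  LinearEquiv.toContinuousLinearEquiv
    { toFun := fun x => x + x j • v
      invFun := fun x => x - x j • v
      map_add' := fun x y => by ext i; simp; ring
      map_smul' := fun c x => by ext i; simp; ring
      left_inv := fun x => by ext i; simp [hv]
      right_inv := fun x => by ext i; simp [hv] }

lemma shear_apply (j : κ) (v : κ → ℝ) (hv : v j = 0) (x : κ → ℝ) :
    shear j v hv x = x + x j • v := rfl

lemma noether_descent {V : Type*} [NormedAddCommGroup V] [NormedSpace ℝ V] {Z : Set V}
    (h0 : (0 : V) ∈ Z) {S : Finset κ} {e : V ≃L[ℝ] (κ → ℝ)} {N : κ → ℕ} {P : κ → (κ → ℝ) → ℝ}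
    (hD : NoetherData Z S e N P) {Q : (κ → ℝ) → ℝ} (hQ : AnalyticAt ℝ Q 0)
    (hQS : ∀ x y : κ → ℝ, (∀ j ∉ S, x j = y j) → Q x = Q y)
    (hQZ : ∀ᶠ x in nhds 0, x ∈ Z → Q (e x) = 0) (hQ0 : ¬ ∀ᶠ x in nhds 0, Q x = 0) :
    ∃ j ∉ S, ∃ (e' : V ≃L[ℝ] (κ → ℝ)) (N' : κ → ℕ) (P' : κ → (κ → ℝ) → ℝ),
      NoetherData Z (insert j S) e' N' P' := by
  obtain ⟨hP, hN, hZ⟩ := hD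
  obtain ⟨c₀, hc₀⟩ := exists_line_not_eventually_zero hQ hQ0
  have hQ00 : Q 0 = 0 := by
    have := hQZ.self_of_nhds h0
    rwa [map_zero] at this
  obtain ⟨j, hjS, hj⟩ : ∃ j ∉ S, c₀ j ≠ 0 := by
    by_contra! h
    refine hc₀ (Eventually.of_forall fun τ => ?_)
    rw [← hQ00]
    refine hQS _ _ fun j hj => ?_
    simp [h j hj]
  let c : κ → ℝ := fun i => if i ∈ S then 0 else c₀ i / c₀ j
  have hcj : c j = 1 := by simp [c, hjS, hj]
  have hc : ¬ ∀ᶠ τ : ℝ in nhds 0, Q (τ • c) = 0 := by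
    intro h
    apply hc₀
    have h1 : Tendsto (fun τ : ℝ => τ * c₀ j) (nhds 0) (nhds 0) := by
      have : Continuous fun τ : ℝ => τ * c₀ j := by fun_prop
      simpa using this.tendsto 0
    filter_upwards [h1.eventually h] with τ hτ
    rw [← hτ]
    refine hQS _ _ fun i hi => ?_
    simp only [c, Pi.smul_apply, smul_eq_mul, if_neg hi]
    field_simp
  have hq : AnalyticAt ℝ (fun τ : ℝ => Q (τ • c)) 0 := by
    refine AnalyticAt.fun_comp (g := Q) (f := fun τ : ℝ => τ • c) ?_
      ((ContinuousLinearMap.toSpanSingleton ℝ c).analyticAt _)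
    simpa using hQ
  obtain ⟨k, u, hu, hu0, hqu⟩ := hq.exists_eventuallyEq_pow_smul_nonzero_iff.2 hc
  simp only [sub_zero, smul_eq_mul] at hqu
  let A := shear j (c - Pi.single j 1) (by simp [hcj])
  have hA : ∀ x, A x = x + x j • (c - Pi.single j 1) := fun x => shear_apply _ _ _ x
  have hAan : ∀ {f : (κ → ℝ) → ℝ}, AnalyticAt ℝ f 0 → AnalyticAt ℝ (fun x => f (A x)) 0 := by
    intro f hf
    refine AnalyticAt.fun_comp (g := f) ?_ ((A : (κ → ℝ) →L[ℝ] (κ → ℝ)).analyticAt 0)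
    simpa using hf
  have hA0 : Tendsto A (nhds 0) (nhds 0) := by
    simpa using A.continuous.tendsto 0
  have hj0 : Tendsto (fun x : κ → ℝ => x j) (nhds 0) (nhds 0) := by
    simpa using (continuous_apply j).tendsto (0 : κ → ℝ)
  have hupd : Tendsto (fun x : κ → ℝ => Function.update x j 0) (nhds 0) (nhds 0) := by
    have h1 : Continuous fun x : κ → ℝ => Function.update x j 0 :=
      continuous_id.update j continuous_const
    have h2 := h1.tendsto 0
    have h3 : Function.update (0 : κ → ℝ) j 0 = 0 := Function.update_eq_self j (0 : κ → ℝ)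
    rwa [h3] at h2
  have hj_an : AnalyticAt ℝ (fun x : κ → ℝ => x j) 0 :=
    (ContinuousLinearMap.proj (R := ℝ) (φ := fun _ : κ => ℝ) j).analyticAt _
  have huj : AnalyticAt ℝ (fun x : κ → ℝ => u (x j)) 0 :=
    AnalyticAt.fun_comp (g := u) (by simpa using hu) hj_an
  let Q' : (κ → ℝ) → ℝ := fun x => Q (A x) / u (x j)
  have hQ' : AnalyticAt ℝ Q' 0 := (hAan hQ).fun_div huj (by simpa using hu0)
  have hp : ∀ i ∈ S, ∃ q : (κ → ℝ) → ℝ, AnalyticAt ℝ q 0 ∧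
      ∀ᶠ x in nhds 0, P i (A x) - P i (A (Function.update x j 0)) = x j * q x := fun i hi =>
    exists_analyticAt_mul_coord (hAan (hP i hi)) j
  choose! q hq_an hq using hp
  let e' : V ≃L[ℝ] (κ → ℝ) := e.trans A.symm
  have he' : ∀ x, A (e' x) = e x := fun x => by simp [e']
  have he0 : Tendsto e' (nhds 0) (nhds 0) := by
    simpa using e'.continuous.tendsto 0
  have hQ'Z : ∀ᶠ x in nhds 0, x ∈ Z → Q' (e' x) = 0 := by
    filter_upwards [hQZ] with x hx hxZ
    simp only [Q', he', hx hxZ, zero_div]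
  have hQ'N : ∀ᶠ x in nhds (0 : κ → ℝ), (∀ l ∉ insert j S, x l = 0) → Q' x = x j ^ k := by
    have h1 : ∀ᶠ τ in nhds (0 : ℝ), u τ ≠ 0 := hu.continuousAt.eventually_ne hu0
    filter_upwards [hj0.eventually h1, hj0.eventually hqu] with x hx1 hx2 hx
    have h2 : Q (A x) = Q (x j • c) := by
      refine hQS _ _ fun l hl => ?_
      by_cases hlj : l = j
      · subst hlj
        simp [hA, hcj]
      · simp [hA, hlj, hx l (by simp [hlj, hl])]
    simp only [Q', h2, hx2]
    field_simp
  let P' : κ → (κ → ℝ) → ℝ := fun i => if i = j then Q' else fun x =>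
    x i ^ (N i * k) - (x i ^ N i - P i (A x)) ^ k + (-1) ^ k * Q' x * q i x ^ k
  let N' : κ → ℕ := fun i => if i = j then k else N i * k
  have hne : ∀ i ∈ S, i ≠ j := by
    rintro i hi rfl
    exact hjS hi
  have hi_an : ∀ i, AnalyticAt ℝ (fun x : κ → ℝ => x i) 0 := fun i =>
    (ContinuousLinearMap.proj (R := ℝ) (φ := fun _ : κ => ℝ) i).analyticAt _
  refine ⟨j, hjS, e', N', P', fun i hi => ?_, fun i hi => ?_, fun i hi => ?_⟩
  · rcases Finset.mem_insert.1 hi with rfl | hi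
    · simpa [P'] using hQ'
    · simp only [P', if_neg (hne i hi)]
      exact (((hi_an i).fun_pow _).fun_sub ((((hi_an i).fun_pow _).fun_sub (hAan (hP i hi))).fun_pow _)).fun_add
        ((analyticAt_const.fun_mul hQ').fun_mul ((hq_an i hi).fun_pow _))
  · rcases Finset.mem_insert.1 hi with rfl | hi
    · simpa [P', N'] using hQ'N
    · simp only [P', N', if_neg (hne i hi)]
      filter_upwards [hQ'N, hq i hi, (hA0.comp hupd).eventually (hN i hi)] with x hx1 hx2 hx3 hx
      rw [hx1 hx]
      have h1 : A (Function.update x j 0) = Function.update x j 0 := by simp [hA]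
      simp only [Function.comp_apply] at hx3
      rw [hx3] at hx2
      · rw [h1, Function.update_of_ne (hne i hi)] at hx2
        have h2 : x i ^ N i - P i (A x) = - (x j * q i x) := by linarith
        rw [h2, neg_pow, mul_pow]
        ring
      · intro l hl
        rw [h1]
        by_cases hlj : l = j
        · subst hlj; simp
        · rw [Function.update_of_ne hlj]
          exact hx l (by simp [hlj, hl])
  · rcases Finset.mem_insert.1 hi with rfl | hi
    · simpa [P'] using hQ'Z
    · simp only [P', if_neg (hne i hi)]
      filter_upwards [hQ'Z, hZ i hi] with x hx1 hx2 hx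
      rw [hx1 hx, he', hx2 hx]
      ring

theorem exists_noetherData {V : Type*} [NormedAddCommGroup V] [NormedSpace ℝ V] {Z : Set V}
    (h0 : (0 : V) ∈ Z) (e₀ : V ≃L[ℝ] (κ → ℝ)) :
    ∃ (S : Finset κ) (e : V ≃L[ℝ] (κ → ℝ)) (N : κ → ℕ) (P : κ → (κ → ℝ) → ℝ),
      NoetherData Z S e N P ∧ ∀ Q : (κ → ℝ) → ℝ, AnalyticAt ℝ Q 0 →
        (∀ x y : κ → ℝ, (∀ j ∉ S, x j = y j) → Q x = Q y) →
        (∀ᶠ x in nhds 0, x ∈ Z → Q (e x) = 0) → ∀ᶠ x in nhds 0, Q x = 0 := by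
  let T : Set (Finset κ) := {S | ∃ (e : V ≃L[ℝ] (κ → ℝ)) (N : κ → ℕ) (P : κ → (κ → ℝ) → ℝ),
    NoetherData Z S e N P}
  have hT : T.Nonempty := ⟨∅, e₀, 0, 0, by simp [NoetherData]⟩
  obtain ⟨S, hS, hmax⟩ := Set.exists_max_image T Finset.card T.toFinite hT
  obtain ⟨e, N, P, hD⟩ := hS
  refine ⟨S, e, N, P, hD, fun Q hQ hQS hQZ => ?_⟩
  by_contra hQ0
  obtain ⟨j, hj, e', N', P', hD'⟩ := noether_descent h0 hD hQ hQS hQZ hQ0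
  have := hmax _ ⟨e', N', P', hD'⟩
  rw [Finset.card_insert_of_notMem hj] at this
  omega

end noether

section charpolyRelation
variable {κ : Type*} [Fintype κ] [DecidableEq κ]

lemma InA_mon (w : κ → ℝ) (s : Multiset κ) : InA w (mon s) :=
  ⟨mon s w • L1.e s, fun u hu => by
    rw [evF_eq u hu, map_smul, evL_e, smul_eq_mul, mon_mul]⟩

lemma prod_pow_eq_mon (β : κ → ℕ) (x : κ → ℝ) :
    ∏ i, x i ^ β i = mon (∑ i, Multiset.replicate (β i) i) x := by
  have h : ∀ T : Finset κ, mon (∑ i ∈ T, Multiset.replicate (β i) i) x = ∏ i ∈ T, x i ^ β i := by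
    intro T
    induction T using Finset.induction_on with
    | empty => simp [mon]
    | insert a T ha ih => rw [Finset.sum_insert ha, Finset.prod_insert ha, mon_add, ih, mon_replicate]
  exact (h _).symm

lemma analyticAt_charpoly_coeff {n V : Type*} [Fintype n] [DecidableEq n] [NormedAddCommGroup V]
    [NormedSpace ℝ V] {M : V → Matrix n n ℝ} {x : V}
    (hM : ∀ β γ, AnalyticAt ℝ (fun x => M x β γ) x) (k : ℕ) :
    AnalyticAt ℝ (fun x => (M x).charpoly.coeff k) x := by
  have h1 : ∀ x, (M x).charpoly.coeff k =
      MvPolynomial.aeval (fun p : n × n => M x p.1 p.2) ((Matrix.charpoly.univ ℝ n).coeff k) :=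
    fun x => (Matrix.charpoly.univ_coeff_eval₂Hom n (RingHom.id ℝ)
      (fun p : n × n => M x p.1 p.2) k).symm
  simp only [h1]
  generalize (Matrix.charpoly.univ ℝ n).coeff k = p
  exact AnalyticAt.aeval_mvPolynomial (f := fun x (p : n × n) => M x p.1 p.2)
    (fun p => hM p.1 p.2) p

/-- Each distinguished coordinate satisfies on the zero set a monic polynomial equation with
analytic coefficients in the remaining coordinates. -/
theorem exists_monic_relation (S : Finset κ) (N : κ → ℕ) (P : κ → (κ → ℝ) → ℝ)
    (hP : ∀ i ∈ S, AnalyticAt ℝ (P i) 0)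
    (hN : ∀ i ∈ S, ∀ᶠ x in nhds 0, (∀ j ∉ S, x j = 0) → P i x = x i ^ N i) :
    ∃ δ > 0, ∃ (B : ℕ) (c : κ → ℕ → (κ → ℝ) → ℝ),
      (∀ i k, AnalyticOnNhd ℝ (c i k) (ball 0 δ)) ∧
      (∀ i k x y, (∀ j ∉ S, x j = y j) → c i k x = c i k y) ∧
      ∀ x ∈ ball (0 : κ → ℝ) δ, (∀ i ∈ S, P i x = 0) →
        ∀ i, x i ^ B + ∑ k ∈ Finset.range B, c i k x * x i ^ k = 0 := by
  obtain ⟨w, hw, hdiv⟩ := division S N P hP hN one_pos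
  generalize redExp S N = R at hdiv
  have hmono : ∀ (i : κ) (β : κ → ℕ), InA w (fun x => x i * ∏ l, x l ^ β l) := by
    intro i β
    have : (fun x : κ → ℝ => x i * ∏ l, x l ^ β l) =
        mon (i ::ₘ ∑ l, Multiset.replicate (β l) l) := by
      ext x
      rw [mon_cons, prod_pow_eq_mon]
    rw [this]
    exact InA_mon _ _
  have hone : InA w (fun _ => 1) := by
    have : (fun _ : κ → ℝ => (1 : ℝ)) = mon 0 := by
      ext x
      simp [mon]
    rw [this]
    exact InA_mon _ _
  choose r hrA hrS hr using fun i β => hdiv _ (hmono i β)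
  obtain ⟨r₁, -, -, hr₁⟩ := hdiv _ hone
  let M : κ → (κ → ℝ) → Matrix R R ℝ := fun i x => Matrix.of fun β γ => r i β γ x
  obtain ⟨δ, hδ, hδw⟩ : ∃ δ > 0, ∀ i, δ ≤ w i := by
    have h1 : ∀ i, ∀ᶠ δ in nhdsWithin (0 : ℝ) (Ioi 0), δ ≤ w i := fun i => by
      filter_upwards [Ioo_mem_nhdsGT (hw i).1] with δ hδ using hδ.2.le
    obtain ⟨δ, h2, h3⟩ := ((eventually_all.2 h1).and self_mem_nhdsWithin).exists
    exact ⟨δ, h3, h2⟩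
  have hδx : ∀ x ∈ ball (0 : κ → ℝ) δ, ∀ i, |x i| < w i := fun x hx i =>
    ((norm_le_pi_norm x i).trans_lt (mem_ball_zero_iff.1 hx)).trans_le (hδw i)
  refine ⟨δ, hδ, Fintype.card R, fun i k x => (M i x).charpoly.coeff k, fun i k x hx => ?_,
    fun i k x y hxy => ?_, fun x hx hPx i => ?_⟩
  · exact analyticAt_charpoly_coeff (M := M i) (fun β γ =>
      (hrA i β γ).analyticAt (fun i => (hw i).1) (hδx x hx)) k
  · have : M i x = M i y := by
      ext β γ
      exact hrS i β γ x y hxy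
    simp only [this]
  · have hxw : ∀ i, |x i| ≤ w i := fun i => (hδx x hx i).le
    let v : R → ℝ := fun β => ∏ l, x l ^ β.1 l
    have hv : v ≠ 0 := by
      intro h0
      have h1 := hr₁ x hxw hPx
      rw [Finset.sum_eq_zero] at h1
      · exact one_ne_zero h1
      · intro β hβ
        have := congrFun h0 ⟨β, hβ⟩
        simp only [v, Pi.zero_apply] at this
        rw [this, mul_zero]
    have hMv : (Matrix.scalar R (x i) - M i x).mulVec v = 0 := by
      ext β
      rw [Matrix.sub_mulVec, Pi.sub_apply, Pi.zero_apply, sub_eq_zero]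
      have h1 := hr i β x hxw hPx
      simp only [Matrix.scalar_apply, Matrix.mulVec_diagonal, v]
      rw [h1, ← Finset.sum_coe_sort]
      rfl
    have hdet := Matrix.exists_mulVec_eq_zero_iff.1 ⟨v, hv, hMv⟩
    rw [← Matrix.eval_charpoly] at hdet
    have h2 := (Matrix.charpoly_monic (M i x)).as_sum
    rw [Matrix.charpoly_natDegree_eq_dim] at h2
    rw [h2] at hdet
    simpa [Polynomial.eval_finsetSum] using hdet

end charpolyRelation

section genericPrimitive
open Polynomial

lemma exists_common_denominator {A F K : Type*} [CommRing A] [IsDomain A] [Field F] [Algebra A F]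
    [IsFractionRing A F] [Fintype K] [DecidableEq K] (p : K → F[X]) :
    ∃ D : A, D ≠ 0 ∧ ∃ P : K → A[X], ∀ k, (P k).map (algebraMap A F) = C (algebraMap A F D) * p k := by
  choose b hb hbp using fun k => IsLocalization.integerNormalization_spec (nonZeroDivisors A) (p k)
  refine ⟨∏ k, b k, Finset.prod_ne_zero_iff.2 fun k _ => nonZeroDivisors.ne_zero (hb k), fun k =>
    C (∏ l ∈ Finset.univ.erase k, b l) * IsLocalization.integerNormalization (nonZeroDivisors A) (p k),
    fun k => ?_⟩
  rw [Polynomial.map_mul, hbp, map_C, ← Finset.prod_erase_mul _ _ (Finset.mem_univ k),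
    map_mul, C_mul, mul_assoc]
  congr 1
  rw [Algebra.smul_def, Polynomial.algebraMap_apply]

/-- Pseudo-division by a multiple of the minimal polynomial. -/
lemma exists_pow_mul_eq_of_aeval_eq_zero {A F L : Type*} [CommRing A] [IsDomain A] [Field F]
    [Field L] [Algebra A F] [IsFractionRing A F] [Algebra F L] {θ : L}
    (hθ : IsIntegral F θ) {D : A} (hD : D ≠ 0) {Q : A[X]}
    (hQ : Q.map (algebraMap A F) = C (algebraMap A F D) * minpoly F θ) (w : A[X])
    (hw : aeval θ (w.map (algebraMap A F)) = 0) : ∃ (k : ℕ) (g : A[X]), C D ^ k * w = Q * g := by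
  have hinj : Function.Injective (algebraMap A F) := IsFractionRing.injective A F
  have hD' : algebraMap A F D ≠ 0 := by simpa using hD
  have hQ0 : Q ≠ 0 := by
    rintro rfl
    rw [Polynomial.map_zero] at hQ
    exact mul_ne_zero (C_ne_zero.2 hD') (minpoly.ne_zero hθ) hQ.symm
  have hQdeg : Q.natDegree = (minpoly F θ).natDegree := by
    rw [← natDegree_map_eq_of_injective hinj, hQ, natDegree_C_mul hD']
  have hQlc : Q.leadingCoeff = D := by
    apply hinj
    rw [← leadingCoeff_map_of_injective hinj, hQ, leadingCoeff_mul, leadingCoeff_C,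
      (minpoly.monic hθ).leadingCoeff, mul_one]
  induction h : w.degree using WellFoundedLT.induction generalizing w with
  | ind n ih =>
    subst h
    by_cases hw0 : w = 0
    · exact ⟨0, 0, by simp [hw0]⟩
    have hw0' : w.map (algebraMap A F) ≠ 0 := by
      rwa [Ne, Polynomial.map_eq_zero_iff hinj]
    have hdeg : Q.natDegree ≤ w.natDegree := by
      rw [hQdeg, ← natDegree_map_eq_of_injective hinj w]
      exact natDegree_le_of_dvd (minpoly.dvd F θ hw) hw0'
    let w' := C D * w - C w.leadingCoeff * X ^ (w.natDegree - Q.natDegree) * Q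
    have hlt : w'.degree < w.degree := by
      have h1 : (C D * w).degree = w.degree := degree_C_mul hD
      rw [← h1]
      have hX : (C w.leadingCoeff * X ^ (w.natDegree - Q.natDegree) * Q).degree = w.degree := by
        rw [degree_mul, degree_C_mul_X_pow _ (leadingCoeff_ne_zero.2 hw0),
          degree_eq_natDegree hQ0, degree_eq_natDegree hw0, ← Nat.cast_add,
          Nat.sub_add_cancel hdeg]
      refine degree_sub_lt_left (h1.trans hX.symm) (mul_ne_zero (C_ne_zero.2 hD) hw0) ?_
      rw [leadingCoeff_mul, leadingCoeff_mul, leadingCoeff_mul, leadingCoeff_C, leadingCoeff_C,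
        leadingCoeff_X_pow, hQlc]
      ring
    have hQθ : aeval θ (Q.map (algebraMap A F)) = 0 := by
      rw [hQ, map_mul, minpoly.aeval, mul_zero]
    obtain ⟨k, g, hg⟩ := ih _ hlt w' (by
      simp only [w', Polynomial.map_sub, Polynomial.map_mul, map_sub, map_mul, hw, hQθ, mul_zero,
        sub_zero]) rfl
    refine ⟨k + 1, g + C D ^ k * (C w.leadingCoeff * X ^ (w.natDegree - Q.natDegree)), ?_⟩
    rw [mul_add, ← hg]
    simp only [w']
    ring

/-- Finitely many elements integral over a domain are rational functions of one generic element
with polynomial elimination. -/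
lemma exists_generic_primitive {A K κ : Type*} [CommRing A] [Field K] [CharZero K] [Fintype κ]
    [DecidableEq κ] (j : A →+* K) (hj : Function.Injective j) (t : κ → K)
    (ht : ∀ i, ∃ p : A[X], p.Monic ∧ p.eval₂ j (t i) = 0) :
    ∃ (θ : K) (D : A) (Q : A[X]) (b : κ → A[X]), D ≠ 0 ∧ (∀ i, j D * t i = (b i).eval₂ j θ) ∧
      Q.eval₂ j θ = 0 ∧ Q.derivative.eval₂ j θ ≠ 0 ∧
      ∀ w : A[X], w.eval₂ j θ = 0 → ∃ (k : ℕ) (g : A[X]), C D ^ k * w = Q * g := by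
  have : IsDomain A := hj.isDomain
  let F := FractionRing A
  let jF : F →+* K := IsFractionRing.lift hj
  have hjF : ∀ a, jF (algebraMap A F a) = j a := fun a => IsFractionRing.lift_algebraMap hj a
  let _ : Algebra F K := jF.toAlgebra
  have hmap : jF.comp (algebraMap A F) = j := RingHom.ext hjF
  have hev : ∀ (p : A[X]) (x : K), p.eval₂ j x = aeval x (p.map (algebraMap A F)) := by
    intro p x
    rw [aeval_def, eval₂_map, ← hmap]
    rfl
  have : CharZero F := jF.charZero
  have hexp : ∀ i, IsIntegral F (t i) := by
    intro i
    obtain ⟨p, hp, hp0⟩ := ht i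
    refine ⟨p.map (algebraMap A F), hp.map _, ?_⟩
    rw [← aeval_def, ← hev, hp0]
  let L := IntermediateField.adjoin F (Set.range t)
  have : FiniteDimensional F L := IntermediateField.finiteDimensional_adjoin (by
    rintro _ ⟨i, rfl⟩
    exact hexp i)
  let pb := Field.powerBasisOfFiniteOfSeparable F L
  let tL : κ → L := fun i => ⟨t i, IntermediateField.subset_adjoin F _ ⟨i, rfl⟩⟩
  choose b₀ _ hb₀ using fun i => pb.exists_eq_aeval (tL i)
  let θ : K := pb.gen
  have hθint : IsIntegral F θ := by
    have := (Algebra.IsIntegral.isIntegral (R := F) pb.gen).map L.val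
    exact this
  have hb₀' : ∀ i, t i = aeval θ (b₀ i) := by
    intro i
    have := congrArg L.val (hb₀ i)
    rw [← aeval_algHom_apply] at this
    exact this
  obtain ⟨D, hD, P, hP⟩ := exists_common_denominator (A := A)
    (fun k : Option κ => k.elim (minpoly F θ) b₀)
  have hjD : algebraMap F K (algebraMap A F D) = j D := hjF D
  have hjD0 : j D ≠ 0 := by rwa [Ne, map_eq_zero_iff j hj]
  refine ⟨θ, D, P none, fun i => P (some i), hD, fun i => ?_, ?_, ?_, fun w hw => ?_⟩
  · rw [hev, hP, map_mul, aeval_C, hjD]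
    simp only [Option.elim]
    rw [← hb₀']
  · rw [hev, hP, map_mul]
    simp
  · rw [hev, ← derivative_map, hP, derivative_C_mul, map_mul, aeval_C, hjD]
    refine mul_ne_zero hjD0 ?_
    exact ((minpoly.irreducible hθint).separable).aeval_derivative_ne_zero (minpoly.aeval F θ)
  · rw [hev] at hw
    exact exists_pow_mul_eq_of_aeval_eq_zero hθint hD (hP none) w hw

end genericPrimitive

section genericPoint

/-- Evaluation of a ring of functions at a point. -/
def fnEval {X : Type*} (A : Subring (X → ℝ)) (x : X) : A →+* ℝ :=
  (Pi.evalRingHom (fun _ : X => ℝ) x).comp A.subtype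

lemma fnEval_apply {X : Type*} (A : Subring (X → ℝ)) (x : X) (f : A) : fnEval A x f = f.1 x := rfl

lemma exists_ultrafilter_ne_zero {X Y : Type*} (A : Subring (X → ℝ)) (π : Y → X)
    (hdom : ∀ f g : A, f * g = 0 → f = 0 ∨ g = 0) (h1 : (1 : A) ≠ 0)
    (hY : ∀ f : A, f ≠ 0 → ∃ x : Y, f.1 (π x) ≠ 0) :
    ∃ 𝒰 : Ultrafilter Y, ∀ f : A, f ≠ 0 → ∀ᶠ x in (𝒰 : Filter Y), f.1 (π x) ≠ 0 := by
  let l : Filter Y :=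
    { sets := {s | ∃ f : A, f ≠ 0 ∧ ∀ x, f.1 (π x) ≠ 0 → x ∈ s}
      univ_sets := ⟨1, h1, fun _ _ => mem_univ _⟩
      sets_of_superset := by
        rintro s t ⟨f, hf, hfs⟩ hst
        exact ⟨f, hf, fun x hx => hst (hfs x hx)⟩
      inter_sets := by
        rintro s t ⟨f, hf, hfs⟩ ⟨g, hg, hgt⟩
        refine ⟨f * g, fun h => (hdom f g h).elim hf hg, fun x hx => ?_⟩
        have : f.1 (π x) * g.1 (π x) ≠ 0 := hx
        exact ⟨hfs x (left_ne_zero_of_mul this), hgt x (right_ne_zero_of_mul this)⟩ }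
  have hl : l.NeBot := by
    rw [neBot_iff, Ne, ← empty_mem_iff_bot]
    rintro ⟨f, hf, hfe⟩
    obtain ⟨x, hx⟩ := hY f hf
    exact hfe x hx
  refine ⟨Ultrafilter.of l, fun f hf => Ultrafilter.of_le l ⟨f, hf, fun x hx => hx⟩⟩

open Polynomial in
lemma exists_homogenization {A κ : Type*} [CommRing A] (D : A) (b : κ → A[X])
    (w : MvPolynomial κ A) : ∃ (n : ℕ) (v : A[X]), ∀ (K : Type) [CommRing K] (φ : A →+* K) (θ : K)
      (t : κ → K), (∀ i, φ D * t i = (b i).eval₂ φ θ) →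
        v.eval₂ φ θ = φ D ^ n * w.eval₂ φ t := by
  induction w using MvPolynomial.induction_on with
  | C a => exact ⟨0, C a, fun K _ φ θ t _ => by simp⟩
  | add p q hp hq =>
    obtain ⟨n, v, h⟩ := hp
    obtain ⟨m, u, h'⟩ := hq
    refine ⟨n + m, C D ^ m * v + C D ^ n * u, fun K _ φ θ t ht => ?_⟩
    simp only [eval₂_add, eval₂_mul, eval₂_pow, eval₂_C, MvPolynomial.eval₂_add, h K φ θ t ht,
      h' K φ θ t ht]
    ring
  | mul_X p i hp =>
    obtain ⟨n, v, h⟩ := hp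
    refine ⟨n + 1, v * b i, fun K _ φ θ t ht => ?_⟩
    simp only [eval₂_mul, MvPolynomial.eval₂_mul, MvPolynomial.eval₂_X, h K φ θ t ht, ← ht]
    ring

/-- A simple root of a continuous family of functions persists. -/
lemma eventually_exists_root {X : Type*} [TopologicalSpace X] {G : X → ℝ → ℝ}
    (hG : Continuous (Function.uncurry G)) {y₁ : X} {θ₁ g : ℝ} (h0 : G y₁ θ₁ = 0)
    (hd : HasDerivAt (G y₁) g θ₁) (hg : g ≠ 0) {η : ℝ} (hη : 0 < η) :
    ∀ᶠ y in nhds y₁, ∃ θ, |θ - θ₁| < η ∧ G y θ = 0 := by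
  wlog hpos : 0 < g generalizing G g
  · have := this (G := fun y θ => - G y θ) hG.neg (by simp [h0]) hd.neg (neg_ne_zero.2 hg)
      (neg_pos.2 (lt_of_le_of_ne (not_lt.1 hpos) hg))
    simpa using this
  have h1 := hd.tendsto_slope
  have h2 : ∀ᶠ θ in nhdsWithin θ₁ {θ₁}ᶜ, 0 < slope (G y₁) θ₁ θ := h1.eventually_const_lt hpos
  rw [eventually_nhdsWithin_iff, Metric.eventually_nhds_iff] at h2
  obtain ⟨ε, hε, h2⟩ := h2
  let h := min ε η / 2
  have hh : 0 < h := half_pos (lt_min hε hη)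
  have hhε : h < ε := (half_lt_self (lt_min hε hη)).trans_le (min_le_left _ _)
  have hhη : h < η := (half_lt_self (lt_min hε hη)).trans_le (min_le_right _ _)
  have hp : 0 < G y₁ (θ₁ + h) := by
    have := h2 (y := θ₁ + h) (by simp [abs_of_pos hh, hhε]) (by simp [hh.ne'])
    rw [slope_def_field, h0, sub_zero, add_sub_cancel_left] at this
    exact (div_pos_iff_of_pos_right hh).1 this
  have hm : G y₁ (θ₁ - h) < 0 := by
    have := h2 (y := θ₁ - h) (by simp [abs_of_pos hh, hhε]) (by simp [hh.ne'])
    rw [slope_def_field, h0, sub_zero] at this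
    have h3 : θ₁ - h - θ₁ = -h := by ring
    rw [h3, div_neg, neg_pos] at this
    by_contra! h4
    exact absurd (div_nonneg h4 hh.le) (not_le.2 this)
  have c1 : Continuous fun y => G y (θ₁ + h) := hG.comp (continuous_id.prodMk continuous_const)
  have c2 : Continuous fun y => G y (θ₁ - h) := hG.comp (continuous_id.prodMk continuous_const)
  filter_upwards [c1.continuousAt.eventually_const_lt hp, c2.continuousAt.eventually_lt_const hm]
    with y hy1 hy2
  have c3 : Continuous (G y) := hG.comp (continuous_const.prodMk continuous_id)
  obtain ⟨θ, hθ, hθ0⟩ := intermediate_value_Icc (by linarith : θ₁ - h ≤ θ₁ + h) c3.continuousOn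
    (show (0 : ℝ) ∈ Icc _ _ from ⟨hy2.le, hy1.le⟩)
  refine ⟨θ, ?_, hθ0⟩
  rw [abs_lt]
  constructor <;> linarith [hθ.1, hθ.2]

lemma continuous_eval₂_fnEval {X : Type*} [TopologicalSpace X] (A : Subring (X → ℝ))
    (hA : ∀ f : A, Continuous f.1) (p : Polynomial A) :
    Continuous (Function.uncurry fun (y : X) (θ : ℝ) => p.eval₂ (fnEval A y) θ) := by
  simp only [Function.uncurry_def, Polynomial.eval₂_eq_sum_range, fnEval_apply]
  refine continuous_finsetSum _ fun i _ => ?_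
  exact ((hA _).comp continuous_fst).mul (continuous_snd.pow i)

/-- Near a generic point all polynomial relations of the functions `t i` extend to an open set of
parameters. -/
theorem exists_generic_point {X Y κ : Type} [TopologicalSpace X] [Fintype κ] [DecidableEq κ]
    (A : Subring (X → ℝ)) (hA : ∀ f : A, Continuous f.1) (π : Y → X)
    (hdom : ∀ f g : A, f * g = 0 → f = 0 ∨ g = 0) (h1 : (1 : A) ≠ 0)
    (hY : ∀ f : A, f ≠ 0 → ∃ x : Y, f.1 (π x) ≠ 0) (t : κ → Y → ℝ)
    (ht : ∀ i, ∃ p : Polynomial A, p.Monic ∧ ∀ x, p.eval₂ (fnEval A (π x)) (t i x) = 0) :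
    ∃ x₁ : Y, ∀ η > 0, ∀ᶠ y in nhds (π x₁), ∃ z : κ → ℝ, (∀ i, |z i - t i x₁| < η) ∧
      ∀ w : MvPolynomial κ A, (∀ x, w.eval₂ (fnEval A (π x)) (fun i => t i x) = 0) →
        w.eval₂ (fnEval A y) z = 0 := by
  obtain ⟨𝒰, h𝒰⟩ := exists_ultrafilter_ne_zero A π hdom h1 hY
  let K := (𝒰 : Filter Y).Germ ℝ
  let pull : A →+* (Y → ℝ) :=
    (RingHom.pi fun x : Y => Pi.evalRingHom (fun _ : X => ℝ) (π x)).comp A.subtype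
  let q : (Y → ℝ) →+* K := Germ.coeRingHom (𝒰 : Filter Y)
  let j : A →+* K := q.comp pull
  have hq0 : ∀ f : Y → ℝ, q f = 0 ↔ ∀ᶠ x in (𝒰 : Filter Y), f x = 0 := fun f =>
    Germ.coe_eq (l := (𝒰 : Filter Y)) (f := f) (g := 0)
  have hj : Function.Injective j := by
    rw [injective_iff_map_eq_zero]
    intro f hf
    by_contra hf0
    obtain ⟨x, h2, h3⟩ := (((hq0 _).1 hf).and (h𝒰 f hf0)).exists
    exact h3 h2
  have hpev : ∀ (p : Polynomial A) (f : Y → ℝ) (x : Y),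
      p.eval₂ pull f x = p.eval₂ (fnEval A (π x)) (f x) := by
    intro p f x
    exact Polynomial.hom_eval₂ p pull (Pi.evalRingHom (fun _ : Y => ℝ) x) f
  have hqev : ∀ (p : Polynomial A) (f : Y → ℝ),
      p.eval₂ j (q f) = q fun x => p.eval₂ (fnEval A (π x)) (f x) := by
    intro p f
    have := Polynomial.hom_eval₂ p pull q f
    rw [← this]
    congr 1
    ext x
    exact hpev p f x
  have hmev : ∀ (w : MvPolynomial κ A), w.eval₂ j (fun i => q (t i)) =
      q fun x => w.eval₂ (fnEval A (π x)) (fun i => t i x) := by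
    intro w
    have := MvPolynomial.eval₂_comp_left q pull t w
    rw [Function.comp_def] at this
    rw [← this]
    congr 1
    ext x
    exact MvPolynomial.eval₂_comp_left (Pi.evalRingHom (fun _ : Y => ℝ) x) pull t w
  obtain ⟨θ, D, Q, b, hD, hb, hQ, hQ', hdiv⟩ := exists_generic_primitive j hj (fun i => q (t i))
    (fun i => by
      obtain ⟨p, hp, hp0⟩ := ht i
      refine ⟨p, hp, ?_⟩
      rw [hqev]
      simp only [hp0]
      exact map_zero q)
  obtain ⟨θf, rfl⟩ : ∃ f, q f = θ := by
    induction θ using Germ.inductionOn with | h f => exact ⟨f, rfl⟩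
  have e1 : ∀ᶠ x in (𝒰 : Filter Y), ∀ i, D.1 (π x) * t i x = (b i).eval₂ (fnEval A (π x)) (θf x) := by
    rw [eventually_all]
    intro i
    have := hb i
    rw [hqev, ← sub_eq_zero] at this
    have h3 : q (pull D * t i - fun x => (b i).eval₂ (fnEval A (π x)) (θf x)) = 0 := by
      rw [map_sub, map_mul]
      exact this
    filter_upwards [(hq0 _).1 h3] with x hx
    exact sub_eq_zero.1 hx
  have e2 : ∀ᶠ x in (𝒰 : Filter Y), Q.eval₂ (fnEval A (π x)) (θf x) = 0 := by
    rw [hqev] at hQ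
    exact (hq0 _).1 hQ
  have e3 : ∀ᶠ x in (𝒰 : Filter Y), Q.derivative.eval₂ (fnEval A (π x)) (θf x) ≠ 0 := by
    rw [hqev, Ne, hq0] at hQ'
    exact Ultrafilter.eventually_not.2 hQ'
  obtain ⟨x₁, ⟨⟨k1, k2⟩, k3⟩, k4⟩ := (((e1.and e2).and e3).and (h𝒰 D hD)).exists
  refine ⟨x₁, fun η hη => ?_⟩
  let Z : X × ℝ → κ → ℝ := fun p i => (b i).eval₂ (fnEval A p.1) p.2 / D.1 p.1
  have hZ : ContinuousAt Z (π x₁, θf x₁) := by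
    refine continuousAt_pi.2 fun i => ?_
    exact (continuous_eval₂_fnEval A hA (b i)).continuousAt.div
      ((hA D).comp continuous_fst).continuousAt k4
  have hZ1 : Z (π x₁, θf x₁) = fun i => t i x₁ := by
    ext i
    simp only [Z]
    rw [← k1 i, mul_div_cancel_left₀ _ k4]
  have hZ2 : ∀ᶠ p in nhds (π x₁, θf x₁), ∀ i, |Z p i - t i x₁| < η := by
    rw [eventually_all]
    intro i
    have := (continuousAt_pi.1 hZ i).eventually (Metric.ball_mem_nhds _ hη)
    filter_upwards [this] with p hp
    rw [← congrFun hZ1 i]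
    exact hp
  rw [nhds_prod_eq, eventually_prod_iff] at hZ2
  obtain ⟨p1, hp1, p2, hp2, hp⟩ := hZ2
  obtain ⟨η', hη', hp2⟩ := Metric.eventually_nhds_iff.1 hp2
  have hder : HasDerivAt (fun θ => Q.eval₂ (fnEval A (π x₁)) θ)
      (Q.derivative.eval₂ (fnEval A (π x₁)) (θf x₁)) (θf x₁) := by
    have := (Q.map (fnEval A (π x₁))).hasDerivAt (θf x₁)
    simpa only [Polynomial.derivative_map, Polynomial.eval_map] using this
  filter_upwards [hp1, eventually_exists_root (continuous_eval₂_fnEval A hA Q) k2 hder k3 hη',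
    (hA D).continuousAt.eventually_ne k4] with y hy1 hy2 hy3
  obtain ⟨θ, hθ, hθ0⟩ := hy2
  refine ⟨Z (y, θ), hp hy1 (hp2 hθ), fun w hw => ?_⟩
  obtain ⟨n, v, hv⟩ := exists_homogenization D b w
  obtain ⟨k, g, hg⟩ := hdiv v (by
    rw [hv K j (q θf) _ hb, hmev]
    simp only [hw]
    have : q (fun _ => 0) = 0 := map_zero q
    rw [this, mul_zero])
  have h2 := congrArg (Polynomial.eval₂ (fnEval A y) θ) hg
  rw [Polynomial.eval₂_mul, Polynomial.eval₂_mul, hθ0, zero_mul, Polynomial.eval₂_pow,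
    Polynomial.eval₂_C, hv ℝ (fnEval A y) θ (Z (y, θ))] at h2
  · have h3 : fnEval A y D ≠ 0 := hy3
    simpa [h3] using h2
  · intro i
    simp only [Z]
    exact mul_div_cancel₀ _ hy3

end genericPoint

section openProjection

/-- Functions on a set that are restrictions of analytic functions. -/
def anSubring {V : Type*} [NormedAddCommGroup V] [NormedSpace ℝ V] (U : Set V) :
    Subring (U → ℝ) where
  carrier := {f | ∃ F : V → ℝ, AnalyticOnNhd ℝ F U ∧ ∀ y : U, f y = F y}
  mul_mem' := by
    rintro f g ⟨F, hF, hfF⟩ ⟨G, hG, hgG⟩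
    exact ⟨F * G, hF.mul hG, fun y => by simp [hfF, hgG]⟩
  one_mem' := ⟨fun _ => 1, analyticOnNhd_const, fun _ => rfl⟩
  add_mem' := by
    rintro f g ⟨F, hF, hfF⟩ ⟨G, hG, hgG⟩
    exact ⟨F + G, hF.add hG, fun y => by simp [hfF, hgG]⟩
  zero_mem' := ⟨fun _ => 0, analyticOnNhd_const, fun _ => rfl⟩
  neg_mem' := by
    rintro f ⟨F, hF, hfF⟩
    exact ⟨-F, hF.neg, fun y => by simp [hfF]⟩

section
variable {V : Type*} [NormedAddCommGroup V] [NormedSpace ℝ V] {U : Set V}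

lemma continuous_of_mem_anSubring (f : anSubring U) : Continuous f.1 := by
  obtain ⟨F, hF, hfF⟩ := f.2
  have : f.1 = U.domRestrict F := funext hfF
  rw [this]
  exact hF.continuousOn.domRestrict

lemma anSubring_eq_zero_of_eventually (hU : IsPreconnected U) (f : anSubring U) {F : V → ℝ}
    (hF : AnalyticOnNhd ℝ F U) (hfF : ∀ y : U, f.1 y = F y) {y : V} (hy : y ∈ U)
    (h : ∀ᶠ x in nhds y, F x = 0) : f = 0 := by
  have := hF.eqOn_zero_of_preconnected_of_eventuallyEq_zero hU hy h
  ext x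
  rw [hfF, this x.2]
  rfl

lemma anSubring_mul_eq_zero (hU : IsPreconnected U) (hUo : IsOpen U) (f g : anSubring U)
    (h : f * g = 0) : f = 0 ∨ g = 0 := by
  by_contra! hfg
  obtain ⟨F, hF, hfF⟩ := f.2
  obtain ⟨G, hG, hgG⟩ := g.2
  have : ∃ y : U, f.1 y ≠ 0 := by
    by_contra! h0
    exact hfg.1 (by ext y; exact h0 y)
  obtain ⟨y, hy⟩ := this
  rw [hfF] at hy
  apply hfg.2
  refine anSubring_eq_zero_of_eventually hU g hG hgG y.2 ?_
  filter_upwards [(hF y y.2).continuousAt.eventually_ne hy, hUo.mem_nhds y.2] with x hx hxU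
  have h1 : f.1 ⟨x, hxU⟩ * g.1 ⟨x, hxU⟩ = 0 := congrFun (congrArg Subtype.val h) _
  rw [hfF, hgG] at h1
  exact (mul_eq_zero.1 h1).resolve_left hx

end

variable {κ : Type} [Fintype κ] [DecidableEq κ]

/-- Extension by zero of a vector indexed by the complement of `S`. -/
def extZero (S : Finset κ) : ({j // j ∉ S} → ℝ) →L[ℝ] (κ → ℝ) :=
  ContinuousLinearMap.pi fun i =>
    if h : i ∉ S then ContinuousLinearMap.proj (R := ℝ) (φ := fun _ : {j // j ∉ S} => ℝ) ⟨i, h⟩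
    else 0

lemma extZero_apply (S : Finset κ) (y : {j // j ∉ S} → ℝ) {i : κ} (hi : i ∉ S) :
    extZero S y i = y ⟨i, hi⟩ := by
  simp [extZero, hi]

lemma extZero_apply_mem (S : Finset κ) (y : {j // j ∉ S} → ℝ) {i : κ} (hi : i ∈ S) :
    extZero S y i = 0 := by
  simp [extZero, hi]

lemma norm_extZero_lt (S : Finset κ) (y : {j // j ∉ S} → ℝ) {ρ : ℝ} (hρ : 0 < ρ) (hy : ‖y‖ < ρ) :
    ‖extZero S y‖ < ρ := by
  refine (pi_norm_lt_iff hρ).2 fun i => ?_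
  by_cases hi : i ∈ S
  · simpa [extZero_apply_mem S y hi] using hρ
  · rw [extZero_apply S y hi]
    exact (norm_le_pi_norm y _).trans_lt hy

/-- Restriction of a vector to the complement of `S`. -/
def offS (S : Finset κ) : (κ → ℝ) →L[ℝ] ({j // j ∉ S} → ℝ) :=
  ContinuousLinearMap.pi fun j => ContinuousLinearMap.proj (R := ℝ) (φ := fun _ : κ => ℝ) j.1

lemma offS_apply (S : Finset κ) (x : κ → ℝ) (j : {j // j ∉ S}) : offS S x j = x j.1 := rfl

lemma norm_offS_le (S : Finset κ) (x : κ → ℝ) : ‖offS S x‖ ≤ ‖x‖ :=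
  (pi_norm_le_iff_of_nonneg (norm_nonneg _)).2 fun j => norm_le_pi_norm x j.1

open Polynomial in
lemma monic_X_pow_add_sum {A : Type*} [CommRing A] (B : ℕ) (a : ℕ → A) :
    (X ^ B + ∑ k ∈ Finset.range B, C (a k) * X ^ k : A[X]).Monic := by
  nontriviality A
  refine monic_X_pow_add ((degree_sum_le _ _).trans_lt ?_)
  refine (Finset.sup_lt_iff (WithBot.bot_lt_coe B)).2 fun k hk => ?_
  exact (degree_C_mul_X_pow_le _ _).trans_lt (WithBot.coe_lt_coe.2 (Finset.mem_range.1 hk))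

/-- The second normalisation: monic relations can be used for division. -/
lemma division_of_monic {S : Finset κ} {B : ℕ} {c : κ → ℕ → (κ → ℝ) → ℝ}
    (hc : ∀ i k, AnalyticAt ℝ (c i k) 0)
    (hcS : ∀ i k x y, (∀ j ∉ S, x j = y j) → c i k x = c i k y) {ε : ℝ} (hε : 0 < ε) :
    ∃ (N : κ → ℕ) (w : κ → ℝ), (∀ i, 0 < w i ∧ w i ≤ ε) ∧ ∀ g : (κ → ℝ) → ℝ, InA w g →
      ∃ r : (κ → ℕ) → (κ → ℝ) → ℝ, (∀ β, InA w (r β)) ∧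
        (∀ β x y, (∀ j ∉ S, x j = y j) → r β x = r β y) ∧
        ∀ x, (∀ i, |x i| ≤ w i) →
          (∀ i ∈ S, x i ^ B + ∑ k ∈ Finset.range B, c i k x * x i ^ k = 0) →
          g x = ∑ β ∈ redExp S N, r β x * ∏ i, x i ^ β i := by
  let p : κ → Polynomial ℝ := fun i =>
    Polynomial.X ^ B + ∑ k ∈ Finset.range B, Polynomial.C (c i k 0) * Polynomial.X ^ k
  have hp : ∀ i, p i ≠ 0 := fun i => (monic_X_pow_add_sum B _).ne_zero
  choose v hv hv0 using fun i => Polynomial.exists_eq_pow_rootMultiplicity_mul_and_not_dvd (p i) (hp i) 0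
  simp only [map_zero, sub_zero] at hv hv0
  let N : κ → ℕ := fun i => (p i).rootMultiplicity 0
  have hv0' : ∀ i, (v i).eval 0 ≠ 0 := by
    intro i h
    refine hv0 i (Polynomial.X_dvd_iff.2 ?_)
    rwa [Polynomial.coeff_zero_eq_eval_zero]
  have hi_an : ∀ i, AnalyticAt ℝ (fun x : κ → ℝ => x i) 0 := fun i =>
    (ContinuousLinearMap.proj (R := ℝ) (φ := fun _ : κ => ℝ) i).analyticAt _
  have hv_an : ∀ i, AnalyticAt ℝ (fun x : κ → ℝ => (v i).eval (x i)) 0 := by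
    intro i
    have := (hi_an i).aeval_polynomial (v i)
    simpa [Polynomial.aeval_def] using this
  let P : κ → (κ → ℝ) → ℝ := fun i x =>
    (x i ^ B + ∑ k ∈ Finset.range B, c i k x * x i ^ k) / (v i).eval (x i)
  have hP : ∀ i ∈ S, AnalyticAt ℝ (P i) 0 := fun i _ => by
    refine AnalyticAt.fun_div ?_ (hv_an i) (hv0' i)
    refine ((hi_an i).fun_pow _).fun_add ?_
    exact Finset.analyticAt_fun_sum _ fun k _ => (hc i k).fun_mul ((hi_an i).fun_pow _)
  have hPN : ∀ i ∈ S, ∀ᶠ x in nhds 0, (∀ j ∉ S, x j = 0) → P i x = x i ^ N i := fun i _ => by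
    filter_upwards [(hv_an i).continuousAt.eventually_ne (hv0' i)] with x hx hx0
    have h1 : ∀ k, c i k x = c i k 0 := fun k => hcS _ _ _ _ fun j hj => by simp [hx0 j hj]
    have h2 : x i ^ B + ∑ k ∈ Finset.range B, c i k x * x i ^ k = (p i).eval (x i) := by
      simp [p, h1, Polynomial.eval_finsetSum]
    simp only [P]
    rw [h2, hv i, Polynomial.eval_mul, Polynomial.eval_pow, Polynomial.eval_X,
      mul_div_cancel_right₀ _ hx]
  obtain ⟨w, hw, hdiv⟩ := division S N P hP hPN hε
  refine ⟨N, w, hw, fun g hg => ?_⟩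
  obtain ⟨r, h1, h2, h3⟩ := hdiv g hg
  refine ⟨r, h1, h2, fun x hx hx0 => h3 x hx fun i hi => ?_⟩
  simp only [P, hx0 i hi, zero_div]

theorem exists_open_projection {ι : Type*} {Z : Set (κ → ℝ)} {S : Finset κ} {B : ℕ}
    {c : κ → ℕ → (κ → ℝ) → ℝ} {δ : ℝ} (hδ : 0 < δ)
    (hc : ∀ i k, AnalyticOnNhd ℝ (c i k) (ball 0 δ))
    (hcS : ∀ i k x y, (∀ j ∉ S, x j = y j) → c i k x = c i k y)
    (hrel : ∀ x ∈ ball (0 : κ → ℝ) δ, x ∈ Z →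
      ∀ i, x i ^ B + ∑ k ∈ Finset.range B, c i k x * x i ^ k = 0)
    (f : ι → (κ → ℝ) → ℝ) (hf : ∀ s w, InA w (f s)) (hZ : ∀ x, x ∈ Z ↔ ∀ s, f s x = 0)
    (hmax : ∀ Q : (κ → ℝ) → ℝ, AnalyticAt ℝ Q 0 →
        (∀ x y : κ → ℝ, (∀ j ∉ S, x j = y j) → Q x = Q y) →
        (∀ᶠ x in nhds 0, x ∈ Z → Q x = 0) → ∀ᶠ x in nhds 0, Q x = 0)
    {ε : ℝ} (hε : 0 < ε) :
    ∃ y : {j // j ∉ S} → ℝ, ∀ᶠ y' in nhds y, ∃ x ∈ Z, x ∈ ball (0 : κ → ℝ) ε ∧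
      ∀ j : {j // j ∉ S}, x j.1 = y' j := by
  obtain ⟨N, w, hw, hdiv⟩ := division_of_monic (fun i k => hc i k 0 (mem_ball_self hδ)) hcS
    (lt_min hε hδ)
  choose r hrA hrS hr using fun s => hdiv (f s) (hf s w)
  obtain ⟨ρ, hρ, hρw, hρε⟩ : ∃ ρ > 0, (∀ i, ρ ≤ w i) ∧ ρ ≤ min ε δ := by
    have h1 : ∀ i, ∀ᶠ δ in nhdsWithin (0 : ℝ) (Ioi 0), δ ≤ w i := fun i => by
      filter_upwards [Ioo_mem_nhdsGT (hw i).1] with δ hδ using hδ.2.le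
    have h0 : ∀ᶠ δ' in nhdsWithin (0 : ℝ) (Ioi 0), δ' ≤ min ε δ := by
      filter_upwards [Ioo_mem_nhdsGT (lt_min hε hδ)] with δ hδ using hδ.2.le
    obtain ⟨ρ, ⟨h2, h3⟩, h4⟩ := (((eventually_all.2 h1).and h0).and self_mem_nhdsWithin).exists
    exact ⟨ρ, h4, h2, h3⟩
  have hρx : ∀ x ∈ ball (0 : κ → ℝ) ρ, ∀ i, |x i| < w i := fun x hx i =>
    ((norm_le_pi_norm x i).trans_lt (mem_ball_zero_iff.1 hx)).trans_le (hρw i)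
  have hρδ : ball (0 : κ → ℝ) ρ ⊆ ball 0 δ := ball_subset_ball (hρε.trans (min_le_right _ _))
  have hρε' : ball (0 : κ → ℝ) ρ ⊆ ball 0 ε := ball_subset_ball (hρε.trans (min_le_left _ _))
  let U : Set ({j // j ∉ S} → ℝ) := ball 0 ρ
  have hU0 : (0 : {j // j ∉ S} → ℝ) ∈ U := mem_ball_self hρ
  have hUpre : IsPreconnected U := (convex_ball _ _).isPreconnected
  let A := anSubring U
  let Y := {x : κ → ℝ // x ∈ Z ∧ x ∈ ball (0 : κ → ℝ) ρ}
  let π : Y → U := fun x => ⟨offS S x.1, mem_ball_zero_iff.2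
    ((norm_offS_le S x.1).trans_lt (mem_ball_zero_iff.1 x.2.2))⟩
  have hext : ∀ y : U, extZero S y.1 ∈ ball (0 : κ → ℝ) ρ := fun y =>
    mem_ball_zero_iff.2 (norm_extZero_lt S _ hρ (mem_ball_zero_iff.1 y.2))
  let mk : ∀ F : (κ → ℝ) → ℝ, AnalyticOnNhd ℝ F (ball 0 ρ) → A := fun F hF =>
    ⟨fun y => F (extZero S y.1), fun y => F (extZero S y), fun y hy =>
      AnalyticAt.fun_comp (g := F) (hF _ (hext ⟨y, hy⟩)) ((extZero S).analyticAt y), fun _ => rfl⟩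
  have hmk : ∀ F hF (y : U) (x : κ → ℝ), (∀ x y : κ → ℝ, (∀ j ∉ S, x j = y j) → F x = F y) →
      (∀ j : {j // j ∉ S}, x j.1 = y.1 j) → fnEval A y (mk F hF) = F x := by
    intro F hF y x hFS hxy
    refine hFS _ _ fun j hj => ?_
    rw [extZero_apply S _ hj, ← hxy ⟨j, hj⟩]
  have hY : ∀ f : A, f ≠ 0 → ∃ x : Y, f.1 (π x) ≠ 0 := by
    intro g hg
    by_contra! h0
    obtain ⟨F, hF, hgF⟩ := g.2
    apply hg
    have h1 : ∀ᶠ x in nhds (0 : κ → ℝ), F (offS S x) = 0 := by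
      refine hmax (fun x => F (offS S x)) ?_ ?_ ?_
      · refine AnalyticAt.fun_comp (g := F) ?_ ((offS S).analyticAt 0)
        rw [map_zero]
        exact hF 0 hU0
      · intro x y hxy
        have : offS S x = offS S y := by
          ext j
          exact hxy j.1 j.2
        simp only [this]
      · filter_upwards [ball_mem_nhds (0 : κ → ℝ) hρ] with x hx hxZ
        have := h0 ⟨x, hxZ, hx⟩
        rwa [hgF] at this
    have h2 : Tendsto (extZero S) (nhds 0) (nhds 0) := by
      simpa using (extZero S).continuous.tendsto 0
    refine anSubring_eq_zero_of_eventually hUpre g hF hgF hU0 ?_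
    filter_upwards [h2.eventually h1] with y hy
    have : offS S (extZero S y) = y := by
      ext j
      rw [offS_apply, extZero_apply S y j.2]
    rwa [this] at hy
  have hcA : ∀ i k, AnalyticOnNhd ℝ (c i k) (ball 0 ρ) := fun i k => (hc i k).mono hρδ
  have hrA' : ∀ s β, AnalyticOnNhd ℝ (r s β) (ball 0 ρ) := fun s β x hx =>
    (hrA s β).analyticAt (fun i => (hw i).1) (hρx x hx)
  obtain ⟨x₁, hx₁⟩ := exists_generic_point A continuous_of_mem_anSubring π
    (anSubring_mul_eq_zero hUpre isOpen_ball)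
    (by
      intro h
      have := congrFun (congrArg Subtype.val h) ⟨0, hU0⟩
      exact one_ne_zero this) hY
    (fun i x => x.1 i) (fun i => by
      refine ⟨_, monic_X_pow_add_sum B (fun k => mk (c i k) (hcA i k)), fun x => ?_⟩
      have := hrel x.1 (hρδ x.2.2) x.2.1 i
      simp only [Polynomial.eval₂_add, Polynomial.eval₂_pow, Polynomial.eval₂_X,
        Polynomial.eval₂_finsetSum, Polynomial.eval₂_mul, Polynomial.eval₂_C]
      rw [← this]
      congr 1
      refine Finset.sum_congr rfl fun k _ => ?_
      rw [hmk _ (hcA i k) _ x.1 (hcS i k) (fun j => rfl)])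
  have hx₁ρ : ‖x₁.1‖ < ρ := mem_ball_zero_iff.1 x₁.2.2
  refine ⟨(π x₁).1, ?_⟩
  rw [← map_nhds_subtype_coe_eq_nhds (π x₁).2 (isOpen_ball.mem_nhds (π x₁).2), eventually_map]
  filter_upwards [hx₁ (ρ - ‖x₁.1‖) (sub_pos.2 hx₁ρ)] with y hy
  obtain ⟨z, hz, hzw⟩ := hy
  let x : κ → ℝ := fun i => if h : i ∈ S then z i else y.1 ⟨i, h⟩
  have hxy : ∀ j : {j // j ∉ S}, x j.1 = y.1 j := fun j => by simp [x, j.2]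
  have hxz : ∀ i ∈ S, x i = z i := fun i hi => by simp [x, hi]
  have hxρ : x ∈ ball (0 : κ → ℝ) ρ := by
    rw [mem_ball_zero_iff, pi_norm_lt_iff hρ]
    intro i
    by_cases hi : i ∈ S
    · rw [hxz i hi, Real.norm_eq_abs]
      have h1 := hz i
      have h2 : |x₁.1 i| ≤ ‖x₁.1‖ := norm_le_pi_norm x₁.1 i
      have h3 := abs_sub_abs_le_abs_sub (z i) (x₁.1 i)
      linarith
    · rw [hxy ⟨i, hi⟩]
      exact (norm_le_pi_norm y.1 _).trans_lt (mem_ball_zero_iff.1 y.2)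
  refine ⟨x, (hZ x).2 fun s => ?_, hρε' hxρ, hxy⟩
  have hχ : ∀ i ∈ S, x i ^ B + ∑ k ∈ Finset.range B, c i k x * x i ^ k = 0 := by
    intro i hi
    have := hzw (MvPolynomial.X i ^ B + ∑ k ∈ Finset.range B,
      MvPolynomial.C (mk (c i k) (hcA i k)) * MvPolynomial.X i ^ k) (fun x' => by
        rw [← hrel x'.1 (hρδ x'.2.2) x'.2.1 i]
        simp only [MvPolynomial.eval₂_add, MvPolynomial.eval₂_pow, MvPolynomial.eval₂_X,
          MvPolynomial.eval₂_sum, MvPolynomial.eval₂_mul, MvPolynomial.eval₂_C]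
        congr 1
        refine Finset.sum_congr rfl fun k _ => ?_
        rw [hmk _ (hcA i k) _ x'.1 (hcS i k) (fun j => rfl)])
    rw [← this]
    simp only [MvPolynomial.eval₂_add, MvPolynomial.eval₂_pow, MvPolynomial.eval₂_X,
          MvPolynomial.eval₂_sum, MvPolynomial.eval₂_mul, MvPolynomial.eval₂_C, hxz i hi]
    congr 1
    refine Finset.sum_congr rfl fun k _ => ?_
    rw [hmk _ (hcA i k) _ x (hcS i k) hxy]
  have hprod : ∀ β ∈ redExp S N, ∀ u : κ → ℝ, ∏ i, u i ^ β i = ∏ i ∈ S, u i ^ β i := by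
    intro β hβ u
    symm
    refine Finset.prod_subset (Finset.subset_univ S) fun i _ hi => ?_
    have := Fintype.mem_piFinset.1 hβ i
    rw [if_neg hi, Finset.mem_range, Nat.lt_one_iff] at this
    rw [this, pow_zero]
  rw [hr s x (fun i => (hρx x hxρ i).le) hχ]
  have := hzw (∑ β ∈ redExp S N, MvPolynomial.C (mk (r s β) (hrA' s β)) *
    ∏ i ∈ S, MvPolynomial.X i ^ β i) (fun x' => by
      have h1 := hr s x'.1 (fun i => (hρx x'.1 x'.2.2 i).le) fun i _ =>
        hrel x'.1 (hρδ x'.2.2) x'.2.1 i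
      rw [(hZ x'.1).1 x'.2.1 s] at h1
      rw [h1]
      simp only [MvPolynomial.eval₂_sum, MvPolynomial.eval₂_mul, MvPolynomial.eval₂_C,
        MvPolynomial.eval₂_prod, MvPolynomial.eval₂_pow, MvPolynomial.eval₂_X]
      refine Finset.sum_congr rfl fun β hβ => ?_
      rw [hmk _ (hrA' s β) _ x'.1 (hrS s β) (fun j => rfl), hprod β hβ])
  rw [← this]
  simp only [MvPolynomial.eval₂_sum, MvPolynomial.eval₂_mul, MvPolynomial.eval₂_C,
        MvPolynomial.eval₂_prod, MvPolynomial.eval₂_pow, MvPolynomial.eval₂_X]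
  refine Finset.sum_congr rfl fun β hβ => ?_
  rw [hmk _ (hrA' s β) _ x (hrS s β) hxy, hprod β hβ]
  congr 1
  exact Finset.prod_congr rfl fun i hi => by rw [hxz i hi]

end openProjection

section gaussian

open ContinuousMultilinearMap in
/-- Exponential integrals against Gaussian weights are entire functions. -/
lemma hasFPowerSeriesOnBall_integral_exp {α V H : Type*} [MeasurableSpace α] {μ : Measure α}
    [TopologicalSpace α] [OpensMeasurableSpace α] [SecondCountableTopology α]
    [NormedAddCommGroup V] [NormedSpace ℝ V] [NormedAddCommGroup H] [InnerProductSpace ℝ H]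
    {ζ : α → H} (hζ : Continuous ζ)
    (hexp : ∀ b : ℝ, 0 < b → Integrable (fun z => Real.exp (-b * ‖ζ z‖ ^ 2)) μ) {s : ℝ} (hs : 0 < s)
    (L : V →L[ℝ] H) :
    ∃ p : FormalMultilinearSeries ℝ V ℝ, HasFPowerSeriesOnBall
      (fun x : V => ∫ z, Real.exp (2 * s * inner ℝ (ζ z) (L x) - s * ‖ζ z‖ ^ 2) ∂μ) p 0 ⊤ := by
  let c : ℝ := 2 * s * ‖L‖
  let ℓ : α → V →L[ℝ] ℝ := fun z => (2 * s) • (innerSL ℝ (ζ z)).comp L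
  have hℓc : Continuous ℓ := by
    have : Continuous fun z => (innerSL ℝ (ζ z)).comp L :=
      ((innerSL ℝ (E := H)).continuous.comp hζ).clm_comp continuous_const
    exact this.const_smul (2 * s)
  have hℓ : ∀ z, ‖ℓ z‖ ≤ c * ‖ζ z‖ := by
    intro z
    rw [norm_smul, Real.norm_of_nonneg (by positivity : 0 ≤ 2 * s)]
    calc 2 * s * ‖(innerSL ℝ (ζ z)).comp L‖ ≤ 2 * s * (‖ζ z‖ * ‖L‖) := by
          gcongr
          refine (ContinuousLinearMap.opNorm_comp_le _ _).trans ?_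
          rw [innerSL_apply_norm]
      _ = c * ‖ζ z‖ := by ring
  have hI : ∀ C : ℝ, Integrable (fun z => Real.exp (C * ‖ζ z‖ - s * ‖ζ z‖ ^ 2)) μ := by
    intro C
    refine ((hexp (s / 2) (by positivity)).const_mul (Real.exp (C ^ 2 / (2 * s)))).mono'
      (by fun_prop) (Eventually.of_forall fun z => ?_)
    rw [Real.norm_of_nonneg (Real.exp_pos _).le, ← Real.exp_add]
    refine Real.exp_le_exp.2 ?_
    have h1 : C ^ 2 / (2 * s) + -(s / 2) * ‖ζ z‖ ^ 2 - (C * ‖ζ z‖ - s * ‖ζ z‖ ^ 2)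
        = (C - s * ‖ζ z‖) ^ 2 / (2 * s) := by
      field_simp
      ring
    have h2 : 0 ≤ (C - s * ‖ζ z‖) ^ 2 / (2 * s) := by positivity
    linarith
  let q : ∀ k : ℕ, α → ContinuousMultilinearMap ℝ (fun _ : Fin k => V) ℝ := fun k z =>
    (Real.exp (-s * ‖ζ z‖ ^ 2) / k.factorial) •
      (ContinuousMultilinearMap.mkPiAlgebraFin ℝ k ℝ).compContinuousLinearMap fun _ => ℓ z
  have hqn : ∀ k z, ‖q k z‖ ≤ Real.exp (-s * ‖ζ z‖ ^ 2) * ((c * ‖ζ z‖) ^ k / k.factorial) := by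
    intro k z
    rw [norm_smul, Real.norm_of_nonneg (by positivity), div_mul_eq_mul_div, mul_div_assoc]
    gcongr
    refine (norm_compContinuousLinearMap_le _ _).trans ?_
    rw [norm_mkPiAlgebraFin, one_mul, Finset.prod_const, Finset.card_univ, Fintype.card_fin]
    gcongr
    exact hℓ z
  have hterm : ∀ ρ : ℝ, 0 ≤ ρ → ∀ k z, Real.exp (-s * ‖ζ z‖ ^ 2) * ((c * ‖ζ z‖) ^ k / k.factorial) * ρ ^ k
      ≤ Real.exp ((c * ρ) * ‖ζ z‖ - s * ‖ζ z‖ ^ 2) := by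
    intro ρ hρ k z
    have : Real.exp ((c * ρ) * ‖ζ z‖ - s * ‖ζ z‖ ^ 2)
        = Real.exp (-s * ‖ζ z‖ ^ 2) * Real.exp (c * ρ * ‖ζ z‖) := by
      rw [← Real.exp_add]; congr 1; ring
    rw [this, mul_assoc]
    gcongr
    have h := Real.pow_div_factorial_le_exp (c * ρ * ‖ζ z‖) (by positivity) k
    refine le_of_eq_of_le ?_ h
    rw [mul_pow, mul_pow, mul_pow]
    ring
  have hqc : ∀ k, Continuous (q k) := by
    intro k
    have h0 : Continuous fun z => Real.exp (-s * ‖ζ z‖ ^ 2) / k.factorial := by fun_prop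
    have h1 := (compContinuousLinearMapContinuousMultilinear ℝ (fun _ : Fin k => V)
      (fun _ : Fin k => ℝ) ℝ).cont.comp (continuous_pi fun _ : Fin k => hℓc)
    exact h0.smul (h1.clm_apply continuous_const)
  have hqi : ∀ k, Integrable (q k) μ := by
    intro k
    refine (hI c).mono' (hqc k).aestronglyMeasurable (Eventually.of_forall fun z => ?_)
    refine (hqn k z).trans ?_
    simpa using hterm 1 zero_le_one k z
  let p : FormalMultilinearSeries ℝ V ℝ := fun k => ∫ z, q k z ∂μ
  refine ⟨p, ?_, by simp, ?_⟩
  · refine ENNReal.le_of_forall_nnreal_lt fun ρ _ => ?_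
    refine p.le_radius_of_bound (∫ z, Real.exp ((c * ρ) * ‖ζ z‖ - s * ‖ζ z‖ ^ 2) ∂μ) fun k => ?_
    calc ‖p k‖ * (ρ : ℝ) ^ k ≤ (∫ z, ‖q k z‖ ∂μ) * ρ ^ k := by
          gcongr
          exact norm_integral_le_integral_norm _
      _ = ∫ z, ‖q k z‖ * ρ ^ k ∂μ := (integral_mul_const _ _).symm
      _ ≤ _ := by
          refine integral_mono ((hqi k).norm.mul_const _) (hI _) fun z => ?_
          refine le_trans ?_ (hterm ρ ρ.2 k z)
          show ‖q k z‖ * ρ ^ k ≤ _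
          gcongr
          exact hqn k z
  · intro x _
    rw [zero_add]
    have hqx : ∀ k z, q k z (fun _ => x)
        = Real.exp (-s * ‖ζ z‖ ^ 2) * ((ℓ z x) ^ k / k.factorial) := by
      intro k z
      simp [q]
      ring
    have hpx : ∀ k, p k (fun _ => x) = ∫ z, q k z (fun _ => x) ∂μ := fun k =>
      ContinuousMultilinearMap.integral_apply (hqi k) _
    have hexp : ∀ t : ℝ, HasSum (fun k : ℕ => t ^ k / k.factorial) (Real.exp t) := by
      intro t
      rw [Real.exp_eq_exp_ℝ]
      exact NormedSpace.expSeries_div_hasSum_exp t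
    have hqi' : ∀ k, Integrable (fun z => q k z (fun _ => x)) μ := fun k =>
      (ContinuousMultilinearMap.apply ℝ (fun _ : Fin k => V) ℝ (fun _ => x)).integrable_comp (hqi k)
    have hsum : Summable fun k => ∫ z, ‖q k z (fun _ => x)‖ ∂μ := by
      refine summable_of_sum_le (c := ∫ z, Real.exp ((c * ‖x‖) * ‖ζ z‖ - s * ‖ζ z‖ ^ 2) ∂μ)
        (fun k => integral_nonneg fun z => norm_nonneg _) fun u => ?_
      rw [← integral_finsetSum _ fun k _ => (hqi' k).norm]
      refine integral_mono (integrable_finsetSum _ fun k _ => (hqi' k).norm) (hI _) fun z => ?_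
      have h1 : Real.exp ((c * ‖x‖) * ‖ζ z‖ - s * ‖ζ z‖ ^ 2)
        = Real.exp (-s * ‖ζ z‖ ^ 2) * Real.exp (c * ‖x‖ * ‖ζ z‖) := by
        rw [← Real.exp_add]; congr 1; ring
      simp only [h1, hqx, norm_mul, norm_div, norm_pow]
      rw [← Finset.mul_sum, Real.norm_of_nonneg (Real.exp_pos _).le]
      gcongr
      have h2 : ∀ k ∈ u, ‖ℓ z x‖ ^ k / ‖(k.factorial : ℝ)‖ ≤ (c * ‖x‖ * ‖ζ z‖) ^ k / k.factorial := by
        intro k _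
        rw [Real.norm_of_nonneg (Nat.cast_nonneg _)]
        gcongr
        calc ‖ℓ z x‖ ≤ ‖ℓ z‖ * ‖x‖ := (ℓ z).le_opNorm x
          _ ≤ c * ‖ζ z‖ * ‖x‖ := by gcongr; exact hℓ z
          _ = _ := by ring
      refine (Finset.sum_le_sum h2).trans ?_
      exact sum_le_hasSum u (fun k _ => by positivity) (hexp _)
    have h := hasSum_integral_of_summable_integral_norm hqi' hsum
    simp only [hpx]
    convert h using 1
    refine integral_congr_ae (Eventually.of_forall fun z => ?_)
    simp only [hqx]
    rw [tsum_mul_left, (hexp _).tsum_eq, ← Real.exp_add]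
    congr 1
    simp only [ℓ, smul_apply, ContinuousLinearMap.comp_apply, innerSL_apply_apply, smul_eq_mul]
    ring

end gaussian

section uniform
variable {d : ℕ} {μ : Measure (Euc d)} {φ : ℝ → ENNReal}

lemma exists_measure_closedBall_eq_zero {x : Euc d} (hx : x ∉ msupport μ) :
    ∃ r > 0, μ (closedBall x r) = 0 := by
  simpa [msupport] using hx

lemma isClosed_msupport : IsClosed (msupport μ) := by
  rw [← isOpen_compl_iff, Metric.isOpen_iff]
  intro x hx
  obtain ⟨r, hr, h⟩ := exists_measure_closedBall_eq_zero hx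
  refine ⟨r / 2, by positivity, fun y hy hy' => ?_⟩
  refine (hy' (r / 2) (by positivity)).ne' (measure_mono_null (closedBall_subset_closedBall' ?_) h)
  linarith [mem_ball.1 hy]

lemma measure_compl_msupport : μ (msupport μ)ᶜ = 0 := by
  refine measure_null_of_locally_null _ fun x hx => ?_
  obtain ⟨r, hr, h⟩ := exists_measure_closedBall_eq_zero hx
  exact ⟨closedBall x r, mem_nhdsWithin_of_mem_nhds (closedBall_mem_nhds x hr), h⟩

lemma IsDistributionFunction.measure_closedBall_le (h : IsDistributionFunction μ φ) (y : Euc d)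
    {r : ℝ} (hr : 0 < r) : μ (closedBall y r) ≤ φ (2 * r) := by
  by_cases hy : (closedBall y r ∩ msupport μ).Nonempty
  · obtain ⟨x, hx, hxs⟩ := hy
    rw [← h.2.2 x hxs _ (by positivity)]
    refine measure_mono (closedBall_subset_closedBall' ?_)
    rw [mem_closedBall, dist_comm] at hx
    linarith
  · rw [measure_mono_null (fun z hz hz' => hy ⟨z, hz, hz'⟩) measure_compl_msupport]
    exact zero_le

lemma integrable_gaussian {b : ℝ} (hb : 0 < b) :
    Integrable (fun z : Euc d => Real.exp (-b * ‖z‖ ^ 2)) := by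
  refine Integrable.of_integral_ne_zero ?_
  rw [GaussianFourier.integral_rexp_neg_mul_sq_norm hb]
  exact (Real.rpow_pos_of_pos (div_pos Real.pi_pos hb) _).ne'

variable [IsLocallyFiniteMeasure μ]

lemma IsDistributionFunction.integrable_gaussian (h : IsDistributionFunction μ φ) {b : ℝ}
    (hb : 0 < b) : Integrable (fun z : Euc d => Real.exp (-b * ‖z‖ ^ 2)) μ := by
  let g : Euc d → ENNReal := fun y => ENNReal.ofReal (Real.exp (-(b / 2) * ‖y‖ ^ 2))
  have hg : Measurable g := by fun_prop
  have hgi : ∫⁻ y, g y < ⊤ := (_root_.integrable_gaussian (half_pos hb)).lintegral_lt_top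
  let K : Set (Euc d × Euc d) := {p | dist p.1 p.2 ≤ 1}
  have hK : MeasurableSet K := (isClosed_le (by fun_prop) (by fun_prop)).measurableSet
  let f : Euc d → Euc d → ENNReal := fun y z => K.indicator (fun p => g p.1) (y, z)
  have hf : Measurable (Function.uncurry f) := (hg.comp measurable_fst).indicator hK
  have h1 : ∫⁻ y, ∫⁻ z, f y z ∂μ ≤ (∫⁻ y, g y) * φ (2 * 1) := by
    rw [← lintegral_mul_const _ hg]
    refine lintegral_mono fun y => ?_
    have : ∀ z, f y z = (closedBall y 1).indicator (fun _ => g y) z := by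
      intro z
      simp [f, K, indicator, dist_comm]
    simp only [this]
    rw [lintegral_indicator_const measurableSet_closedBall]
    gcongr
    exact h.measure_closedBall_le y one_pos
  let v : ENNReal := volume (closedBall (0 : Euc d) 1)
  have hv : 0 < v := measure_closedBall_pos _ _ one_pos
  have hvt : v ≠ ⊤ := measure_closedBall_lt_top.ne
  have h2 : ∀ z, ENNReal.ofReal (Real.exp (-b * ‖z‖ ^ 2)) * (ENNReal.ofReal (Real.exp (-b)) * v)
      ≤ ∫⁻ y, f y z := by
    intro z
    have : ∀ y, (closedBall z 1).indicator (fun _ => ENNReal.ofReal (Real.exp (-b * ‖z‖ ^ 2)) *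
        ENNReal.ofReal (Real.exp (-b))) y ≤ f y z := by
      intro y
      by_cases hy : dist y z ≤ 1
      · rw [indicator_of_mem (mem_closedBall.2 hy)]
        simp only [f]
        rw [indicator_of_mem (show (y, z) ∈ K from hy)]
        simp only [g]
        rw [← ENNReal.ofReal_mul (Real.exp_pos _).le, ← Real.exp_add]
        refine ENNReal.ofReal_le_ofReal (Real.exp_le_exp.2 ?_)
        have h3 : ‖y‖ ≤ ‖z‖ + 1 := by
          have := norm_le_norm_add_norm_sub' y z
          rw [dist_eq_norm] at hy
          linarith
        have h4 : ‖y‖ ^ 2 ≤ (‖z‖ + 1) ^ 2 := by gcongr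
        nlinarith [mul_nonneg hb.le (sq_nonneg (‖z‖ - 1)), mul_le_mul_of_nonneg_left h4 hb.le]
      · rw [indicator_of_notMem (by simpa using hy)]
        exact zero_le
    calc _ = ∫⁻ y, (closedBall z 1).indicator (fun _ => ENNReal.ofReal (Real.exp (-b * ‖z‖ ^ 2)) *
        ENNReal.ofReal (Real.exp (-b))) y := by
          rw [lintegral_indicator_const measurableSet_closedBall, mul_assoc,
            Measure.addHaar_closedBall_center]
      _ ≤ _ := lintegral_mono this
  have h3 : (∫⁻ z, ENNReal.ofReal (Real.exp (-b * ‖z‖ ^ 2)) ∂μ) *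
      (ENNReal.ofReal (Real.exp (-b)) * v) < ⊤ := by
    rw [← lintegral_mul_const _ (by fun_prop)]
    refine (lintegral_mono h2).trans_lt ?_
    rw [← lintegral_lintegral_swap hf.aemeasurable]
    exact h1.trans_lt (ENNReal.mul_lt_top hgi (h.2.1 _ (by norm_num)).2)
  refine ⟨by fun_prop, ?_⟩
  rw [hasFiniteIntegral_iff_ofReal (Eventually.of_forall fun z => (Real.exp_pos _).le)]
  by_contra h4
  rw [not_lt, top_le_iff] at h4
  rw [h4, ENNReal.top_mul] at h3
  · exact lt_irrefl _ h3
  · refine mul_ne_zero ?_ hv.ne'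
    simpa using Real.exp_pos _

lemma IsDistributionFunction.integrable_gaussian_sub (h : IsDistributionFunction μ φ) {b : ℝ}
    (hb : 0 < b) (x : Euc d) : Integrable (fun z : Euc d => Real.exp (-b * ‖x - z‖ ^ 2)) μ := by
  refine ((h.integrable_gaussian (half_pos hb)).const_mul (Real.exp (b * ‖x‖ ^ 2))).mono'
    (by fun_prop) (Eventually.of_forall fun z => ?_)
  rw [Real.norm_of_nonneg (Real.exp_pos _).le, ← Real.exp_add]
  refine Real.exp_le_exp.2 ?_
  have h1 : ‖z‖ ≤ ‖x‖ + ‖x - z‖ := by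
    have := norm_sub_le x (x - z)
    simpa using this
  have h2 : ‖z‖ ^ 2 ≤ (‖x‖ + ‖x - z‖) ^ 2 := by gcongr
  nlinarith [mul_le_mul_of_nonneg_left h2 hb.le, mul_nonneg hb.le (sq_nonneg (‖x‖ - ‖x - z‖))]

/-- The Gaussian integral of `μ` centred at `x`. -/
def gaussInt (μ : Measure (Euc d)) (s : ℝ) (x : Euc d) : ℝ := ∫ z, Real.exp (-s * ‖x - z‖ ^ 2) ∂μ

lemma IsDistributionFunction.gaussInt_eq (h : IsDistributionFunction μ φ) {s : ℝ} (hs : 0 < s)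
    {x y : Euc d} (hx : x ∈ msupport μ) (hy : y ∈ msupport μ) : gaussInt μ s x = gaussInt μ s y := by
  have key : ∀ x ∈ msupport μ, gaussInt μ s x = (∫⁻ t in Ioi (0 : ℝ),
      if t < 1 then φ (Real.sqrt (-Real.log t / s)) else 0).toReal := by
    intro x hx
    rw [gaussInt, integral_eq_lintegral_of_nonneg_ae (Eventually.of_forall fun z => (Real.exp_pos _).le)
      (by fun_prop), lintegral_eq_lintegral_meas_le _ (Eventually.of_forall fun z => (Real.exp_pos _).le)
      (by fun_prop)]
    congr 1
    refine lintegral_congr_ae ?_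
    filter_upwards [Measure.ae_ne (volume.restrict (Ioi (0 : ℝ))) 1,
      ae_restrict_mem measurableSet_Ioi] with t ht1 ht0
    rcases lt_or_gt_of_ne ht1 with ht | ht
    · rw [if_pos ht]
      have hl : 0 < -Real.log t / s := div_pos (neg_pos.2 (Real.log_neg ht0 ht)) hs
      rw [← h.2.2 x hx _ (Real.sqrt_pos.2 hl)]
      congr 1
      ext z
      rw [mem_ofPred_eq, mem_closedBall, dist_comm, dist_eq_norm, Real.le_sqrt (norm_nonneg _) hl.le,
        ← Real.log_le_iff_le_exp ht0, le_div_iff₀ hs]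
      constructor <;> intro h <;> linarith
    · rw [if_neg (not_lt.2 ht.le)]
      convert measure_empty (μ := μ)
      ext z
      simp only [mem_ofPred_eq, mem_empty_iff_false, iff_false, not_le]
      refine lt_of_le_of_lt (Real.exp_le_one_iff.2 ?_) ht
      have := mul_nonneg hs.le (sq_nonneg ‖x - z‖)
      linarith
  rw [key x hx, key y hy]

lemma IsDistributionFunction.mem_msupport_of_gaussInt_eq (h : IsDistributionFunction μ φ)
    {x₀ x : Euc d} (hx₀ : x₀ ∈ msupport μ)
    (hx : ∀ s : ℕ, 0 < s → gaussInt μ s x = gaussInt μ s x₀) : x ∈ msupport μ := by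
  by_contra hxs
  obtain ⟨r, hr, hr0⟩ := exists_measure_closedBall_eq_zero hxs
  have hφ := h.2.1 (r / 2) (by positivity)
  have hae : ∀ᵐ z ∂μ, r < ‖x - z‖ := by
    refine measure_mono_null (fun z hz => ?_) hr0
    rw [mem_compl_iff, mem_ofPred_eq, not_lt] at hz
    rwa [mem_closedBall, dist_comm, dist_eq_norm]
  have h1 : ∀ s : ℕ, 0 < s →
      gaussInt μ s x ≤ Real.exp (-(s - 1) * r ^ 2) * gaussInt μ 1 x := by
    intro s hs
    have hs1 : (1 : ℝ) ≤ s := by exact_mod_cast hs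
    rw [gaussInt, gaussInt, ← integral_const_mul]
    refine integral_mono_ae (h.integrable_gaussian_sub (by positivity) x)
      ((h.integrable_gaussian_sub one_pos x).const_mul _) ?_
    filter_upwards [hae] with z hz
    rw [← Real.exp_add]
    refine Real.exp_le_exp.2 ?_
    have : r ^ 2 ≤ ‖x - z‖ ^ 2 := by gcongr
    nlinarith [mul_le_mul_of_nonneg_left this (sub_nonneg.2 hs1)]
  have h2 : ∀ s : ℕ, 0 < s →
      Real.exp (-s * (r / 2) ^ 2) * (φ (r / 2)).toReal ≤ gaussInt μ s x₀ := by
    intro s hs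
    rw [← h.2.2 x₀ hx₀ _ (half_pos hr), gaussInt]
    calc _ = ∫ z in closedBall x₀ (r / 2), Real.exp (-s * (r / 2) ^ 2) ∂μ := by
          rw [setIntegral_const, smul_eq_mul, mul_comm]
          rfl
      _ ≤ ∫ z in closedBall x₀ (r / 2), Real.exp (-s * ‖x₀ - z‖ ^ 2) ∂μ := by
          refine setIntegral_mono_on (integrableOn_const measure_closedBall_lt_top.ne)
            (h.integrable_gaussian_sub (by positivity) x₀).integrableOn
            measurableSet_closedBall fun z hz => ?_
          refine Real.exp_le_exp.2 ?_
          rw [mem_closedBall, dist_comm, dist_eq_norm] at hz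
          have : ‖x₀ - z‖ ^ 2 ≤ (r / 2) ^ 2 := by gcongr
          have := mul_le_mul_of_nonneg_left this (Nat.cast_nonneg (α := ℝ) s)
          linarith
      _ ≤ _ := setIntegral_le_integral (h.integrable_gaussian_sub (by positivity) x₀)
          (Eventually.of_forall fun z => (Real.exp_pos _).le)
  have hφ' : 0 < (φ (r / 2)).toReal := ENNReal.toReal_pos hφ.1.ne' hφ.2.ne
  have h3 : Tendsto (fun s : ℕ => Real.exp ((s : ℝ) * (3 / 4 * r ^ 2))) atTop atTop :=
    Real.tendsto_exp_atTop.comp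
      (tendsto_natCast_atTop_atTop.atTop_mul_const (by positivity))
  obtain ⟨s, hs, hs0⟩ := ((h3.eventually_gt_atTop
    (Real.exp (r ^ 2) * gaussInt μ 1 x / (φ (r / 2)).toReal)).and (eventually_gt_atTop 0)).exists
  have h4 := (h2 s hs0).trans ((hx s hs0).symm.le.trans (h1 s hs0))
  rw [div_lt_iff₀ hφ'] at hs
  have h5 := mul_lt_mul_of_pos_left hs (Real.exp_pos (-s * r ^ 2))
  rw [← mul_assoc, ← mul_assoc, ← Real.exp_add, ← Real.exp_add] at h5
  refine absurd h4 (not_le.2 ?_)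
  convert h5 using 3 <;> ring

/-- Support of a uniformly distributed measure as the zero set of entire functions. -/
theorem IsDistributionFunction.exists_analytic_equations (h : IsDistributionFunction μ φ)
    {x₀ : Euc d} (hx₀ : x₀ ∈ msupport μ) {κ : Type} [Fintype κ] (e : Euc d ≃L[ℝ] (κ → ℝ)) :
    ∃ f : ℕ → (κ → ℝ) → ℝ, (∀ s w, InA w (f s)) ∧
      ∀ x, x₀ + e.symm x ∈ msupport μ ↔ ∀ s, f s x = 0 := by
  have hvol : ∀ b : ℝ, 0 < b → Integrable (fun z : Euc d => Real.exp (-b * ‖z‖ ^ 2)) :=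
    fun b hb => _root_.integrable_gaussian hb
  have hμ : ∀ b : ℝ, 0 < b → Integrable (fun z : Euc d => Real.exp (-b * ‖z - x₀‖ ^ 2)) μ :=
    fun b hb => by simpa only [norm_sub_rev] using h.integrable_gaussian_sub hb x₀
  have hpos : ∀ n : ℕ, (0 : ℝ) < n + 1 := fun n => by positivity
  choose p hp using fun n : ℕ => hasFPowerSeriesOnBall_integral_exp
    (ζ := fun z : Euc d => z - x₀) (by fun_prop) hμ (hpos n) (e.symm : (κ → ℝ) →L[ℝ] Euc d)
  choose q hq using fun n : ℕ => hasFPowerSeriesOnBall_integral_exp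
    (ζ := fun z : Euc d => z) (by fun_prop) hvol (hpos n) (e.symm : (κ → ℝ) →L[ℝ] Euc d)
  let c : ℕ → ℝ := fun n => ∫ z : Euc d, Real.exp (-(n + 1) * ‖z‖ ^ 2)
  have hc : ∀ n, 0 < c n := fun n => by
    simp only [c]
    rw [GaussianFourier.integral_rexp_neg_mul_sq_norm (hpos n)]
    exact Real.rpow_pos_of_pos (div_pos Real.pi_pos (hpos n)) _
  have hG : ∀ (n : ℕ) (ν : Measure (Euc d)) (y u : Euc d), gaussInt ν (n + 1) (y + u)
      = Real.exp (-(n + 1) * ‖u‖ ^ 2) *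
        ∫ z, Real.exp (2 * (n + 1) * inner ℝ (z - y) u - (n + 1) * ‖z - y‖ ^ 2) ∂ν := by
    intro n ν y u
    rw [gaussInt, ← integral_const_mul]
    congr 1
    ext z
    rw [← Real.exp_add]
    congr 1
    have : y + u - z = u - (z - y) := by abel
    rw [this, norm_sub_sq_real, real_inner_comm]
    ring
  let k : ℕ → ℝ := fun n => gaussInt μ (n + 1) x₀ / c n
  refine ⟨fun n x => (∫ z, Real.exp (2 * (n + 1) * inner ℝ (z - x₀) (e.symm x)
        - (n + 1) * ‖z - x₀‖ ^ 2) ∂μ) - k n * ∫ z : Euc d, Real.exp (2 * (n + 1) * inner ℝ z (e.symm x)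
        - (n + 1) * ‖z‖ ^ 2), fun n w => ?_, fun x => ?_⟩
  · obtain ⟨ρ, hρ⟩ : ∃ ρ : NNReal, ∀ i, |w i| ≤ ρ :=
      ⟨⟨‖w‖, norm_nonneg _⟩, fun i => norm_le_pi_norm w i⟩
    exact InA_of_hasFPowerSeriesOnBall ((hp n).sub ((hq n).const_smul (c := k n)))
      (ρ := ρ) w hρ ENNReal.coe_lt_top ENNReal.coe_lt_top
  · have hiff : ∀ n : ℕ, gaussInt μ (n + 1) (x₀ + e.symm x) = gaussInt μ (n + 1) x₀ ↔
        (∫ z, Real.exp (2 * (n + 1) * inner ℝ (z - x₀) (e.symm x)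
        - (n + 1) * ‖z - x₀‖ ^ 2) ∂μ) - k n * ∫ z : Euc d, Real.exp (2 * (n + 1) * inner ℝ z (e.symm x)
        - (n + 1) * ‖z‖ ^ 2) = 0 := by
      intro n
      have h1 := hG n volume 0 (e.symm x)
      have h2 : gaussInt volume (n + 1) (0 + e.symm x) = c n := by
        simp only [gaussInt, c, norm_sub_rev]
        exact integral_sub_right_eq_self (fun z : Euc d => Real.exp (-(n + 1) * ‖z‖ ^ 2)) _
      rw [h2] at h1
      simp only [sub_zero] at h1
      have h3 : gaussInt μ (n + 1) x₀ = k n * c n := (div_mul_cancel₀ _ (hc n).ne').symm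
      rw [hG, h3, h1, ← mul_assoc, mul_comm (k n), mul_assoc, mul_right_inj' (Real.exp_pos _).ne',
        sub_eq_zero]
    constructor
    · intro hx n
      exact (hiff n).1 (h.gaussInt_eq (hpos n) hx hx₀)
    · intro hx
      refine h.mem_msupport_of_gaussInt_eq hx₀ fun s hs => ?_
      obtain ⟨n, rfl⟩ := Nat.exists_eq_succ_of_ne_zero hs.ne'
      have := (hiff n).2 (hx n)
      simpa using this

end uniform

section upper
variable {d : ℕ} {μ : Measure (Euc d)} {φ : ℝ → ENNReal}

theorem IsDistributionFunction.exists_local_noether [IsLocallyFiniteMeasure μ]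
    (h : IsDistributionFunction μ φ) {x₀ : Euc d} (hx₀ : x₀ ∈ msupport μ) :
    ∃ (S : Finset (Fin d)) (e : Euc d ≃L[ℝ] (Fin d → ℝ)) (N : Fin d → ℕ)
      (P : Fin d → (Fin d → ℝ) → ℝ), NoetherData {v | x₀ + v ∈ msupport μ} S e N P ∧
      ∃ y : {j // j ∉ S} → ℝ, ∀ᶠ y' in nhds y, ∃ v, x₀ + v ∈ msupport μ ∧ ‖v‖ ≤ 1 ∧
        offS S (e v) = y' := by
  obtain ⟨S, e, N, P, hN, hmax⟩ := exists_noetherData (Z := {v | x₀ + v ∈ msupport μ})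
    (by simpa using hx₀) (EuclideanSpace.equiv (Fin d) ℝ)
  refine ⟨S, e, N, P, hN, ?_⟩
  obtain ⟨δ, hδ, B, c, hc, hcS, hrel⟩ := exists_monic_relation S N P hN.1 hN.2.1
  obtain ⟨f, hf, hfZ⟩ := h.exists_analytic_equations hx₀ e
  obtain ⟨δ', hδ', hP⟩ : ∃ δ' > 0, ∀ i ∈ S, ∀ v ∈ ball (0 : Euc d) δ', x₀ + v ∈ msupport μ →
      P i (e v) = 0 := by
    have := (Filter.eventually_all_finset S).2 hN.2.2
    obtain ⟨δ', hδ', hP⟩ := Metric.eventually_nhds_iff_ball.1 this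
    exact ⟨δ', hδ', fun i hi v hv => hP v hv i hi⟩
  obtain ⟨ε₁, hε₁, hε⟩ : ∃ ε₁ > 0, ∀ x ∈ ball (0 : Fin d → ℝ) ε₁, e.symm x ∈ ball (0 : Euc d) (min 1 δ') := by
    have : Tendsto e.symm (nhds 0) (nhds 0) := by simpa using e.symm.continuous.tendsto 0
    exact Metric.eventually_nhds_iff_ball.1 (this (ball_mem_nhds _ (lt_min one_pos hδ')))
  obtain ⟨y, hy⟩ := exists_open_projection (Z := {x | x₀ + e.symm x ∈ msupport μ})
    (δ := min δ ε₁) (lt_min hδ hε₁)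
    (fun i k => (hc i k).mono (ball_subset_ball (min_le_left _ _))) hcS
    (fun x hx hxZ => hrel x (ball_subset_ball (min_le_left _ _) hx) fun i hi => by
      have := hP i hi (e.symm x) (ball_subset_ball (min_le_right _ _)
        (hε x (ball_subset_ball (min_le_right _ _) hx))) hxZ
      simpa using this) f hf hfZ
    (fun Q hQ hQS hQ0 => hmax Q hQ hQS (by
      have : Tendsto e (nhds 0) (nhds 0) := by simpa using e.continuous.tendsto 0
      filter_upwards [this.eventually hQ0] with v hv hvZ
      exact hv (by simpa using hvZ))) hε₁
  refine ⟨y, ?_⟩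
  filter_upwards [hy] with y' hy'
  obtain ⟨x, hxZ, hx, hxy⟩ := hy'
  refine ⟨e.symm x, hxZ, ?_, ?_⟩
  · have := mem_ball_zero_iff.1 (hε x hx)
    exact this.le.trans (min_le_left _ _)
  · ext j
    simpa [offS_apply] using hxy j

/-- A measure whose support projects onto an open set of an `n`-dimensional space. -/
theorem IsDistributionFunction.exists_le_of_open_projection (h : IsDistributionFunction μ φ)
    {x₀ : Euc d} (hx₀ : x₀ ∈ msupport μ) {J : Type*} [Fintype J] (T : Euc d →L[ℝ] (J → ℝ))
    {y : J → ℝ} (hy : ∀ᶠ y' in nhds y, ∃ v, x₀ + v ∈ msupport μ ∧ ‖v‖ ≤ 1 ∧ T v = y') :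
    ∃ C > 0, ∃ r₀ > 0, ∀ r, 0 < r → r ≤ r₀ → φ r ≤ ENNReal.ofReal (C * r ^ Fintype.card J) := by
  obtain ⟨ρ, hρ, hyρ⟩ := Metric.eventually_nhds_iff_ball.1 hy
  let L : ℝ := ‖T‖ + 1
  have hL : 0 < L := by positivity
  have hφ := h.2.1 2 two_pos
  have hφ' : 0 < (φ 2).toReal := ENNReal.toReal_pos hφ.1.ne' hφ.2.ne
  refine ⟨(φ 2).toReal * (6 * L / ρ) ^ Fintype.card J, by positivity, min 1 (ρ / (6 * L)),
    by positivity, fun r hr hr₀ => ?_⟩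
  obtain ⟨hr1, hr2⟩ := le_min_iff.1 hr₀
  let t : ℝ := 3 * L * r
  have ht : 0 < t := by positivity
  let m : ℕ := ⌊ρ / t⌋₊
  have hm : ρ / (2 * t) ≤ m := by
    have h1 := (Nat.lt_floor_add_one (ρ / t)).le
    have h2 : 1 ≤ ρ / (2 * t) := by
      rw [le_div_iff₀ (by positivity)]
      rw [le_div_iff₀ (by positivity)] at hr2
      simp only [t]
      linarith
    have h3 : ρ / t = 2 * (ρ / (2 * t)) := by field_simp
    have h4 : ρ / t ≤ m + 1 := h1
    linarith
  have hmt : ∀ k : Fin m, k * t < ρ := by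
    intro k
    have h1 : (k : ℝ) < m := by exact_mod_cast k.2
    have h2 : (m : ℝ) ≤ ρ / t := Nat.floor_le (by positivity)
    exact (lt_div_iff₀ ht).1 (h1.trans_le h2)
  have hpt : ∀ k : J → Fin m, ∃ v, x₀ + v ∈ msupport μ ∧ ‖v‖ ≤ 1 ∧ T v = fun j => y j + k j * t := by
    intro k
    refine hyρ _ ?_
    rw [mem_ball, dist_pi_lt_iff hρ]
    intro j
    rw [Real.dist_eq, add_sub_cancel_left, abs_of_nonneg (by positivity)]
    exact hmt _
  choose v hv hv1 hvT using hpt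
  have hdisj : Pairwise (Function.onFun Disjoint fun k => closedBall (x₀ + v k) r) := by
    intro k l hkl
    refine closedBall_disjoint_closedBall ?_
    rw [dist_add_left, dist_eq_norm]
    obtain ⟨j, hj⟩ := Function.ne_iff.1 hkl
    have h1 : t ≤ ‖T (v k - v l) j‖ := by
      have : T (v k - v l) j = ((k j : ℝ) - l j) * t := by
        rw [map_sub, hvT, hvT]
        simp only [Pi.sub_apply]
        ring
      rw [this, norm_mul, Real.norm_of_nonneg ht.le]
      have h2 : (1 : ℝ) ≤ |((k j : ℤ) - (l j : ℤ) : ℤ)| := by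
        have : (1 : ℤ) ≤ |((k j : ℤ) - (l j : ℤ) : ℤ)| := by
          refine Int.one_le_abs (sub_ne_zero.2 fun h => hj (Fin.ext ?_))
          exact_mod_cast h
        exact_mod_cast this
      push_cast at h2
      rw [Real.norm_eq_abs]
      nlinarith
    have h2 : ‖T (v k - v l) j‖ ≤ L * ‖v k - v l‖ := by
      refine (norm_le_pi_norm _ j).trans ((T.le_opNorm _).trans ?_)
      gcongr
      simp [L]
    have h3 : L * (3 * r) ≤ L * ‖v k - v l‖ := by
      simp only [t] at h1
      linarith
    have := le_of_mul_le_mul_left h3 hL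
    linarith
  have hsum : (m ^ Fintype.card J : ℕ) * φ r ≤ φ 2 := by
    classical
    calc ((m ^ Fintype.card J : ℕ) : ENNReal) * φ r = ∑ k : J → Fin m, μ (closedBall (x₀ + v k) r) := by
          rw [Finset.sum_congr rfl fun k _ => h.2.2 _ (hv k) r hr, Finset.sum_const,
            Finset.card_univ, Fintype.card_fun, Fintype.card_fin, nsmul_eq_mul]
      _ = μ (⋃ k, closedBall (x₀ + v k) r) := by
          rw [measure_iUnion hdisj fun k => measurableSet_closedBall, tsum_fintype]
      _ ≤ μ (closedBall x₀ 2) := by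
          refine measure_mono (iUnion_subset fun k => closedBall_subset_closedBall' ?_)
          rw [dist_self_add_left]
          linarith [hv1 k]
      _ = φ 2 := h.2.2 _ hx₀ _ two_pos
  have hφr := h.2.1 r hr
  rw [← ENNReal.ofReal_toReal hφr.2.ne]
  refine ENNReal.ofReal_le_ofReal ?_
  have h1 : (m : ℝ) ^ Fintype.card J * (φ r).toReal ≤ (φ 2).toReal := by
    have := ENNReal.toReal_mono hφ.2.ne hsum
    simpa using this
  have h2 : (ρ / (6 * L * r)) ^ Fintype.card J * (φ r).toReal ≤ (φ 2).toReal := by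
    refine le_trans ?_ h1
    gcongr
    refine le_of_eq_of_le ?_ hm
    simp only [t]
    ring
  have h3 : (6 * L / ρ) ^ Fintype.card J * r ^ Fintype.card J * (ρ / (6 * L * r)) ^ Fintype.card J = 1 := by
    rw [← mul_pow, ← mul_pow]
    have : 6 * L / ρ * r * (ρ / (6 * L * r)) = 1 := by field_simp
    rw [this, one_pow]
  calc (φ r).toReal = (6 * L / ρ) ^ Fintype.card J * r ^ Fintype.card J *
        ((ρ / (6 * L * r)) ^ Fintype.card J * (φ r).toReal) := by rw [← mul_assoc, h3, one_mul]
    _ ≤ (6 * L / ρ) ^ Fintype.card J * r ^ Fintype.card J * (φ 2).toReal := by gcongr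
    _ = _ := by ring

end upper

section

open scoped NNReal ENNReal

section Taylor

variable {E : Type*} [NormedAddCommGroup E] [NormedSpace ℝ E] [CompleteSpace E]

set_option maxHeartbeats 1000000 in
/-- Taylor expansion with a remainder that is uniform in the base point. -/
lemma AnalyticAt.exists_uniform_taylor {F : E → ℝ} (hF : AnalyticAt ℝ F 0) (B : ℕ) :
    ∃ ρ > 0, ∃ C > 0, ∃ A : E → (k : ℕ) → ContinuousMultilinearMap ℝ (fun _ : Fin k => E) ℝ,
      ∀ z, ‖z‖ ≤ ρ → ∀ w, ‖w‖ ≤ ρ →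
        |F (z + w) - ∑ k ∈ Finset.range (B + 1), A z k (fun _ => w)| ≤ C * ‖w‖ ^ (B + 1) := by
  obtain ⟨p, R, hp⟩ := hF
  obtain ⟨r, hr0, hrR⟩ : ∃ r : ℝ≥0, 0 < r ∧ (r + r : ℝ≥0∞) < R := by
    obtain ⟨s, hs0, hs⟩ := ENNReal.lt_iff_exists_nnreal_btwn.1 hp.r_pos
    refine ⟨s / 2, by simpa using hs0, ?_⟩
    rw [← ENNReal.coe_add, add_halves]; exact hs
  have hrp : (r + r : ℝ≥0∞) < p.radius := hrR.trans_le hp.r_le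
  have hS := p.changeOriginSeries_summable_aux₁ hrp
  set a : ℕ → ℝ≥0 := fun k => (∑' s : Σ l : ℕ, { s : Finset (Fin (k + l)) // s.card = l },
    ‖p (k + s.1)‖₊ * r ^ s.1) * r ^ k with ha
  have hsum : Summable a := by
    simpa only [ha, ← NNReal.tsum_mul_right] using (NNReal.summable_sigma.1 hS).2
  have hbd : ∀ z : E, ‖z‖₊ ≤ r → ∀ k, ‖p.changeOrigin z k‖₊ * r ^ k ≤ a k := by
    intro z hz k
    have hrr : (r : ℝ≥0∞) < p.radius := lt_of_le_of_lt (by simp) hrp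
    have hz' : (‖z‖₊ : ℝ≥0∞) < p.radius := lt_of_le_of_lt (by exact_mod_cast hz) hrr
    have h := (p.nnnorm_changeOrigin_le k hz').trans
      (Summable.tsum_le_tsum (fun s => by gcongr) (p.changeOriginSeries_summable_aux₂ hz' k)
        (p.changeOriginSeries_summable_aux₂ hrr k))
    exact mul_le_mul_left h _
  have hr0' : (0 : ℝ) < r := by exact_mod_cast hr0
  have hsum' : Summable (fun k => (a k : ℝ)) := by exact_mod_cast hsum
  refine ⟨r / 2, by positivity, (∑' k, (a k : ℝ) + 1) / r ^ (B + 1), ?_, fun z k => p.changeOrigin z k, ?_⟩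
  · have : 0 ≤ ∑' k, (a k : ℝ) := tsum_nonneg fun k => by positivity
    positivity
  intro z hz w hw
  have hz1 : ‖z‖₊ ≤ r := by
    rw [← NNReal.coe_le_coe, coe_nnnorm]; linarith
  have hco := hp.changeOrigin (y := z) (lt_of_le_of_lt (by exact_mod_cast hz1 : (‖z‖₊ : ℝ≥0∞) ≤ r)
    (lt_of_le_of_lt (by simp) hrR))
  have hwm : w ∈ Metric.eball (0 : E) (R - ‖z‖₊) := by
    rw [Metric.mem_eball, edist_zero_right, lt_tsub_iff_right]
    refine lt_of_le_of_lt ?_ hrR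
    gcongr
    · rw [enorm_le_coe, ← NNReal.coe_le_coe, coe_nnnorm]; linarith
  have hs := hco.hasSum hwm
  rw [zero_add] at hs
  have htail := (hasSum_nat_add_iff' (B + 1)).2 hs
  rw [← htail.tsum_eq]
  have hterm : ∀ k, ‖p.changeOrigin z (k + (B + 1)) fun _ => w‖ ≤
      a (k + (B + 1)) * (‖w‖ / r) ^ (B + 1) := by
    intro k
    have h1 := (p.changeOrigin z (k + (B + 1))).le_opNorm (fun _ => w)
    rw [Finset.prod_const, Finset.card_univ, Fintype.card_fin] at h1
    refine h1.trans ?_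
    have h2 : ‖p.changeOrigin z (k + (B + 1))‖ * (r : ℝ) ^ (k + (B + 1)) ≤ a (k + (B + 1)) := by
      exact_mod_cast hbd z hz1 (k + (B + 1))
    have hwr : ‖w‖ / r ≤ 1 := by rw [div_le_one hr0']; linarith
    calc ‖p.changeOrigin z (k + (B + 1))‖ * ‖w‖ ^ (k + (B + 1))
        = (‖p.changeOrigin z (k + (B + 1))‖ * (r : ℝ) ^ (k + (B + 1))) *
            ((‖w‖ / r) ^ k * (‖w‖ / r) ^ (B + 1)) := by
          rw [← pow_add, div_pow]; field_simp
      _ ≤ a (k + (B + 1)) * (1 * (‖w‖ / r) ^ (B + 1)) := by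
          gcongr
          exact pow_le_one₀ (by positivity) hwr
      _ = _ := by rw [one_mul]
  have hsa : Summable fun k => (a (k + (B + 1)) : ℝ) := (summable_nat_add_iff (B + 1)).2 hsum'
  have h3 := tsum_of_norm_bounded ((hsa.mul_right ((‖w‖ / r) ^ (B + 1))).hasSum) hterm
  rw [← Real.norm_eq_abs]
  refine h3.trans ?_
  rw [tsum_mul_right]
  have h4 : ∑' k, (a (k + (B + 1)) : ℝ) ≤ ∑' k, (a k : ℝ) := by
    have := hsum'.sum_add_tsum_nat_add (B + 1)
    have h5 : 0 ≤ ∑ i ∈ Finset.range (B + 1), (a i : ℝ) := Finset.sum_nonneg fun i _ => by positivity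
    linarith
  calc (∑' k, (a (k + (B + 1)) : ℝ)) * (‖w‖ / r) ^ (B + 1)
      ≤ (∑' k, (a k : ℝ) + 1) * (‖w‖ / r) ^ (B + 1) := by gcongr; linarith
    _ = _ := by rw [div_pow]; ring

end Taylor

section PolyFn

variable {J : Type*} [Fintype J] [DecidableEq J]

/-- Evaluation of the polynomial with coefficients `c`, of degree at most `B` in each variable. -/
def polyEval {B : ℕ} (c : (J → Fin (B + 1)) → ℝ) (ξ : J → ℝ) : ℝ :=
  ∑ m, c m * ∏ j, ξ j ^ (m j : ℕ)

lemma multilinear_eq_polyEval {E : Type*} [AddCommGroup E] [Module ℝ E] {B k : ℕ} (hk : k ≤ B)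
    (A : MultilinearMap ℝ (fun _ : Fin k => E) ℝ) (v : J → E) (v0 : E) :
    ∃ c : (J → Fin (B + 1)) → ℝ, ∀ ξ : J → ℝ,
      A (fun _ => ∑ j, ξ j • v j + v0) = polyEval c ξ := by
  let cnt : (Fin k → Option J) → J → Fin (B + 1) := fun r j =>
    ⟨(Finset.univ.filter fun i => r i = some j).card, by
      refine Nat.lt_succ_of_le ((Finset.card_le_univ _).trans ?_)
      simpa using hk⟩
  let vv : Option J → E := fun o => o.elim v0 v
  refine ⟨fun m => ∑ r with cnt r = m, A fun i => vv (r i), fun ξ => ?_⟩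
  let x : Option J → ℝ := fun o => o.elim 1 ξ
  have h1 : ∑ j, ξ j • v j + v0 = ∑ o, x o • vv o := by
    rw [Fintype.sum_option]; simp [x, vv, add_comm]
  rw [h1, MultilinearMap.map_sum]
  simp only [polyEval, Finset.sum_mul]
  rw [← Finset.sum_fiberwise (s := Finset.univ) (g := cnt)]
  refine Finset.sum_congr rfl fun m _ => Finset.sum_congr rfl fun r hr => ?_
  rw [Finset.mem_filter] at hr
  rw [MultilinearMap.map_smul_univ, smul_eq_mul, mul_comm]
  congr 1
  rw [← hr.2]
  have h2 : ∀ i, x (r i) = ∏ j, if r i = some j then ξ j else 1 := by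
    intro i
    cases h : r i with
    | none => simp [x]
    | some j => simp [x]
  simp_rw [h2]
  rw [Finset.prod_comm]
  refine Finset.prod_congr rfl fun j _ => ?_
  rw [Finset.prod_ite]
  simp [cnt]

end PolyFn

end

lemma coeff_eq_zero_of_abs_le {B : ℕ} {q : ℕ → ℝ} {C ρ : ℝ} (hρ : 0 < ρ)
    (h : ∀ τ, 0 < τ → τ ≤ ρ → |∑ k ∈ Finset.range (B + 1), q k * τ ^ k| ≤ C * τ ^ (B + 1)) :
    ∀ k ≤ B, q k = 0 := by
  have h0 : ∀ {B : ℕ} {q : ℕ → ℝ}, (∀ τ, 0 < τ → τ ≤ ρ →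
      |∑ k ∈ Finset.range (B + 1), q k * τ ^ k| ≤ C * τ ^ (B + 1)) → q 0 = 0 := by
    intro B q h
    have hc : Tendsto (fun τ : ℝ => |∑ k ∈ Finset.range (B + 1), q k * τ ^ k|)
        (nhdsWithin 0 (Ioi 0)) (nhds |∑ k ∈ Finset.range (B + 1), q k * (0 : ℝ) ^ k|) := by
      apply Tendsto.mono_left _ nhdsWithin_le_nhds
      apply Continuous.tendsto; fun_prop
    have hd : Tendsto (fun τ : ℝ => C * τ ^ (B + 1)) (nhdsWithin 0 (Ioi 0))
        (nhds (C * (0 : ℝ) ^ (B + 1))) := by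
      apply Tendsto.mono_left _ nhdsWithin_le_nhds
      apply Continuous.tendsto; fun_prop
    have := le_of_tendsto_of_tendsto hc hd (by
      filter_upwards [Ioc_mem_nhdsGT hρ] with τ hτ using h τ hτ.1 hτ.2)
    rw [Finset.sum_range_succ'] at this
    simpa using this
  induction B generalizing q with
  | zero =>
    intro k hk
    obtain rfl : k = 0 := by omega
    exact h0 h
  | succ B ih =>
    have hq0 := h0 h
    have := ih (q := fun k => q (k + 1)) (fun τ h1 h2 => by
      have h3 := h τ h1 h2
      rw [Finset.sum_range_succ', hq0] at h3
      simp only [zero_mul, add_zero] at h3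
      have h4 : ∑ k ∈ Finset.range (B + 1), q (k + 1) * τ ^ (k + 1) =
          (∑ k ∈ Finset.range (B + 1), q (k + 1) * τ ^ k) * τ := by
        rw [Finset.sum_mul]; exact Finset.sum_congr rfl fun k _ => by ring
      rw [h4, abs_mul, abs_of_pos h1, pow_succ, ← mul_assoc] at h3
      exact le_of_mul_le_mul_right h3 h1)
    intro k hk
    cases k with
    | zero => exact hq0
    | succ k => exact this k (by omega)

section Expansion

variable {J : Type*} [Fintype J] [DecidableEq J]

lemma abs_polyEval_le {B : ℕ} (c : (J → Fin (B + 1)) → ℝ) {ξ : J → ℝ} (hξ : ‖ξ‖ ≤ 1) :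
    |polyEval c ξ| ≤ Fintype.card (J → Fin (B + 1)) * ‖c‖ := by
  refine (Finset.abs_sum_le_sum_abs _ _).trans ?_
  have : ∀ m ∈ (Finset.univ : Finset (J → Fin (B + 1))), |c m * ∏ j, ξ j ^ (m j : ℕ)| ≤ ‖c‖ := by
    intro m _
    rw [abs_mul, Finset.abs_prod]
    have h1 : ∏ j, |ξ j ^ (m j : ℕ)| ≤ 1 := Finset.prod_le_one (fun j _ => abs_nonneg _) fun j _ => by
      rw [abs_pow]
      exact pow_le_one₀ (abs_nonneg _) ((norm_le_pi_norm ξ j).trans hξ)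
    calc |c m| * ∏ j, |ξ j ^ (m j : ℕ)| ≤ ‖c‖ * 1 :=
          mul_le_mul (norm_le_pi_norm c m) h1 (Finset.prod_nonneg fun _ _ => abs_nonneg _)
            (norm_nonneg _)
      _ = _ := mul_one _
  simpa using Finset.sum_le_sum this

variable {E : Type*} [NormedAddCommGroup E] [NormedSpace ℝ E] [CompleteSpace E]

/-- Expansion of an analytic function along the lines `z + τ (∑ ξ_j v_j + v₀)`. -/
lemma AnalyticAt.exists_expansion {F : E → ℝ} (hF : AnalyticAt ℝ F 0) (B : ℕ) (v : J → E) (v0 : E) :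
    ∃ ρ > 0, ∃ C > 0, ∃ c : E → ℕ → (J → Fin (B + 1)) → ℝ, ∀ z, ‖z‖ ≤ ρ →
      (∀ τ : ℝ, |τ| ≤ ρ → ∀ ξ : J → ℝ, ‖ξ‖ ≤ 1 →
        |F (z + τ • (∑ j, ξ j • v j + v0)) -
          ∑ k ∈ Finset.range (B + 1), polyEval (c z k) ξ * τ ^ k| ≤ C * |τ| ^ (B + 1)) ∧
      ((∃ q : ℕ → ℝ, ∀ τ : ℝ, F (z + τ • v0) = τ ^ B + ∑ k ∈ Finset.range B, q k * τ ^ k) →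
        polyEval (c z B) 0 = 1) := by
  obtain ⟨ρ, hρ, C, hC, A, hA⟩ := hF.exists_uniform_taylor B
  have hc : ∀ z k, ∃ c : (J → Fin (B + 1)) → ℝ, k ≤ B → ∀ ξ : J → ℝ,
      A z k (fun _ => ∑ j, ξ j • v j + v0) = polyEval c ξ := by
    intro z k
    by_cases hk : k ≤ B
    · obtain ⟨c, hc⟩ := multilinear_eq_polyEval hk (A z k).toMultilinearMap v v0
      exact ⟨c, fun _ => hc⟩
    · exact ⟨0, fun h => absurd h hk⟩
  choose c hc using hc
  set V : ℝ := ∑ j, ‖v j‖ + ‖v0‖ + 1 with hV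
  have hV1 : 1 ≤ V := by
    have : 0 ≤ ∑ j, ‖v j‖ := Finset.sum_nonneg fun j _ => norm_nonneg _
    have := norm_nonneg v0
    linarith
  have hlin : ∀ ξ : J → ℝ, ‖ξ‖ ≤ 1 → ‖∑ j, ξ j • v j + v0‖ ≤ V := by
    intro ξ hξ
    have h1 : ‖∑ j, ξ j • v j‖ ≤ ∑ j, ‖v j‖ := by
      refine (norm_sum_le _ _).trans (Finset.sum_le_sum fun j _ => ?_)
      rw [norm_smul]
      exact mul_le_of_le_one_left (norm_nonneg _) ((norm_le_pi_norm ξ j).trans hξ)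
    linarith [norm_add_le (∑ j, ξ j • v j) v0]
  have key : ∀ z, ‖z‖ ≤ ρ / V → ∀ τ : ℝ, |τ| ≤ ρ / V → ∀ ξ : J → ℝ, ‖ξ‖ ≤ 1 →
        |F (z + τ • (∑ j, ξ j • v j + v0)) -
          ∑ k ∈ Finset.range (B + 1), polyEval (c z k) ξ * τ ^ k| ≤
            C * V ^ (B + 1) * |τ| ^ (B + 1) := by
    intro z hz τ hτ ξ hξ
    have h1 : ‖τ • (∑ j, ξ j • v j + v0)‖ ≤ |τ| * V := by
      rw [norm_smul, Real.norm_eq_abs]; gcongr; exact hlin ξ hξ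
    have h2 := hA z (hz.trans (div_le_self hρ.le hV1)) (τ • (∑ j, ξ j • v j + v0))
      (h1.trans (by rwa [le_div_iff₀ (by linarith)] at hτ))
    have h3 : ∑ k ∈ Finset.range (B + 1), A z k (fun _ => τ • (∑ j, ξ j • v j + v0)) =
        ∑ k ∈ Finset.range (B + 1), polyEval (c z k) ξ * τ ^ k := by
      refine Finset.sum_congr rfl fun k hk => ?_
      rw [← hc z k (Nat.lt_succ_iff.1 (Finset.mem_range.1 hk)) ξ, ContinuousMultilinearMap.map_smul_univ]
      simp [mul_comm]
    rw [h3] at h2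
    refine h2.trans ?_
    calc C * ‖τ • (∑ j, ξ j • v j + v0)‖ ^ (B + 1) ≤ C * (|τ| * V) ^ (B + 1) := by gcongr
      _ = _ := by rw [mul_pow]; ring
  refine ⟨ρ / V, by positivity, C * V ^ (B + 1), by positivity, c, fun z hz => ⟨key z hz, ?_⟩⟩
  rintro ⟨q, hq⟩
  have h := coeff_eq_zero_of_abs_le (B := B) (C := C * V ^ (B + 1)) (ρ := ρ / V) (by positivity)
    (q := fun k => (if k = B then 1 else q k) - polyEval (c z k) 0) (fun τ h1 h2 => by
      have h3 := key z hz τ (by rwa [abs_of_pos h1]) 0 (by simp)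
      simp only [Pi.zero_apply, zero_smul, Finset.sum_const_zero, zero_add] at h3
      rw [hq, abs_of_pos h1] at h3
      convert h3 using 2
      simp only [sub_mul, Finset.sum_sub_distrib]
      congr 1
      rw [Finset.sum_range_succ, if_pos rfl, one_mul, add_comm]
      congr 1
      refine Finset.sum_congr rfl fun k hk => ?_
      rw [if_neg (Finset.mem_range.1 hk).ne]) B le_rfl
  simp only [if_true] at h
  linarith

end Expansion

section Grid

variable {J : Type*} [Fintype J] [DecidableEq J]

/-- A polynomial vanishing at sufficiently many points of the curve
`s ↦ ε s ^ ((B + 1) ^ σ j)` vanishes identically. -/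
lemma polyEval_curve_eq_zero {B : ℕ} (c : (J → Fin (B + 1)) → ℝ) {ε : ℝ} (hε : 0 < ε)
    (σ : J ≃ Fin (Fintype.card J)) (T : Finset ℝ) (hT : (B + 1) ^ Fintype.card J ≤ T.card)
    (h : ∀ s ∈ T, polyEval c (fun j => ε * s ^ (B + 1) ^ (σ j : ℕ)) = 0) : c = 0 := by
  let e : (J → Fin (B + 1)) ≃ Fin ((B + 1) ^ Fintype.card J) :=
    (Equiv.arrowCongr σ (Equiv.refl _)).trans finFunctionFinEquiv
  have he : ∀ m, (e m : ℕ) = ∑ j, (m j : ℕ) * (B + 1) ^ (σ j : ℕ) := by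
    intro m
    simp only [e, Equiv.trans_apply, finFunctionFinEquiv_apply]
    rw [← Equiv.sum_comp σ]
    simp [Equiv.arrowCongr]
  let p : Polynomial ℝ := ∑ m, Polynomial.monomial (e m : ℕ) (c m * ∏ j, ε ^ (m j : ℕ))
  have hp : ∀ s, p.eval s = polyEval c (fun j => ε * s ^ (B + 1) ^ (σ j : ℕ)) := by
    intro s
    simp only [p, Polynomial.eval_finsetSum, Polynomial.eval_monomial, polyEval]
    refine Finset.sum_congr rfl fun m _ => ?_
    rw [he, mul_assoc, ← Finset.prod_pow_eq_pow_sum, ← Finset.prod_mul_distrib]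
    congr 1
    refine Finset.prod_congr rfl fun j _ => ?_
    rw [mul_pow, ← pow_mul, mul_comm (m j : ℕ)]
  have hdeg : p.natDegree < T.card := by
    refine lt_of_lt_of_le ?_ hT
    refine lt_of_le_of_lt (Polynomial.natDegree_sum_le_of_forall_le (n := (B + 1) ^ Fintype.card J - 1)
      _ _ fun m _ => (Polynomial.natDegree_monomial_le _).trans ?_) ?_
    · have := (e m).2; omega
    · have : 0 < (B + 1) ^ Fintype.card J := by positivity
      omega
  have hp0 : p = 0 := Polynomial.eq_zero_of_natDegree_lt_card_of_eval_eq_zero' p T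
    (fun s hs => by rw [hp, h s hs]) hdeg
  funext m
  have h1 : p.coeff (e m) = c m * ∏ j, ε ^ (m j : ℕ) := by
    simp only [p, Polynomial.finsetSum_coeff, Polynomial.coeff_monomial]
    rw [Finset.sum_eq_single m]
    · simp
    · intro m' _ hm'
      rw [if_neg]
      intro h'
      exact hm' (e.injective (Fin.ext h'))
    · simp
  rw [hp0, Polynomial.coeff_zero] at h1
  have h2 : ∏ j, ε ^ (m j : ℕ) ≠ 0 := (Finset.prod_pos fun j _ => by positivity).ne'
  simpa [h2] using h1.symm

/-- A finite grid such that every polynomial is robustly nonzero on most of its points. -/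
lemma exists_robust_grid (J : Type*) [Fintype J] [DecidableEq J] (B L : ℕ) {ε : ℝ} (hε : 0 < ε) :
    ∃ ξ : Fin L → J → ℝ, (∀ l, ‖ξ l‖ ≤ ε) ∧ ∃ θ > 0, ∃ α > 0, ∀ c : (J → Fin (B + 1)) → ℝ,
      ∀ t : Finset (Fin L), (∀ l ∈ t, ∃ η, ‖η - ξ l‖ ≤ α ∧ |polyEval c η| < θ * ‖c‖) →
        t.card < (B + 1) ^ Fintype.card J := by
  classical
  let σ : J ≃ Fin (Fintype.card J) := Fintype.equivFin J
  let s : Fin L → ℝ := fun l => ((l : ℕ) + 1) / L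
  have hs0 : ∀ l, 0 < s l := fun l => by
    have : 0 < L := l.pos
    simp only [s]; positivity
  have hs1 : ∀ l, s l ≤ 1 := fun l => by
    have : (0 : ℝ) < L := by exact_mod_cast l.pos
    simp only [s]; rw [div_le_one this]; exact_mod_cast l.2
  have hsinj : Function.Injective s := by
    intro l l' h
    have : (L : ℝ) ≠ 0 := by exact_mod_cast l.pos.ne'
    simp only [s] at h
    field_simp at h
    ext; exact_mod_cast (add_right_cancel h)
  let ξ : Fin L → J → ℝ := fun l j => ε * s l ^ (B + 1) ^ (σ j : ℕ)
  have hlin : ∀ η : J → ℝ, ∃ f : ((J → Fin (B + 1)) → ℝ) →ₗ[ℝ] ℝ, ∀ c, f c = polyEval c η := by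
    intro η
    refine ⟨{ toFun := fun c => polyEval c η, map_add' := ?_, map_smul' := ?_ }, fun c => rfl⟩
    · intro c c'; simp [polyEval, add_mul, Finset.sum_add_distrib]
    · intro r c; simp [polyEval, Finset.mul_sum, mul_assoc]
  choose f hf using hlin
  have hK : ∀ T : Finset (Fin L), ∃ K : ℝ, 0 < K ∧ ((B + 1) ^ Fintype.card J ≤ T.card →
      ∀ c : (J → Fin (B + 1)) → ℝ, ∃ l ∈ T, ‖c‖ ≤ K * |polyEval c (ξ l)|) := by
    intro T
    by_cases hT : (B + 1) ^ Fintype.card J ≤ T.card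
    · have hker : LinearMap.ker (LinearMap.pi fun l : T => f (ξ l)) = ⊥ := by
        rw [LinearMap.ker_eq_bot']
        intro c hc
        refine polyEval_curve_eq_zero c hε σ (T.image s) ?_ ?_
        · rwa [Finset.card_image_of_injective _ hsinj]
        · intro x hx
          obtain ⟨l, hl, rfl⟩ := Finset.mem_image.1 hx
          have := congrFun hc ⟨l, hl⟩
          simpa [hf, ξ] using this
      obtain ⟨K, hK0, hK⟩ := LinearMap.exists_antilipschitzWith _ hker
      refine ⟨K, by exact_mod_cast hK0, fun _ c => ?_⟩
      have hne : T.Nonempty := by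
        rw [← Finset.card_pos]
        exact lt_of_lt_of_le (by positivity) hT
      obtain ⟨l, hl, hmax⟩ := T.exists_max_image (fun l => |polyEval c (ξ l)|) hne
      refine ⟨l, hl, ?_⟩
      have h1 := hK.le_mul_dist c 0
      rw [map_zero, dist_zero_right, dist_zero_right] at h1
      refine h1.trans ?_
      gcongr
      refine (pi_norm_le_iff_of_nonneg (abs_nonneg _)).2 fun l' => ?_
      simpa [hf] using hmax l' l'.2
    · exact ⟨1, one_pos, fun h => absurd h hT⟩
  choose K hK0 hK using hK
  set Km : ℝ := ∑ T, K T with hKm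
  have hKle : ∀ T, K T ≤ Km := fun T =>
    Finset.single_le_sum (f := K) (fun T _ => (hK0 T).le) (Finset.mem_univ T)
  have hKm0 : 0 < Km := (hK0 ∅).trans_le (hKle ∅)
  set θ : ℝ := 1 / (4 * Km) with hθ
  have hθ0 : 0 < θ := by positivity
  have hα : ∀ l, ∃ α > 0, ∀ η, ‖η - ξ l‖ ≤ α →
      ∑ m : J → Fin (B + 1), |∏ j, η j ^ (m j : ℕ) - ∏ j, ξ l j ^ (m j : ℕ)| < θ := by
    intro l
    have hcont : Continuous fun η : J → ℝ =>
        ∑ m : J → Fin (B + 1), |∏ j, η j ^ (m j : ℕ) - ∏ j, ξ l j ^ (m j : ℕ)| := by fun_prop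
    have hev := (hcont.tendsto (ξ l)).eventually (Iio_mem_nhds (show _ < θ by simpa using hθ0))
    obtain ⟨α, hα, h⟩ := Metric.eventually_nhds_iff.1 hev
    exact ⟨α / 2, by positivity, fun η hη => h (by rw [dist_eq_norm]; linarith)⟩
  choose α hα0 hα using hα
  obtain ⟨α', hα'0, hα'⟩ : ∃ α' > 0, ∀ l, α' ≤ α l := by
    by_cases hL : Nonempty (Fin L)
    · obtain ⟨l0, hl0⟩ := Finite.exists_min α
      exact ⟨α l0, hα0 l0, hl0⟩
    · exact ⟨1, one_pos, fun l => absurd ⟨l⟩ hL⟩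
  refine ⟨ξ, fun l => ?_, θ, hθ0, α', hα'0, fun c t ht => ?_⟩
  · refine (pi_norm_le_iff_of_nonneg hε.le).2 fun j => ?_
    simp only [ξ]
    rw [Real.norm_eq_abs, abs_of_pos (mul_pos hε (pow_pos (hs0 l) _))]
    exact mul_le_of_le_one_right hε.le (pow_le_one₀ (hs0 l).le (hs1 l))
  · by_contra! hcard
    obtain ⟨l, hl, hle⟩ := hK t hcard c
    obtain ⟨η, hη, hlt⟩ := ht l hl
    have hdiff : |polyEval c (ξ l)| ≤ |polyEval c η| + ‖c‖ * θ := by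
      have h1 : |polyEval c η - polyEval c (ξ l)| ≤ ‖c‖ * θ := by
        simp only [polyEval, ← Finset.sum_sub_distrib, ← mul_sub]
        refine (Finset.abs_sum_le_sum_abs _ _).trans ?_
        refine le_trans ?_ (mul_le_mul_of_nonneg_left (hα l η (hη.trans (hα' l))).le (norm_nonneg c))
        rw [Finset.mul_sum]
        refine Finset.sum_le_sum fun m _ => ?_
        rw [abs_mul]
        gcongr
        exact norm_le_pi_norm c m
      have := abs_sub_abs_le_abs_sub (polyEval c (ξ l)) (polyEval c η)
      rw [abs_sub_comm] at this
      linarith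
    have hc0 : 0 < ‖c‖ := by
      by_contra h
      have : ‖c‖ = 0 := le_antisymm (not_lt.1 h) (norm_nonneg c)
      rw [this, mul_zero] at hlt
      exact absurd hlt (not_lt.2 (abs_nonneg _))
    have : ‖c‖ ≤ Km * (2 * (θ * ‖c‖)) := by
      refine hle.trans ?_
      gcongr
      · exact hKle t
      · linarith
    have h2 : Km * (2 * (θ * ‖c‖)) = ‖c‖ / 2 := by rw [hθ]; field_simp; norm_num
    linarith

end Grid

/-- If bad choices at `i` depend only on the other coordinates and are few, some choice avoids them
all. -/
lemma exists_avoiding {κ : Type*} [Fintype κ] [DecidableEq κ] {L D : ℕ}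
    (bad : κ → (κ → Fin L) → Finset (Fin L)) (hcard : ∀ i a, (bad i a).card ≤ D)
    (hupd : ∀ i a s, bad i (Function.update a i s) = bad i a)
    (hL : Fintype.card κ * D < L) : ∃ a : κ → Fin L, ∀ i, a i ∉ bad i a := by
  classical
  have hL0 : 0 < L := by omega
  by_contra! hcon
  have hcount : ∀ i, L * (Finset.univ.filter fun a : κ → Fin L => a i ∈ bad i a).card ≤
      D * L ^ Fintype.card κ := by
    intro i
    set A := Finset.univ.filter fun a : κ → Fin L => a i ∈ bad i a with hA
    let g : (κ → Fin L) × Fin L → (κ → Fin L) := fun p => Function.update p.1 i p.2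
    have h1 : (A ×ˢ (Finset.univ : Finset (Fin L))).card ≤
        D * ((A ×ˢ (Finset.univ : Finset (Fin L))).image g).card := by
      refine Finset.card_le_mul_card_image _ _ fun b _ => ?_
      refine le_trans (Finset.card_le_card_of_injOn (fun p => p.1 i) (t := bad i b) ?_ ?_) (hcard i b)
      · rintro ⟨a, s⟩ hp
        simp only [Finset.coe_filter, Finset.mem_product, Set.mem_ofPred_eq, hA, Finset.mem_filter,
          Finset.mem_univ, true_and, and_true, g] at hp
        rw [← hp.2, Finset.mem_coe, hupd]
        exact hp.1
      · rintro ⟨a, s⟩ hp ⟨a', s'⟩ hp' heq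
        simp only [Finset.coe_filter, Finset.mem_product, Set.mem_ofPred_eq, g] at hp hp' heq
        have h := hp.2.trans hp'.2.symm
        ext1
        · funext k
          by_cases hk : k = i
          · subst hk; exact heq
          · have := congrFun h k
            simpa [hk] using this
        · have := congrFun h i
          simpa using this
    rw [Finset.card_product, Finset.card_univ, Fintype.card_fin] at h1
    rw [mul_comm]
    refine h1.trans (Nat.mul_le_mul_left D ?_)
    refine (Finset.card_le_univ _).trans ?_
    simp
  have h2 : (Finset.univ : Finset (κ → Fin L)).card ≤
      ∑ i, (Finset.univ.filter fun a : κ → Fin L => a i ∈ bad i a).card := by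
    refine le_trans (Finset.card_le_card ?_) Finset.card_biUnion_le
    intro a _
    obtain ⟨i, hi⟩ := hcon a
    simp only [Finset.mem_biUnion, Finset.mem_univ, true_and, Finset.mem_filter]
    exact ⟨i, hi⟩
  have h3 : L * L ^ Fintype.card κ ≤ Fintype.card κ * D * L ^ Fintype.card κ := by
    calc L * L ^ Fintype.card κ = L * (Finset.univ : Finset (κ → Fin L)).card := by simp
      _ ≤ ∑ i, L * (Finset.univ.filter fun a : κ → Fin L => a i ∈ bad i a).card := by
          rw [← Finset.mul_sum]; exact Nat.mul_le_mul_left _ h2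
      _ ≤ ∑ _i : κ, D * L ^ Fintype.card κ := Finset.sum_le_sum fun i _ => hcount i
      _ = _ := by simp [mul_assoc]
  have h4 : 0 < L ^ Fintype.card κ := by positivity
  exact absurd (Nat.le_of_mul_le_mul_right h3 h4) (not_le.2 hL)

lemma exists_finset_of_window {N : ℕ} {A : Set ℕ} (h : ∀ j ∈ A, ∀ j' ∈ A, j ≤ j' → j' ≤ j + N) :
    ∃ t : Finset ℕ, t.card ≤ N + 1 ∧ ∀ j ∈ A, j ∈ t := by
  rcases A.eq_empty_or_nonempty with rfl | hne
  · exact ⟨∅, by simp, by simp⟩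
  · refine ⟨Finset.Icc (sInf A) (sInf A + N), by simp; omega, fun j hj => ?_⟩
    rw [Finset.mem_Icc]
    exact ⟨Nat.sInf_le hj, h _ (Nat.sInf_mem hne) _ hj (Nat.sInf_le hj)⟩

/-- Two distinct monomials can be comparable at only boundedly many dyadic scales. -/
lemma exists_finset_resonance {lam : ℝ} (hlam : 0 < lam) (B : ℕ) : ∃ M : ℕ, ∀ m : ℕ → ℝ,
    ∃ t : Finset ℕ, t.card ≤ M ∧ ∀ (j : ℕ) (τ : ℝ), (1 / 2) ^ (j + 1) ≤ τ → τ ≤ (1 / 2) ^ j →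
      (∃ k ≤ B, ∃ l ≤ B, k ≠ l ∧ 0 < m l * τ ^ l ∧ lam * (m l * τ ^ l) ≤ m k * τ ^ k ∧
        m k * τ ^ k ≤ m l * τ ^ l) → j ∈ t := by
  obtain ⟨N, hN⟩ := pow_unbounded_of_one_lt (1 / lam) (one_lt_two : (1 : ℝ) < 2)
  refine ⟨(B + 1) * ((B + 1) * (N + 2)), fun m => ?_⟩
  have hpair : ∀ k l : ℕ, ∃ t : Finset ℕ, t.card ≤ N + 1 + 1 ∧ (k ≠ l → ∀ j ∈ {j : ℕ | ∃ τ : ℝ,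
      (1 / 2) ^ (j + 1) ≤ τ ∧ τ ≤ (1 / 2) ^ j ∧ 0 < m l * τ ^ l ∧
      lam * (m l * τ ^ l) ≤ m k * τ ^ k ∧ m k * τ ^ k ≤ m l * τ ^ l}, j ∈ t) := by
    intro k l
    by_cases hkl : k = l
    · exact ⟨∅, by simp, fun h => absurd hkl h⟩
    obtain ⟨t, ht, hjt⟩ := exists_finset_of_window (N := N + 1) (A := {j : ℕ | ∃ τ : ℝ,
      (1 / 2) ^ (j + 1) ≤ τ ∧ τ ≤ (1 / 2) ^ j ∧ 0 < m l * τ ^ l ∧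
      lam * (m l * τ ^ l) ≤ m k * τ ^ k ∧ m k * τ ^ k ≤ m l * τ ^ l}) (by
      rintro j ⟨τ, h1, h2, h3, h4, h5⟩ j' ⟨τ', h1', h2', h3', h4', h5'⟩ hjj
      by_contra! hlt
      have hτ : 0 < τ := lt_of_lt_of_le (by positivity) h1
      have hτ' : 0 < τ' := lt_of_lt_of_le (by positivity) h1'
      have hml : 0 < m l := (mul_pos_iff_of_pos_right (pow_pos hτ l)).1 h3
      have hmk : 0 < m k := (mul_pos_iff_of_pos_right (pow_pos hτ k)).1
        (lt_of_lt_of_le (by positivity) h4)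
      have hratio : 1 / lam < τ / τ' := by
        refine hN.trans_le ?_
        rw [le_div_iff₀ hτ']
        calc (2 : ℝ) ^ N * τ' ≤ 2 ^ N * (1 / 2) ^ j' := by gcongr
          _ ≤ 2 ^ N * (1 / 2) ^ (j + 1 + N) := by
              gcongr 2 ^ N * ?_
              exact pow_le_pow_of_le_one (by norm_num) (by norm_num) (by omega)
          _ = (1 / 2) ^ (j + 1) := by
              rw [pow_add (1 / 2 : ℝ) (j + 1) N, mul_comm, mul_assoc, ← mul_pow]; norm_num
          _ ≤ τ := h1
      have hge : 1 ≤ τ / τ' := by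
        rw [le_div_iff₀ hτ', one_mul]
        refine h2'.trans (le_trans ?_ h1)
        exact pow_le_pow_of_le_one (by norm_num) (by norm_num) (by omega)
      have hpw : ∀ p q : ℕ, p < q → ∀ u v x y : ℝ, 0 < u → 0 < v → 0 < y → x * y = lam →
          x * (v * τ ^ q) ≤ u * τ ^ p → y * (u * τ' ^ p) ≤ v * τ' ^ q → False := by
        intro p q hpq u v x y hu hv hy hxy a1 a2
        obtain ⟨n, rfl⟩ := Nat.exists_eq_add_of_lt hpq
        have b1 : x * v * τ ^ (n + 1) ≤ u := by
          have : x * v * τ ^ (n + 1) * τ ^ p ≤ u * τ ^ p := by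
            calc _ = x * (v * τ ^ (p + n + 1)) := by ring
              _ ≤ _ := a1
          exact le_of_mul_le_mul_right this (by positivity)
        have b2 : y * u ≤ v * τ' ^ (n + 1) := by
          have : y * u * τ' ^ p ≤ v * τ' ^ (n + 1) * τ' ^ p := by
            calc _ = y * (u * τ' ^ p) := by ring
              _ ≤ _ := a2
              _ = _ := by ring
          exact le_of_mul_le_mul_right this (by positivity)
        have b3 : lam * τ ^ (n + 1) ≤ τ' ^ (n + 1) := by
          have : lam * τ ^ (n + 1) * v ≤ τ' ^ (n + 1) * v := by
            calc lam * τ ^ (n + 1) * v = y * (x * v * τ ^ (n + 1)) := by rw [← hxy]; ring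
              _ ≤ y * u := by gcongr
              _ ≤ _ := b2
              _ = _ := by ring
          exact le_of_mul_le_mul_right this hv
        have b4 : (τ / τ') ^ (n + 1) ≤ 1 / lam := by
          rw [div_pow, div_le_div_iff₀ (by positivity) hlam]
          linarith
        have b5 : τ / τ' ≤ (τ / τ') ^ (n + 1) := le_self_pow₀ hge (by omega)
        linarith
      rcases lt_or_gt_of_ne hkl with h | h
      · exact hpw k l h (m k) (m l) lam 1 hmk hml one_pos (mul_one _) h4 (by rwa [one_mul])
      · exact hpw l k h (m l) (m k) 1 lam hml hmk hlam (one_mul _) (by rwa [one_mul]) h4')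
    exact ⟨t, ht, fun _ => hjt⟩
  choose t ht hjt using hpair
  refine ⟨(Finset.range (B + 1)).biUnion fun k => (Finset.range (B + 1)).biUnion fun l => t k l,
    ?_, ?_⟩
  · refine (Finset.card_biUnion_le_card_mul _ _ _ fun k _ =>
      Finset.card_biUnion_le_card_mul _ _ _ fun l _ => ht k l).trans ?_
    simp
  · rintro j τ h1 h2 ⟨k, hk, l, hl, hkl, h⟩
    simp only [Finset.mem_biUnion, Finset.mem_range]
    exact ⟨k, by omega, l, by omega, hjt k l hkl j ⟨τ, h1, h2, h⟩⟩

section ParamRelation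

variable {κ : Type*} [Fintype κ] [DecidableEq κ]

/-- The sheared coordinates `u_j + ∑_{k ∈ S} a_{k j} u_k`. -/
def shearBy (S : Finset κ) (a : κ × κ → ℝ) (u : κ → ℝ) (j : κ) : ℝ :=
  u j + ∑ k ∈ S, a (k, j) * u k

/-- A point in sheared coordinates, together with the shear parameters. -/
def shearLift (S : Finset κ) (a : κ × κ → ℝ) (u : κ → ℝ) : κ ⊕ κ × κ → ℝ :=
  Sum.elim (fun j => if j ∈ S then u j else shearBy S a u j) a

/-- The inverse of `shearLift` on the first component. -/
def shearDrop (S : Finset κ) (x : κ ⊕ κ × κ → ℝ) : κ → ℝ := fun j =>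
  if j ∈ S then x (Sum.inl j) else x (Sum.inl j) - ∑ k ∈ S, x (Sum.inr (k, j)) * x (Sum.inl k)

lemma shearDrop_shearLift (S : Finset κ) (a : κ × κ → ℝ) (u : κ → ℝ) :
    shearDrop S (shearLift S a u) = u := by
  funext j
  by_cases hj : j ∈ S
  · simp [shearDrop, shearLift, hj]
  · have h : ∑ k ∈ S, a (k, j) * shearLift S a u (Sum.inl k) = ∑ k ∈ S, a (k, j) * u k :=
      Finset.sum_congr rfl fun k hk => by simp [shearLift, hk]
    have h' : shearLift S a u (Sum.inl j) = u j + ∑ k ∈ S, a (k, j) * u k := by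
      simp [shearLift, hj, shearBy]
    rw [shearDrop, if_neg hj, h', show ∑ k ∈ S, shearLift S a u (Sum.inr (k, j)) *
      shearLift S a u (Sum.inl k) = _ from h, add_sub_cancel_right]

lemma norm_shearLift_le (S : Finset κ) {a : κ × κ → ℝ} {u : κ → ℝ} {ε : ℝ} (ha : ‖a‖ ≤ ε)
    (hε : ε * S.card ≤ 1) (hu : 2 * ‖u‖ ≤ ε) : ‖shearLift S a u‖ ≤ ε := by
  have hε0 : 0 ≤ ε := (norm_nonneg _).trans ha
  refine (pi_norm_le_iff_of_nonneg hε0).2 ?_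
  rintro (j | p)
  · simp only [shearLift, Sum.elim_inl]
    split_ifs
    · linarith [norm_le_pi_norm u j, norm_nonneg u]
    · have h1 : ‖∑ k ∈ S, a (k, j) * u k‖ ≤ ∑ _k ∈ S, ε * ‖u‖ := by
        refine (norm_sum_le _ _).trans (Finset.sum_le_sum fun k _ => ?_)
        rw [norm_mul]
        gcongr
        · exact (norm_le_pi_norm a _).trans ha
        · exact norm_le_pi_norm u k
      rw [Finset.sum_const, nsmul_eq_mul, ← mul_assoc, mul_comm (S.card : ℝ)] at h1
      have h2 : ε * S.card * ‖u‖ ≤ 1 * ‖u‖ := by gcongr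
      unfold shearBy
      linarith [norm_add_le (u j) (∑ k ∈ S, a (k, j) * u k), norm_le_pi_norm u j]
  · exact (norm_le_pi_norm a p).trans ha

lemma exists_coeff_translate {B : ℕ} (b : ℕ → ℝ) (t : ℝ) : ∃ q : ℕ → ℝ, ∀ τ : ℝ,
    (t + τ) ^ B + ∑ k ∈ Finset.range B, b k * (t + τ) ^ k =
      τ ^ B + ∑ k ∈ Finset.range B, q k * τ ^ k := by
  let p : Polynomial ℝ := Polynomial.X ^ B + ∑ k ∈ Finset.range B, Polynomial.monomial k (b k)
  have hlt : (∑ k ∈ Finset.range B, Polynomial.monomial k (b k)).degree < (B : WithBot ℕ) := by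
    rw [← Polynomial.mem_degreeLT]
    refine Submodule.sum_mem _ fun k hk => ?_
    rw [Polynomial.mem_degreeLT]
    exact (Polynomial.degree_monomial_le _ _).trans_lt
      (by exact_mod_cast Finset.mem_range.1 hk)
  have hp : p.Monic := Polynomial.monic_X_pow_add hlt
  have hd : p.natDegree = B := by
    refine Polynomial.natDegree_eq_of_degree_eq_some ?_
    rw [Polynomial.degree_add_eq_left_of_degree_lt] <;> rw [Polynomial.degree_X_pow]
    exact hlt
  let p' := p.comp (Polynomial.X + Polynomial.C t)
  have hp' : p'.Monic := hp.comp_X_add_C t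
  have hd' : p'.natDegree = B := by
    simp only [p', Polynomial.natDegree_comp, Polynomial.natDegree_X_add_C, hd, mul_one]
  refine ⟨p'.coeff, fun τ => ?_⟩
  have h1 : p'.eval τ = (t + τ) ^ B + ∑ k ∈ Finset.range B, b k * (t + τ) ^ k := by
    simp [p', p, Polynomial.eval_finsetSum, add_comm]
  have h2 := congrArg (Polynomial.eval τ) hp'.as_sum
  rw [h1, hd'] at h2
  rw [h2]
  simp [Polynomial.eval_finsetSum]

/-- Monic relations for the coordinates in `S`, uniformly over shears of the base coordinates. -/
lemma NoetherData.exists_sheared_relations {V : Type*} [NormedAddCommGroup V] [NormedSpace ℝ V]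
    {Z : Set V} {S : Finset κ} {e : V ≃L[ℝ] (κ → ℝ)} {N : κ → ℕ} {P : κ → (κ → ℝ) → ℝ}
    (hD : NoetherData Z S e N P) :
    ∃ (B : ℕ) (F : κ → (κ ⊕ κ × κ → ℝ) → ℝ), (∀ i ∈ S, AnalyticAt ℝ (F i) 0) ∧
      (∀ i ∈ S, ∀ x y : κ ⊕ κ × κ → ℝ, (∀ j ∉ S, x (Sum.inl j) = y (Sum.inl j)) →
        (∀ p, x (Sum.inr p) = y (Sum.inr p)) → x (Sum.inl i) = y (Sum.inl i) → F i x = F i y) ∧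
      (∀ i ∈ S, ∀ z, ∃ q : ℕ → ℝ, ∀ τ : ℝ, F i (z + τ • Pi.single (Sum.inl i) 1) =
        τ ^ B + ∑ k ∈ Finset.range B, q k * τ ^ k) ∧
      ∃ ρ > 0, ∀ v ∈ Z, ∀ a, ‖e v‖ ≤ ρ → ‖shearLift S a (e v)‖ ≤ ρ →
        ∀ i ∈ S, F i (shearLift S a (e v)) = 0 := by
  obtain ⟨hP, hN, hZ⟩ := hD
  let S' : Finset (κ ⊕ κ × κ) := S.map ⟨Sum.inl, Sum.inl_injective⟩
  have hS' : ∀ {j}, Sum.inl j ∈ S' ↔ j ∈ S := by intro j; simp [S']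
  have hS'' : ∀ {p}, Sum.inr p ∉ S' := by intro p; simp [S']
  let N' : κ ⊕ κ × κ → ℕ := Sum.elim N fun _ => 0
  let P' : κ ⊕ κ × κ → (κ ⊕ κ × κ → ℝ) → ℝ :=
    Sum.elim (fun i x => P i (shearDrop S x)) fun _ _ => 0
  have hproj : ∀ p : κ ⊕ κ × κ, AnalyticAt ℝ (fun x : κ ⊕ κ × κ → ℝ => x p) 0 := fun p =>
    (ContinuousLinearMap.proj (R := ℝ) (φ := fun _ : κ ⊕ κ × κ => ℝ) p).analyticAt 0
  have hdrop : AnalyticAt ℝ (shearDrop S) (0 : κ ⊕ κ × κ → ℝ) := by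
    rw [analyticAt_pi_iff]
    intro j
    by_cases hj : j ∈ S
    · simp only [shearDrop, hj, if_true]
      exact hproj _
    · simp only [shearDrop, hj, if_false]
      exact (hproj _).fun_sub (Finset.analyticAt_fun_sum _ fun k _ => (hproj _).fun_mul (hproj _))
  have hdrop0 : shearDrop S (0 : κ ⊕ κ × κ → ℝ) = 0 := by
    funext j; simp [shearDrop]
  have htend : Tendsto (shearDrop S) (nhds (0 : κ ⊕ κ × κ → ℝ)) (nhds 0) := by
    have := hdrop.continuousAt.tendsto
    rwa [hdrop0] at this
  have hP' : ∀ i ∈ S', AnalyticAt ℝ (P' i) 0 := by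
    rintro (i | p) hi
    · simp only [P', Sum.elim_inl]
      exact AnalyticAt.fun_comp (by rw [hdrop0]; exact hP i (hS'.1 hi)) hdrop
    · exact absurd hi hS''
  have hN' : ∀ i ∈ S', ∀ᶠ x in nhds 0, (∀ j ∉ S', x j = 0) → P' i x = x i ^ N' i := by
    rintro (i | p) hi
    · filter_upwards [htend.eventually (hN i (hS'.1 hi))] with x hx hx0
      simp only [P', N', Sum.elim_inl]
      rw [hx]
      · simp [shearDrop, hS'.1 hi]
      · intro j hj
        simp only [shearDrop, hj, if_false]
        rw [hx0 _ (by rwa [hS']), Finset.sum_eq_zero, sub_zero]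
        intro k _
        rw [hx0 _ hS'', zero_mul]
    · exact absurd hi hS''
  obtain ⟨δ, hδ, B, c, hc, hcS, hrel⟩ := exists_monic_relation S' N' P' hP' hN'
  let F : κ → (κ ⊕ κ × κ → ℝ) → ℝ := fun i x =>
    x (Sum.inl i) ^ B + ∑ k ∈ Finset.range B, c (Sum.inl i) k x * x (Sum.inl i) ^ k
  have hZ' : ∀ᶠ v in nhds (0 : V), ∀ i ∈ S, v ∈ Z → P i (e v) = 0 := by
    rw [Filter.eventually_all_finset]; exact hZ
  have hZ'' : ∀ᶠ u in nhds (0 : κ → ℝ), ∀ i ∈ S, e.symm u ∈ Z → P i u = 0 := by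
    have ht : Tendsto e.symm (nhds 0) (nhds (0 : V)) := by
      have := e.symm.continuous.tendsto 0
      rwa [map_zero] at this
    filter_upwards [ht.eventually hZ'] with u hu i hi h
    simpa using hu i hi h
  obtain ⟨r, hr, hr'⟩ := Metric.eventually_nhds_iff.1 hZ''
  refine ⟨B, F, fun i hi => ?_, fun i hi x y hxy hp hi' => ?_, fun i hi z => ?_,
    min δ r / 2, by positivity, ?_⟩
  · refine ((hproj _).fun_pow B).fun_add (Finset.analyticAt_fun_sum _ fun k _ =>
      AnalyticAt.fun_mul (hc _ _ 0 (mem_ball_self hδ)) ((hproj _).fun_pow k))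
  · simp only [F, hi']
    congr 1
    refine Finset.sum_congr rfl fun k _ => ?_
    rw [hcS (Sum.inl i) k x y]
    rintro (j | p) hj
    · exact hxy j (by rwa [hS'] at hj)
    · exact hp p
  · obtain ⟨q, hq⟩ := exists_coeff_translate (B := B) (fun k => c (Sum.inl i) k z) (z (Sum.inl i))
    refine ⟨q, fun τ => ?_⟩
    rw [← hq]
    have h1 : (z + τ • Pi.single (Sum.inl i) 1 : κ ⊕ κ × κ → ℝ) (Sum.inl i) =
        z (Sum.inl i) + τ := by simp
    simp only [F, h1]
    congr 1
    refine Finset.sum_congr rfl fun k _ => ?_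
    rw [hcS (Sum.inl i) k _ z]
    intro j hj
    have : j ≠ Sum.inl i := by rintro rfl; exact hj (hS'.2 hi)
    simp [this]
  · intro v hv a h1 h2 i hi
    have hlt : min δ r / 2 < min δ r := by
      have : 0 < min δ r := lt_min hδ hr
      linarith
    refine hrel (shearLift S a (e v)) ?_ ?_ (Sum.inl i)
    · rw [mem_ball_zero_iff]
      exact h2.trans_lt (hlt.trans_le (min_le_left _ _))
    · rintro (k | p) hk
      · simp only [P', Sum.elim_inl, shearDrop_shearLift]
        refine hr' ?_ k (hS'.1 hk) (by simpa using hv)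
        rw [dist_zero_right]
        exact h1.trans_lt (hlt.trans_le (min_le_right _ _))
      · exact absurd hk hS''

end ParamRelation

lemma exists_pos_forall_le {ι : Type*} [Finite ι] (f : ι → ℝ) (hf : ∀ i, 0 < f i) :
    ∃ r > 0, ∀ i, r ≤ f i := by
  cases isEmpty_or_nonempty ι
  · exact ⟨1, one_pos, fun i => isEmptyElim i⟩
  · obtain ⟨i, hi⟩ := Finite.exists_min f
    exact ⟨f i, hf i, hi⟩

/-- If no monomial dominates the others, two of them are comparable. -/
lemma exists_resonance_of_small {B : ℕ} {Q m : ℕ → ℝ} {τ θ C D : ℝ} (hθ : 0 < θ) (hC : 0 < C)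
    (hD : 0 < D) (hm : ∀ k, 0 ≤ m k) (hup : ∀ k ≤ B, |Q k| ≤ D * m k)
    (hlo : ∀ k ≤ B, θ * m k ≤ |Q k|) (hB : 1 ≤ D * m B) (hτ0 : 0 < |τ|) (hτ : C * |τ| * D ≤ θ / 2)
    (hsum : |∑ k ∈ Finset.range (B + 1), Q k * τ ^ k| ≤ C * |τ| ^ (B + 1)) :
    ∃ k ≤ B, ∃ l ≤ B, k ≠ l ∧ 0 < m l * |τ| ^ l ∧
      θ / (2 * D * (B + 1)) * (m l * |τ| ^ l) ≤ m k * |τ| ^ k ∧ m k * |τ| ^ k ≤ m l * |τ| ^ l := by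
  obtain ⟨l, hl, hmax⟩ := (Finset.range (B + 1)).exists_max_image (fun k => m k * |τ| ^ k)
    ⟨0, by simp⟩
  have hle : ∀ {k}, k ∈ Finset.range (B + 1) ↔ k ≤ B := by simp
  have hBpos : 0 < m B * |τ| ^ B := by
    have : 0 < m B := by
      by_contra h
      have : m B = 0 := le_antisymm (not_lt.1 h) (hm B)
      rw [this] at hB; linarith
    positivity
  have hlB := hmax B (hle.2 le_rfl)
  have hlpos := hBpos.trans_le hlB
  by_contra! hcon
  have hsmall : ∀ k ∈ (Finset.range (B + 1)).erase l,
      |Q k * τ ^ k| ≤ θ / (2 * (B + 1)) * (m l * |τ| ^ l) := by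
    intro k hk
    rw [Finset.mem_erase, hle] at hk
    have h1 : m k * |τ| ^ k < θ / (2 * D * (B + 1)) * (m l * |τ| ^ l) := by
      by_contra! h
      exact absurd (hcon k hk.2 l (hle.1 hl) hk.1 hlpos h) (not_lt.2 (hmax k (hle.2 hk.2)))
    rw [abs_mul, abs_pow]
    calc |Q k| * |τ| ^ k ≤ D * m k * |τ| ^ k := by gcongr; exact hup k hk.2
      _ = D * (m k * |τ| ^ k) := by ring
      _ ≤ D * (θ / (2 * D * (B + 1)) * (m l * |τ| ^ l)) := by gcongr
      _ = _ := by field_simp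
  have h2 : |∑ k ∈ (Finset.range (B + 1)).erase l, Q k * τ ^ k| ≤
      B * (θ / (2 * (B + 1)) * (m l * |τ| ^ l)) := by
    refine (Finset.abs_sum_le_sum_abs _ _).trans ((Finset.sum_le_card_nsmul _ _ _ hsmall).trans ?_)
    rw [Finset.card_erase_of_mem hl, Finset.card_range, nsmul_eq_mul]
    simp
  have h3 : |Q l * τ ^ l| ≤ |∑ k ∈ Finset.range (B + 1), Q k * τ ^ k| +
      |∑ k ∈ (Finset.range (B + 1)).erase l, Q k * τ ^ k| := by
    rw [← Finset.add_sum_erase _ _ hl]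
    have := abs_sub_abs_le_abs_sub (Q l * τ ^ l) (-∑ k ∈ (Finset.range (B + 1)).erase l, Q k * τ ^ k)
    rw [abs_neg, sub_neg_eq_add] at this
    linarith
  have h4 : θ * (m l * |τ| ^ l) ≤ |Q l * τ ^ l| := by
    rw [abs_mul, abs_pow, ← mul_assoc]
    gcongr
    exact hlo l (hle.1 hl)
  have h5 : C * |τ| ^ (B + 1) ≤ θ / 2 * (m l * |τ| ^ l) := by
    calc C * |τ| ^ (B + 1) = C * |τ| * |τ| ^ B * 1 := by ring
      _ ≤ C * |τ| * |τ| ^ B * (D * m B) := by gcongr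
      _ = C * |τ| * D * (m B * |τ| ^ B) := by ring
      _ ≤ θ / 2 * (m l * |τ| ^ l) := by gcongr
  have h6 : B * (θ / (2 * (B + 1)) * (m l * |τ| ^ l)) < θ / 2 * (m l * |τ| ^ l) := by
    rw [← mul_assoc]
    gcongr
    rw [mul_div_assoc', div_lt_div_iff₀ (by positivity) (by positivity)]
    nlinarith
  linarith

section Cone

variable {κ : Type} [Fintype κ] [DecidableEq κ]

/-- The shear parameters attached to a choice of a vector for each coordinate in `S`. -/
def shearParam {S : Finset κ} {L : ℕ} (ξ : Fin L → {j // j ∉ S} → ℝ) (ι : κ → Fin L) : κ × κ → ℝ :=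
  fun p => if h : p.2 ∉ S then -ξ (ι p.1) ⟨p.2, h⟩ else 0

/-- `shearParam` with the block of `i` removed. -/
def shearParamErase {S : Finset κ} {L : ℕ} (ξ : Fin L → {j // j ∉ S} → ℝ) (i : κ) (ι : κ → Fin L) :
    κ × κ → ℝ :=
  fun p => if p.1 = i then 0 else shearParam ξ ι p

lemma norm_shearParam_apply_le {S : Finset κ} {L : ℕ} {ξ : Fin L → {j // j ∉ S} → ℝ} {ε : ℝ}
    (hε : 0 ≤ ε) (hξ : ∀ l, ‖ξ l‖ ≤ ε) (ι : κ → Fin L) (p : κ × κ) : |shearParam ξ ι p| ≤ ε := by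
  unfold shearParam
  split_ifs with h
  · simpa using hε
  · rw [abs_neg]; exact (norm_le_pi_norm (ξ (ι p.1)) ⟨p.2, h⟩).trans (hξ _)

lemma norm_shearParamErase_le {S : Finset κ} {L : ℕ} {ξ : Fin L → {j // j ∉ S} → ℝ} {ε : ℝ}
    (hε : 0 ≤ ε) (hξ : ∀ l, ‖ξ l‖ ≤ ε) (i : κ) (ι : κ → Fin L) : ‖shearParamErase ξ i ι‖ ≤ ε := by
  refine (pi_norm_le_iff_of_nonneg hε).2 fun p => ?_
  unfold shearParamErase
  split_ifs with h
  · simpa using hε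
  · exact norm_shearParam_apply_le hε hξ ι p

lemma shearParamErase_update {S : Finset κ} {L : ℕ} (ξ : Fin L → {j // j ∉ S} → ℝ) (i : κ)
    (ι : κ → Fin L) (s : Fin L) :
    shearParamErase ξ i (Function.update ι i s) = shearParamErase ξ i ι := by
  funext p
  unfold shearParamErase
  split_ifs with h
  · rfl
  · simp [shearParam, h]

lemma shearBy_erase {S : Finset κ} {L : ℕ} (ξ : Fin L → {j // j ∉ S} → ℝ) {i : κ} (hi : i ∈ S)
    (ι : κ → Fin L) (w : κ → ℝ) (j : {j // j ∉ S}) :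
    shearBy S (shearParamErase ξ i ι) w j = shearBy S (shearParam ξ ι) w j + ξ (ι i) j * w i := by
  unfold shearBy
  rw [← Finset.add_sum_erase _ _ hi, ← Finset.add_sum_erase _ _ hi]
  have h1 : ∑ x ∈ S.erase i, shearParamErase ξ i ι (x, ↑j) * w x =
      ∑ x ∈ S.erase i, shearParam ξ ι (x, ↑j) * w x :=
    Finset.sum_congr rfl fun k hk => by simp [shearParamErase, (Finset.mem_erase.1 hk).1]
  rw [h1]
  have h2 : shearParamErase ξ i ι (i, ↑j) = 0 := by simp [shearParamErase]
  have h3 : shearParam ξ ι (i, ↑j) = -ξ (ι i) j := by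
    unfold shearParam
    rw [dif_pos j.2]
  rw [h2, h3]; ring

lemma shearBy_sub (S : Finset κ) (a : κ × κ → ℝ) (u u' : κ → ℝ) (j : κ) :
    shearBy S a (u - u') j = shearBy S a u j - shearBy S a u' j := by
  simp only [shearBy, Pi.sub_apply, mul_sub, Finset.sum_sub_distrib]; ring

/-- For each point of `Z` there is a shear for which, at all but boundedly many scales, no other
point of `Z` lies in the corresponding cone. -/
theorem NoetherData.exists_cone {V : Type*} [NormedAddCommGroup V] [NormedSpace ℝ V]
    {Z : Set V} {S : Finset κ} {e : V ≃L[ℝ] (κ → ℝ)} {N : κ → ℕ} {P : κ → (κ → ℝ) → ℝ}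
    (hD : NoetherData Z S e N P) :
    ∃ ρ > 0, ∃ α > 0, ∃ M : ℕ, ∃ (ι : Type) (_ : Fintype ι) (a : ι → κ × κ → ℝ),
      ∀ v ∈ Z, ‖e v‖ ≤ ρ → ∃ i : ι, ∃ t : Finset ℕ, t.card ≤ M ∧ ∀ j : ℕ,
        (∃ v' ∈ Z, ‖e v'‖ ≤ ρ ∧ (1 / 2) ^ (j + 1) ≤ ‖e v' - e v‖ ∧ ‖e v' - e v‖ ≤ (1 / 2) ^ j ∧
          ∀ k ∉ S, |shearBy S (a i) (e v' - e v) k| ≤ α * ‖e v' - e v‖) → j ∈ t := by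
  classical
  obtain ⟨B, F, hF, hdep, hmon, ρ₁, hρ₁, hrel⟩ := hD.exists_sheared_relations
  have hex : ∀ i, ∃ ρ > 0, ∃ C > 0, ∃ c : (κ ⊕ κ × κ → ℝ) → ℕ → ({j // j ∉ S} → Fin (B + 1)) → ℝ,
      i ∈ S → ∀ z, ‖z‖ ≤ ρ → (∀ τ : ℝ, |τ| ≤ ρ → ∀ ξ : {j // j ∉ S} → ℝ, ‖ξ‖ ≤ 1 →
        |F i (z + τ • (∑ j, ξ j • Pi.single (Sum.inl j.1) 1 + Pi.single (Sum.inl i) 1)) -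
          ∑ k ∈ Finset.range (B + 1), polyEval (c z k) ξ * τ ^ k| ≤ C * |τ| ^ (B + 1)) ∧
        polyEval (c z B) 0 = 1 := by
    intro i
    by_cases hi : i ∈ S
    · obtain ⟨ρ, hρ, C, hC, c, hc⟩ := (hF i hi).exists_expansion B
        (fun j : {j // j ∉ S} => Pi.single (Sum.inl j.1) 1) (Pi.single (Sum.inl i) 1)
      exact ⟨ρ, hρ, C, hC, c, fun _ z hz => ⟨(hc z hz).1, (hc z hz).2 (hmon i hi z)⟩⟩
    · exact ⟨1, one_pos, 1, one_pos, 0, fun h => absurd h hi⟩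
  choose ρ' hρ' C' hC' c hc using hex
  obtain ⟨ρ₂, hρ₂, hρ₂'⟩ := exists_pos_forall_le ρ' hρ'
  obtain ⟨C, hC, hCle⟩ : ∃ C > 0, ∀ i, C' i ≤ C := by
    refine ⟨∑ i, C' i + 1, ?_, fun i => ?_⟩
    · have : 0 ≤ ∑ i, C' i := Finset.sum_nonneg fun i _ => (hC' i).le
      linarith
    · have := Finset.single_le_sum (f := C') (fun i _ => (hC' i).le) (Finset.mem_univ i)
      linarith
  obtain ⟨ε, hε, hε1, hε2, hε3⟩ : ∃ ε > 0, ε ≤ ρ₁ ∧ ε ≤ ρ₂ ∧ ε * (S.card + 1) ≤ 1 / 2 := by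
    refine ⟨min (min ρ₁ ρ₂) (1 / 2 / (S.card + 1)), by positivity,
      (min_le_left _ _).trans (min_le_left _ _), (min_le_left _ _).trans (min_le_right _ _), ?_⟩
    rw [← le_div_iff₀ (by positivity)]
    exact min_le_right _ _
  have hεS : ε * S.card ≤ 1 / 2 := by nlinarith
  have hε4 : ε ≤ 1 / 2 := by
    have : 0 ≤ ε * S.card := by positivity
    linarith
  set D₀ := (B + 1) ^ Fintype.card {j // j ∉ S} with hD₀
  set L := Fintype.card κ * ((B + 1) * D₀) + 1 with hL
  obtain ⟨ξ, hξ, θ, hθ, α₀, hα₀, hgrid⟩ := exists_robust_grid {j // j ∉ S} B L hε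
  obtain ⟨α, hα, hαα, hα4⟩ : ∃ α > 0, α ≤ α₀ ∧ α ≤ 1 / 4 :=
    ⟨min α₀ (1 / 4), by positivity, min_le_left _ _, min_le_right _ _⟩
  set D : ℝ := ((Fintype.card ({j // j ∉ S} → Fin (B + 1)) : ℕ) : ℝ) with hDdef
  have hDpos : 0 < D := by rw [hDdef]; exact_mod_cast Fintype.card_pos
  obtain ⟨M, hM⟩ := exists_finset_resonance (lam := θ / (2 * D * (B + 1))) (by positivity) B
  obtain ⟨ρ, hρ, hρa, hρb, hρc⟩ : ∃ ρ > 0, 2 * ρ ≤ ε ∧ 2 * ρ ≤ ρ₂ ∧ C * (2 * ρ) * D ≤ θ / 2 := by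
    refine ⟨min (ε / 2) (min (ρ₂ / 2) (θ / 2 / (2 * C * D))), by positivity, ?_, ?_, ?_⟩
    · linarith [min_le_left (ε / 2) (min (ρ₂ / 2) (θ / 2 / (2 * C * D)))]
    · linarith [(min_le_right (ε / 2) (min (ρ₂ / 2) (θ / 2 / (2 * C * D)))).trans (min_le_left _ _)]
    · have h := (min_le_right (ε / 2) (min (ρ₂ / 2) (θ / 2 / (2 * C * D)))).trans (min_le_right _ _)
      rw [le_div_iff₀ (by positivity)] at h
      linarith
  refine ⟨ρ, hρ, α, hα, Fintype.card κ * M, κ → Fin L, inferInstance, shearParam ξ,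
    fun v _ hv => ?_⟩
  set z : κ → (κ → Fin L) → κ ⊕ κ × κ → ℝ := fun i ι =>
    shearLift S (shearParamErase ξ i ι) (e v) with hz
  have hlift : ∀ i ι u, ‖u‖ ≤ ρ → ‖shearLift S (shearParamErase ξ i ι) u‖ ≤ ε := fun i ι u hu =>
    norm_shearLift_le S (norm_shearParamErase_le hε.le hξ i ι) (by linarith) (by linarith)
  let bad : κ → (κ → Fin L) → Finset (Fin L) := fun i ι =>
    (Finset.range (B + 1)).biUnion fun k => Finset.univ.filter fun l =>
      ∃ η, ‖η - ξ l‖ ≤ α₀ ∧ |polyEval (c i (z i ι) k) η| < θ * ‖c i (z i ι) k‖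
  obtain ⟨ι, hι⟩ := exists_avoiding bad (D := (B + 1) * D₀) (fun i ι => by
      refine (Finset.card_biUnion_le_card_mul _ _ D₀ fun k _ => ?_).trans (by simp)
      exact (hgrid (c i (z i ι) k) _ fun l hl => (Finset.mem_filter.1 hl).2).le)
    (fun i ι s => by simp only [bad, hz, shearParamErase_update]) (by omega)
  have hgood : ∀ i, ∀ k ≤ B, ∀ η, ‖η - ξ (ι i)‖ ≤ α →
      θ * ‖c i (z i ι) k‖ ≤ |polyEval (c i (z i ι) k) η| := by
    intro i k hk η hη
    by_contra! h
    refine hι i (Finset.mem_biUnion.2 ⟨k, Finset.mem_range.2 (by omega), ?_⟩)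
    exact Finset.mem_filter.2 ⟨Finset.mem_univ _, η, hη.trans hαα, h⟩
  choose t ht hjt using fun i => hM fun k => ‖c i (z i ι) k‖
  refine ⟨ι, Finset.univ.biUnion t, Finset.card_biUnion_le_card_mul _ _ _ fun i _ => ht i, ?_⟩
  rintro j ⟨v', hv', hv'ρ, hj1, hj2, hcone⟩
  set w := e v' - e v with hw
  have hw0 : 0 < ‖w‖ := lt_of_lt_of_le (by positivity) hj1
  obtain ⟨i, hi⟩ : ∃ i, ‖w‖ = |w i| := by
    have hne : Nonempty κ := by
      by_contra h
      rw [not_nonempty_iff] at h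
      rw [Subsingleton.elim w 0, norm_zero] at hw0
      exact lt_irrefl _ hw0
    obtain ⟨i, hi⟩ := Finite.exists_max fun i => |w i|
    exact ⟨i, le_antisymm ((pi_norm_le_iff_of_nonneg (abs_nonneg _)).2 hi) (norm_le_pi_norm w i)⟩
  have hiS : i ∈ S := by
    by_contra hiS
    have h1 := hcone i hiS
    have h2 : |∑ k ∈ S, shearParam ξ ι (k, i) * w k| ≤ ε * S.card * ‖w‖ := by
      refine (Finset.abs_sum_le_sum_abs _ _).trans ((Finset.sum_le_card_nsmul _ _ (ε * ‖w‖)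
        fun k _ => ?_).trans ?_)
      · rw [abs_mul]
        gcongr
        · exact norm_shearParam_apply_le hε.le hξ ι _
        · exact norm_le_pi_norm w k
      · rw [nsmul_eq_mul]; exact le_of_eq (by ring)
    have h3 : |w i| ≤ |shearBy S (shearParam ξ ι) w i| + |∑ k ∈ S, shearParam ξ ι (k, i) * w k| := by
      unfold shearBy
      have := abs_sub_abs_le_abs_sub (w i) (-∑ k ∈ S, shearParam ξ ι (k, i) * w k)
      rw [abs_neg, sub_neg_eq_add] at this
      linarith
    nlinarith
  set τ := w i with hτ
  have hτ0 : τ ≠ 0 := by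
    intro h
    rw [hi, h, abs_zero] at hw0
    exact lt_irrefl _ hw0
  set η : {j // j ∉ S} → ℝ := fun k => shearBy S (shearParamErase ξ i ι) w k / τ with hη
  have hηξ : ‖η - ξ (ι i)‖ ≤ α := by
    refine (pi_norm_le_iff_of_nonneg hα.le).2 fun k => ?_
    have h1 : (η - ξ (ι i)) k = shearBy S (shearParam ξ ι) w k / τ := by
      simp only [hη, Pi.sub_apply]
      rw [shearBy_erase ξ hiS]
      field_simp
      ring
    rw [h1, Real.norm_eq_abs, abs_div, div_le_iff₀ (abs_pos.2 hτ0), ← hi]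
    exact hcone k k.2
  have hη1 : ‖η‖ ≤ 1 := by
    have := norm_sub_norm_le η (ξ (ι i))
    linarith [hξ (ι i)]
  have hτρ : |τ| ≤ 2 * ρ := by
    rw [← hi]
    linarith [norm_sub_le (e v') (e v)]
  have hzn : ‖z i ι‖ ≤ ρ' i := (hlift i ι _ hv).trans (hε2.trans (hρ₂' i))
  obtain ⟨hexp, hone⟩ := hc i hiS (z i ι) hzn
  have hzero : F i (z i ι + τ • (∑ j, η j • Pi.single (Sum.inl j.1) 1 + Pi.single (Sum.inl i) 1)) = 0 := by
    rw [← hrel v' hv' (shearParamErase ξ i ι) (by linarith) ((hlift i ι _ hv'ρ).trans hε1) i hiS]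
    refine hdep i hiS _ _ (fun j hj => ?_) (fun p => ?_) ?_
    · have hji : j ≠ i := by rintro rfl; exact hj hiS
      have h1 : (∑ k : {j // j ∉ S}, η k • (Pi.single (Sum.inl k.1) 1 : κ ⊕ κ × κ → ℝ)) (Sum.inl j) =
          η ⟨j, hj⟩ := by
        rw [Finset.sum_apply, Finset.sum_eq_single ⟨j, hj⟩]
        · simp
        · intro k _ hk
          have : Sum.inl j ≠ (Sum.inl k.1 : κ ⊕ κ × κ) := by
            intro h
            exact hk (Subtype.ext (Sum.inl_injective h).symm)
          simp [this]
        · simp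
      rw [Pi.add_apply, Pi.smul_apply, Pi.add_apply, h1]
      have h2 : (Pi.single (Sum.inl i) 1 : κ ⊕ κ × κ → ℝ) (Sum.inl j) = 0 := by simp [hji]
      rw [h2, add_zero, smul_eq_mul]
      simp only [hη, hz, shearLift, Sum.elim_inl, if_neg hj]
      rw [mul_div_cancel₀ _ hτ0, hw, shearBy_sub]
      ring
    · simp [hz, shearLift]
    · have h1 : (∑ k : {j // j ∉ S}, η k • (Pi.single (Sum.inl k.1) 1 : κ ⊕ κ × κ → ℝ)) (Sum.inl i) =
          0 := by
        rw [Finset.sum_apply, Finset.sum_eq_zero]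
        intro k _
        have : Sum.inl i ≠ (Sum.inl k.1 : κ ⊕ κ × κ) := by
          intro h
          exact k.2 ((Sum.inl_injective h) ▸ hiS)
        simp [this]
      rw [Pi.add_apply, Pi.smul_apply, Pi.add_apply, h1]
      simp [hz, shearLift, hiS, hτ, hw]
  have hsum := hexp τ (hτρ.trans (hρb.trans (hρ₂' i))) η hη1
  rw [hzero, zero_sub, abs_neg] at hsum
  have hres := exists_resonance_of_small (m := fun k => ‖c i (z i ι) k‖) hθ hC hDpos
    (fun k => norm_nonneg _) (fun k _ => abs_polyEval_le (c i (z i ι) k) hη1)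
    (fun k hk => hgood i k hk η hηξ) (by
      have := abs_polyEval_le (c i (z i ι) B) (ξ := 0) (by simp)
      rwa [hone, abs_one] at this) (abs_pos.2 hτ0) (by
      refine le_trans ?_ hρc
      gcongr) (hsum.trans (by gcongr; exact hCle i))
  exact Finset.mem_biUnion.2 ⟨i, Finset.mem_univ _, hjt i j |τ| (by rwa [← hi]) (by rwa [← hi]) hres⟩

end Cone

section Coloring

variable {X : Type*}

lemma exists_color_class [MeasurableSpace X] {Γ : Type*} [Fintype Γ] [Nonempty Γ] (ν : Measure X) (A : Set X)
    (col : X → Γ) :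
    ∃ c, ν A ≤ Fintype.card Γ * ν (A ∩ {x | col x = c}) := by
  obtain ⟨c, hc⟩ := Finite.exists_max fun c => ν (A ∩ {x | col x = c})
  refine ⟨c, ?_⟩
  have h1 : A ⊆ ⋃ c, A ∩ {x | col x = c} := fun x hx => mem_iUnion.2 ⟨col x, hx, rfl⟩
  calc ν A ≤ ∑ c, ν (A ∩ {x | col x = c}) := (measure_mono h1).trans (measure_iUnion_fintype_le _ _)
    _ ≤ ∑ _c : Γ, ν (A ∩ {x | col x = c}) := Finset.sum_le_sum fun c' _ => hc c'
    _ = _ := by simp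

open Classical in
/-- `K` to the number of indices below `j` whose set contains `x`. -/
def badWeight (Bad : ℕ → Set X) (K : ENNReal) (j : ℕ) (x : X) : ENNReal :=
  K ^ ((Finset.range j).filter fun i => x ∈ Bad i).card

lemma badWeight_zero (Bad : ℕ → Set X) (K : ENNReal) (x : X) : badWeight Bad K 0 x = 1 := by
  simp [badWeight]

lemma badWeight_succ_mem {Bad : ℕ → Set X} {j : ℕ} {x : X} (K : ENNReal) (hx : x ∈ Bad j) :
    badWeight Bad K (j + 1) x = K * badWeight Bad K j x := by
  simp only [badWeight, Finset.range_add_one, Finset.filter_insert, hx, if_true]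
  rw [Finset.card_insert_of_notMem (by simp), pow_succ']

lemma badWeight_succ_notMem {Bad : ℕ → Set X} {j : ℕ} {x : X} (K : ENNReal) (hx : x ∉ Bad j) :
    badWeight Bad K (j + 1) x = badWeight Bad K j x := by
  simp only [badWeight, Finset.range_add_one, Finset.filter_insert, hx, if_false]

/-- Given bad sets with bounded multiplicity and a finite coloring at each scale, a large subset
consists of points whose bad scales all have a prescribed color. -/
lemma exists_coloring [MeasurableSpace X] {Γ : Type*} [Fintype Γ] [Nonempty Γ] (μ : Measure X) {E : Set X}
    (hE : MeasurableSet E) (hEμ : μ E ≠ ⊤) {Bad : ℕ → Set X} (hBad : ∀ j, MeasurableSet (Bad j))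
    {col : ℕ → X → Γ} (hcol : ∀ j c, MeasurableSet {x | col j x = c}) {M : ℕ}
    (hM : ∀ x ∈ E, ∃ t : Finset ℕ, t.card ≤ M ∧ ∀ j, x ∈ Bad j → j ∈ t) :
    ∃ F ⊆ E, MeasurableSet F ∧ μ E ≤ (Fintype.card Γ : ENNReal) ^ M * μ F ∧
      ∃ c : ℕ → Γ, ∀ x ∈ F, ∀ j, x ∈ Bad j → col j x = c j := by
  classical
  set K : ENNReal := ((Fintype.card Γ : ℕ) : ENNReal) with hK
  have hKt : K ≠ ⊤ := ENNReal.natCast_ne_top _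
  have hK1 : 1 ≤ K := by rw [hK]; exact_mod_cast Fintype.card_pos (α := Γ)
  set w := badWeight Bad K with hw
  have hstep : ∀ j (A : Set X), ∃ c, MeasurableSet A → ∫⁻ x in A, w j x ∂μ ≤
      ∫⁻ x in A ∩ {x | x ∈ Bad j → col j x = c}, w (j + 1) x ∂μ := by
    intro j A
    obtain ⟨c, hc⟩ := exists_color_class (μ.withDensity (w j)) (A ∩ Bad j) (col j)
    refine ⟨c, fun hA => ?_⟩
    have hAB : MeasurableSet (A ∩ Bad j) := hA.inter (hBad j)
    rw [withDensity_apply _ hAB, withDensity_apply _ (hAB.inter (hcol j c))] at hc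
    have hset : A ∩ {x | x ∈ Bad j → col j x = c} =
        (A \ Bad j) ∪ (A ∩ Bad j ∩ {x | col j x = c}) := by
      ext x
      by_cases hx : x ∈ Bad j <;> simp [hx]
    have hdisj : Disjoint (A \ Bad j) (A ∩ Bad j ∩ {x | col j x = c}) :=
      disjoint_left.2 fun x hx hx' => hx.2 hx'.1.2
    rw [hset, lintegral_union (hAB.inter (hcol j c)) hdisj,
      ← lintegral_inter_add_sdiff (w j) A (hBad j), add_comm]
    refine add_le_add (le_of_eq ?_) (hc.trans (le_of_eq ?_))
    · exact setLIntegral_congr_fun (hA.diff (hBad j)) fun x hx =>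
        (badWeight_succ_notMem K hx.2).symm
    · rw [← lintegral_const_mul' _ _ hKt]
      exact setLIntegral_congr_fun (hAB.inter (hcol j c)) fun x hx =>
        (badWeight_succ_mem K hx.1.2).symm
  choose g hg using hstep
  let A : ℕ → Set X := fun j => Nat.rec E (fun j A => A ∩ {x | x ∈ Bad j → col j x = g j A}) j
  have hA0 : A 0 = E := rfl
  have hAs : ∀ j, A (j + 1) = A j ∩ {x | x ∈ Bad j → col j x = g j (A j)} := fun j => rfl
  have hAm : ∀ j, MeasurableSet (A j) := by
    intro j
    induction j with
    | zero => exact hE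
    | succ j ih =>
      rw [hAs]
      refine ih.inter ?_
      have : {x | x ∈ Bad j → col j x = g j (A j)} = (Bad j)ᶜ ∪ {x | col j x = g j (A j)} := by
        ext x
        by_cases hx : x ∈ Bad j <;> simp [hx]
      rw [this]
      exact (hBad j).compl.union (hcol j _)
  have hAanti : Antitone A := antitone_nat_of_succ_le fun j => by
    rw [hAs]; exact inter_subset_left
  have hAE : ∀ j, A j ⊆ E := fun j => hAanti (Nat.zero_le j)
  have hΦ : ∀ j, μ E ≤ ∫⁻ x in A j, w j x ∂μ := by
    intro j
    induction j with
    | zero => simp [hA0, hw, badWeight_zero]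
    | succ j ih => exact ih.trans (hg j (A j) (hAm j))
  have hle : ∀ j, μ E ≤ K ^ M * μ (A j) := by
    intro j
    refine (hΦ j).trans ?_
    refine (setLIntegral_mono measurable_const (g := fun _ => K ^ M) fun x hx => ?_).trans
      (by rw [setLIntegral_const])
    obtain ⟨t, ht, hjt⟩ := hM x (hAE j hx)
    refine pow_le_pow_right₀ hK1 (le_trans (Finset.card_le_card ?_) ht)
    intro i hi
    exact hjt i (Finset.mem_filter.1 hi).2
  refine ⟨⋂ j, A j, iInter_subset_of_subset 0 (hAE 0), MeasurableSet.iInter hAm, ?_,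
    fun j => g j (A j), fun x hx j hxj => ?_⟩
  · have ht := tendsto_measure_iInter_atTop (μ := μ) (fun j => (hAm j).nullMeasurableSet) hAanti
      ⟨0, hEμ⟩
    have ht' := ENNReal.Tendsto.const_mul (a := K ^ M) ht
      (Or.inr (ENNReal.pow_ne_top hKt))
    exact ge_of_tendsto' ht' hle
  · have := mem_iInter.1 hx (j + 1)
    rw [hAs] at this
    exact this.2 hxj

end Coloring

lemma abs_sub_lt_of_floor_cast_eq {a b s : ℝ} (hs : 0 < s) (hab : |a - b| ≤ 2 * s)
    (h : ((⌊a / s⌋ : ℤ) : ZMod 3) = ((⌊b / s⌋ : ℤ) : ZMod 3)) : |a - b| < s := by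
  have h1 : |a / s - b / s| ≤ 2 := by
    rw [← sub_div, abs_div, abs_of_pos hs, div_le_iff₀ hs]; exact hab
  rw [abs_le] at h1
  have hdvd := (ZMod.intCast_eq_intCast_iff_dvd_sub _ _ 3).1 h
  have h2 : ⌊a / s⌋ - ⌊b / s⌋ < 3 := by
    have : ((⌊a / s⌋ - ⌊b / s⌋ : ℤ) : ℝ) < 3 := by
      push_cast; linarith [Int.floor_le (a / s), Int.lt_floor_add_one (b / s)]
    exact_mod_cast this
  have h3 : ⌊b / s⌋ - ⌊a / s⌋ < 3 := by
    have : ((⌊b / s⌋ - ⌊a / s⌋ : ℤ) : ℝ) < 3 := by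
      push_cast; linarith [Int.floor_le (b / s), Int.lt_floor_add_one (a / s)]
    exact_mod_cast this
  have h4 : ⌊a / s⌋ = ⌊b / s⌋ := by omega
  have h5 := Int.abs_sub_lt_one_of_floor_eq_floor h4
  rwa [← sub_div, abs_div, abs_of_pos hs, div_lt_one hs] at h5

section

variable {d : ℕ} {μ : Measure (Euc d)} {φ : ℝ → ENNReal}

/-- The projection along a sheared copy of the coordinate plane of `S`. -/
def shearProj {κ : Type*} [Fintype κ] [DecidableEq κ] (S : Finset κ) (a : κ × κ → ℝ) :
    (κ → ℝ) →ₗ[ℝ] ({j // j ∉ S} → ℝ) where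
  toFun u j := shearBy S a u j
  map_add' u v := by
    funext j
    simp only [shearBy, Pi.add_apply, mul_add, Finset.sum_add_distrib]; ring
  map_smul' c u := by
    funext j
    simp only [shearBy, Pi.smul_apply, smul_eq_mul, RingHom.id_apply, mul_add, Finset.mul_sum]
    congr 1
    exact Finset.sum_congr rfl fun k _ => by ring

lemma measurableSet_floor_color (e : Euc d ≃L[ℝ] (Fin d → ℝ)) (s : ℝ) (c : Fin d → ZMod 3) :
    MeasurableSet {x : Euc d | (fun k => ((⌊e x k / s⌋ : ℤ) : ZMod 3)) = c} := by
  have : {x : Euc d | (fun k => ((⌊e x k / s⌋ : ℤ) : ZMod 3)) = c} =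
      ⋂ k, {x | ((⌊e x k / s⌋ : ℤ) : ZMod 3) = c k} := by
    ext x; simp [funext_iff]
  rw [this]
  refine MeasurableSet.iInter fun k => ?_
  have hm : Measurable fun x : Euc d => ⌊e x k / s⌋ :=
    Int.measurable_floor.comp
      (((continuous_apply k).comp e.continuous).measurable.div_const s)
  exact hm (show MeasurableSet {n : ℤ | (n : ZMod 3) = c k} from trivial)

theorem NoetherData.exists_bilipschitz [IsLocallyFiniteMeasure μ] {x₀ : Euc d}
    {S : Finset (Fin d)} {e : Euc d ≃L[ℝ] (Fin d → ℝ)} {N : Fin d → ℕ}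
    {P : Fin d → (Fin d → ℝ) → ℝ} (hD : NoetherData {v | x₀ + v ∈ msupport μ} S e N P) :
    ∃ r₁ > 0, ∃ K : ℕ, ∃ C₁ > 0, ∃ C₂ > 0, ∀ x ∈ msupport μ, dist x x₀ ≤ r₁ →
      ∀ R, 0 < R → R ≤ r₁ → ∃ T : Euc d →L[ℝ] ({j // j ∉ S} → ℝ), ‖T‖ ≤ C₁ ∧
        ∃ F ⊆ closedBall x R ∩ msupport μ, MeasurableSet F ∧ μ (closedBall x R) ≤ K * μ F ∧
          ∀ y ∈ F, ∀ y' ∈ F, ‖y - y'‖ ≤ C₂ * ‖T y - T y'‖ := by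
  obtain ⟨ρ, hρ, α, hα, M, ι, _, a, hcone⟩ := hD.exists_cone
  set T : ι → Euc d →L[ℝ] ({j // j ∉ S} → ℝ) := fun i =>
    (shearProj S (a i)).toContinuousLinearMap.comp (e : Euc d →L[ℝ] (Fin d → ℝ)) with hT
  have hTa : ∀ i v (k : {j // j ∉ S}), T i v k = shearBy S (a i) (e v) k := fun i v k => rfl
  set A : ℝ := ‖(e : Euc d →L[ℝ] (Fin d → ℝ))‖ + 1 with hA
  have hA0 : 0 < A := by positivity
  have heA : ∀ v, ‖e v‖ ≤ A * ‖v‖ := fun v =>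
    ((e : Euc d →L[ℝ] (Fin d → ℝ)).le_opNorm v).trans
      (mul_le_mul_of_nonneg_right (by rw [hA]; linarith) (norm_nonneg _))
  set A' : ℝ := ‖(e.symm : (Fin d → ℝ) →L[ℝ] Euc d)‖ + 1 with hA'
  have hA'0 : 0 < A' := by positivity
  have heA' : ∀ v, ‖v‖ ≤ A' * ‖e v‖ := fun v => by
    have := (e.symm : (Fin d → ℝ) →L[ℝ] Euc d).le_opNorm (e v)
    simp only [ContinuousLinearEquiv.coe_coe, e.symm_apply_apply] at this
    exact this.trans (mul_le_mul_of_nonneg_right (by rw [hA']; linarith) (norm_nonneg _))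
  set G : Set (Euc d) := {x | x ∈ msupport μ ∧ ‖e (x - x₀)‖ ≤ ρ} with hG
  have hGcl : IsClosed G := (isClosed_msupport (μ := μ)).inter
    (isClosed_le (f := fun x => ‖e (x - x₀)‖) (by fun_prop) continuous_const)
  have hGc : IsCompact G := by
    refine (isCompact_closedBall x₀ (A' * ρ)).of_isClosed_subset hGcl fun x hx => ?_
    rw [mem_closedBall, dist_eq_norm]
    exact (heA' _).trans (mul_le_mul_of_nonneg_left hx.2 hA'0.le)
  set B : ι → ℕ → Set (Euc d × Euc d) := fun i j => {p | (1 / 2 : ℝ) ^ (j + 1) ≤ ‖e (p.2 - p.1)‖ ∧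
    ‖e (p.2 - p.1)‖ ≤ (1 / 2) ^ j ∧
    ∀ k : {j // j ∉ S}, |T i (p.2 - p.1) k| ≤ α * ‖e (p.2 - p.1)‖} with hB
  have hBcl : ∀ i j, IsClosed (B i j) := fun i j => by
    have hcont : Continuous fun p : Euc d × Euc d => ‖e (p.2 - p.1)‖ := by fun_prop
    refine (isClosed_le continuous_const hcont).inter
      ((isClosed_le hcont continuous_const).inter ?_)
    have : {p : Euc d × Euc d | ∀ k : {j // j ∉ S}, |T i (p.2 - p.1) k| ≤ α * ‖e (p.2 - p.1)‖} =
      ⋂ k : {j // j ∉ S}, {p | |T i (p.2 - p.1) k| ≤ α * ‖e (p.2 - p.1)‖} := by ext p; simp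
    change IsClosed {p : Euc d × Euc d |
      ∀ k : {j // j ∉ S}, |T i (p.2 - p.1) k| ≤ α * ‖e (p.2 - p.1)‖}
    rw [this]
    exact isClosed_iInter fun k => isClosed_le (by fun_prop) (by fun_prop)
  set Bad : ι → ℕ → Set (Euc d) := fun i j => Prod.fst '' (G ×ˢ G ∩ B i j) with hBad
  have hBadm : ∀ i j, MeasurableSet (Bad i j) := fun i j =>
    (((hGc.prod hGc).inter_right (hBcl i j)).image continuous_fst).isClosed.measurableSet
  set Good : ι → Set (Euc d) := fun i =>
    ⋃ t : {t : Finset ℕ // t.card ≤ M}, ⋂ j : ℕ, {x | x ∈ Bad i j → j ∈ t.1} with hGood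
  have hGoodm : ∀ i, MeasurableSet (Good i) := fun i => by
    refine MeasurableSet.iUnion fun t => MeasurableSet.iInter fun j => ?_
    by_cases hj : j ∈ t.1
    · simp [hj]
    · simp only [hj, imp_false]
      exact (hBadm i j).compl
  have hcover : ∀ x ∈ G, ∃ i, x ∈ Good i := by
    intro x hx
    obtain ⟨i, t, ht, hjt⟩ := hcone (x - x₀) (by simpa using hx.1) hx.2
    refine ⟨i, mem_iUnion.2 ⟨⟨t, ht⟩, mem_iInter.2 fun j => ?_⟩⟩
    rintro ⟨⟨y, y'⟩, ⟨⟨-, hy'⟩, h1, h2, h3⟩, rfl⟩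
    have hsub : e (y' - x₀) - e (y - x₀) = e (y' - y) := by rw [← map_sub]; congr 1; abel
    refine hjt j ⟨y' - x₀, by simpa using hy'.1, hy'.2, ?_, ?_, ?_⟩
    · rw [hsub]; exact h1
    · rw [hsub]; exact h2
    · intro k hk
      rw [hsub]
      exact h3 ⟨k, hk⟩
  set r₁ : ℝ := min ρ 1 / (2 * A) with hr₁
  have hr₁0 : 0 < r₁ := div_pos (lt_min hρ one_pos) (by positivity)
  have hr₁A : A * (2 * r₁) = min ρ 1 := by rw [hr₁]; field_simp
  refine ⟨r₁, hr₁0, Fintype.card ι * Fintype.card (Fin d → ZMod 3) ^ M, ∑ i, ‖T i‖ + 1,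
    by positivity, A' / α, by positivity, fun x hx hxx₀ R hR hRr => ?_⟩
  have hsubG : closedBall x R ∩ msupport μ ⊆ G := fun y hy => by
    refine ⟨hy.2, (heA _).trans ?_⟩
    have : ‖y - x₀‖ ≤ 2 * r₁ := by
      rw [← dist_eq_norm]; linarith [dist_triangle y x x₀, mem_closedBall.1 hy.1]
    calc A * ‖y - x₀‖ ≤ A * (2 * r₁) := by gcongr
      _ ≤ ρ := hr₁A.trans_le (min_le_left _ _)
  have hxG : x ∈ G := hsubG ⟨mem_closedBall_self hR.le, hx⟩
  have : Nonempty ι := ⟨(hcover x hxG).choose⟩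
  set E : ι → Set (Euc d) := fun i => closedBall x R ∩ msupport μ ∩ Good i with hE
  have hEm : ∀ i, MeasurableSet (E i) := fun i =>
    (measurableSet_closedBall.inter isClosed_msupport.measurableSet).inter (hGoodm i)
  obtain ⟨i, hi⟩ := Finite.exists_max fun i => μ (E i)
  have hμi : μ (closedBall x R) ≤ Fintype.card ι * μ (E i) := by
    calc μ (closedBall x R) ≤ μ ((⋃ i, E i) ∪ (msupport μ)ᶜ) := by
          refine measure_mono fun y hy => ?_
          by_cases hyS : y ∈ msupport μ
          · obtain ⟨i, hi⟩ := hcover y (hsubG ⟨hy, hyS⟩)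
            exact Or.inl (mem_iUnion.2 ⟨i, ⟨hy, hyS⟩, hi⟩)
          · exact Or.inr hyS
      _ ≤ μ (⋃ i, E i) + 0 := by
          rw [← measure_compl_msupport (μ := μ)]; exact measure_union_le _ _
      _ ≤ ∑ i, μ (E i) := by rw [add_zero]; exact measure_iUnion_fintype_le _ _
      _ ≤ ∑ _i' : ι, μ (E i) := Finset.sum_le_sum fun i' _ => hi i'
      _ = _ := by simp
  have hEtop : μ (E i) ≠ ⊤ :=
    ((measure_mono (inter_subset_left.trans inter_subset_left)).trans_lt
      (isCompact_closedBall x R).measure_lt_top).ne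
  obtain ⟨F, hFE, hFm, hμF, c, hc⟩ := exists_coloring (Γ := Fin d → ZMod 3) μ (hEm i) hEtop
    (Bad := Bad i) (hBadm i) (col := fun j x k => ((⌊e x k / (1 / 2) ^ (j + 1)⌋ : ℤ) : ZMod 3))
    (fun j c => measurableSet_floor_color e _ c) (M := M) (fun y hy => by
      obtain ⟨t, ht⟩ := mem_iUnion.1 hy.2
      exact ⟨t.1, t.2, fun j hj => mem_iInter.1 ht j hj⟩)
  refine ⟨T i, ?_, F, hFE.trans inter_subset_left, hFm, ?_, ?_⟩
  · have := Finset.single_le_sum (f := fun i => ‖T i‖) (fun i _ => norm_nonneg _)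
      (Finset.mem_univ i)
    linarith
  · refine hμi.trans ((mul_le_mul_right hμF _).trans (le_of_eq ?_))
    push_cast
    ring
  · intro y hy y' hy'
    by_cases hyy : y = y'
    · simp [hyy]
    have hyG := hsubG (hFE hy).1
    have hy'G := hsubG (hFE hy').1
    have hu0 : 0 < ‖e (y' - y)‖ := by
      rw [norm_pos_iff]; simpa [sub_eq_zero] using fun h => hyy h.symm
    have hu1 : ‖e (y' - y)‖ ≤ 1 := by
      refine (heA _).trans ?_
      have : ‖y' - y‖ ≤ 2 * r₁ := by
        rw [← dist_eq_norm]
        linarith [dist_triangle_right y' y x, mem_closedBall.1 (hFE hy).1.1,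
          mem_closedBall.1 (hFE hy').1.1]
      calc A * ‖y' - y‖ ≤ A * (2 * r₁) := by gcongr
        _ ≤ 1 := hr₁A.trans_le (min_le_right _ _)
    obtain ⟨j, hj1, hj2⟩ := exists_nat_pow_near_of_lt_one hu0 hu1 (y := (1 / 2 : ℝ))
      (by norm_num) (by norm_num)
    have hsymm : e (y - y') = -e (y' - y) := by rw [← map_neg]; congr 1; abel
    obtain ⟨k, hk⟩ : ∃ k : {j // j ∉ S}, α * ‖e (y' - y)‖ < |T i (y' - y) k| := by
      by_contra! hcon
      have hyB : y ∈ Bad i j := ⟨(y, y'), ⟨⟨hyG, hy'G⟩, hj1.le, hj2, hcon⟩, rfl⟩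
      have hy'B : y' ∈ Bad i j := by
        refine ⟨(y', y), ⟨⟨hy'G, hyG⟩, ?_, ?_, fun k => ?_⟩, rfl⟩
        · simpa only [hsymm, norm_neg] using hj1.le
        · simpa only [hsymm, norm_neg] using hj2
        · have : T i (y - y') = -T i (y' - y) := by rw [← map_neg]; congr 1; abel
          simpa only [hsymm, norm_neg, this, Pi.neg_apply, abs_neg] using hcon k
      have hcol := (hc y' hy' j hy'B).trans (hc y hy j hyB).symm
      refine absurd hj1 (not_lt.2 (le_of_lt ((pi_norm_lt_iff (by positivity)).2 fun k => ?_)))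
      have hsub : e (y' - y) k = e y' k - e y k := by rw [map_sub]; rfl
      rw [hsub, Real.norm_eq_abs]
      refine abs_sub_lt_of_floor_cast_eq (by positivity) ?_ (congrFun hcol k)
      rw [← hsub, ← Real.norm_eq_abs]
      refine (norm_le_pi_norm _ k).trans (hj2.trans (le_of_eq ?_))
      rw [pow_succ]; ring
    have h1 : α * ‖e (y' - y)‖ ≤ ‖T i y - T i y'‖ := by
      rw [norm_sub_rev, ← map_sub]
      exact hk.le.trans (norm_le_pi_norm (T i (y' - y)) k)
    calc ‖y - y'‖ = ‖y' - y‖ := norm_sub_rev _ _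
      _ ≤ A' * ‖e (y' - y)‖ := heA' _
      _ = A' / α * (α * ‖e (y' - y)‖) := by field_simp
      _ ≤ _ := by gcongr

end

section

variable {d : ℕ} {μ : Measure (Euc d)} {φ : ℝ → ENNReal}

lemma exists_lipschitz_range_superset {J : Type*} [Fintype J] (C : ℝ) :
    ∃ M > 0, ∀ (T : Euc d → J → ℝ) (F : Set (Euc d)),
      (∀ y ∈ F, ∀ y' ∈ F, ‖y - y'‖ ≤ C * ‖T y - T y'‖) →
      ∃ g : EuclideanSpace ℝ (Fin (Fintype.card J)) → Euc d,
        LipschitzWith (Real.toNNReal M) g ∧ F ⊆ range g := by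
  let E := EuclideanSpace.equiv (Fin d) ℝ
  let L : EuclideanSpace ℝ (Fin (Fintype.card J)) ≃L[ℝ] (J → ℝ) :=
    ContinuousLinearEquiv.ofFinrankEq (by simp)
  set KE := ‖(E : Euc d →L[ℝ] (Fin d → ℝ))‖₊
  set KE' := ‖(E.symm : (Fin d → ℝ) →L[ℝ] Euc d)‖₊
  set KL := ‖(L : EuclideanSpace ℝ (Fin (Fintype.card J)) →L[ℝ] (J → ℝ))‖₊
  refine ⟨(KE' * (KE * C.toNNReal * KL) + 1 : NNReal), by positivity, fun T F hF => ?_⟩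
  have hinj : InjOn T F := fun y hy y' hy' h => by
    have := hF y hy y' hy'
    rw [h, sub_self, norm_zero, mul_zero] at this
    exact sub_eq_zero.1 (norm_le_zero_iff.1 this)
  have hinv : ∀ y ∈ F, Function.invFunOn T F (T y) = y := fun y hy =>
    hinj (Function.invFunOn_mem ⟨y, hy, rfl⟩) hy (Function.invFunOn_eq ⟨y, hy, rfl⟩)
  have hlip : LipschitzOnWith C.toNNReal (Function.invFunOn T F) (T '' F) := by
    refine LipschitzOnWith.of_dist_le_mul ?_
    rintro _ ⟨y, hy, rfl⟩ _ ⟨y', hy', rfl⟩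
    rw [hinv y hy, hinv y' hy', dist_eq_norm, dist_eq_norm]
    exact (hF y hy y' hy').trans
      (mul_le_mul_of_nonneg_right (Real.le_coe_toNNReal C) (norm_nonneg _))
  have hElip : LipschitzWith KE E := (E : Euc d →L[ℝ] (Fin d → ℝ)).lipschitz
  obtain ⟨f, hf, hfeq⟩ := (hElip.comp_lipschitzOnWith hlip).extend_pi
  refine ⟨fun z => E.symm (f (L z)), ?_, fun y hy => ⟨L.symm (T y), ?_⟩⟩
  · have h1 : LipschitzWith (KE' * (KE * C.toNNReal * KL)) fun z => E.symm (f (L z)) :=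
      (E.symm : (Fin d → ℝ) →L[ℝ] Euc d).lipschitz.comp (hf.comp
        (L : EuclideanSpace ℝ (Fin (Fintype.card J)) →L[ℝ] (J → ℝ)).lipschitz)
    refine h1.weaken ?_
    rw [Real.toNNReal_coe]
    exact le_self_add
  · have := hfeq (mem_image_of_mem T hy)
    simp only [Function.comp_apply, hinv y hy] at this
    simp [← this]

/-- A set of positive measure on which a linear map to `ℝ^J` is bilipschitz forces the distribution
function to decay no faster than `r ^ card J`. -/
lemma IsDistributionFunction.le_of_bilipschitz [IsLocallyFiniteMeasure μ]
    (h : IsDistributionFunction μ φ) {J : Type*} [Fintype J] {T : Euc d →L[ℝ] (J → ℝ)} {C : ℝ}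
    (hC : 0 < C) {x : Euc d} {R : ℝ} {F : Set (Euc d)} (hF : F ⊆ closedBall x R ∩ msupport μ)
    (hμF : μ F ≠ 0) (hT : ∀ y ∈ F, ∀ y' ∈ F, ‖y - y'‖ ≤ C * ‖T y - T y'‖) :
    ∃ c > 0, ∃ r₀ > 0, ∀ r, 0 < r → r ≤ r₀ → ENNReal.ofReal (c * r ^ Fintype.card J) ≤ φ r := by
  classical
  have hFtop : μ F ≠ ⊤ := ((measure_mono (hF.trans inter_subset_left)).trans_lt
    (isCompact_closedBall x R).measure_lt_top).ne
  have hm : 0 < (μ F).toReal := ENNReal.toReal_pos hμF hFtop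
  set m := (μ F).toReal
  have hbd : ∀ y ∈ F, ‖T y‖ ≤ ‖T‖ * (‖x‖ + |R|) := fun y hy => by
    refine (T.le_opNorm y).trans (mul_le_mul_of_nonneg_left ?_ (norm_nonneg _))
    have h1 := mem_closedBall.1 (hF hy).1
    rw [dist_eq_norm] at h1
    have h2 := norm_add_le x (y - x)
    rw [add_sub_cancel] at h2
    linarith [le_abs_self R]
  set B := ‖T‖ * (‖x‖ + |R|)
  have hB : 0 ≤ B := by positivity
  set D := 2 * B + 3
  have hD : 0 < D := by positivity
  refine ⟨m * (1 / (C * D)) ^ Fintype.card J, by positivity, C, hC, fun r hr hrC => ?_⟩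
  set δ := r / C with hδ
  have hδ0 : 0 < δ := by positivity
  have hδ1 : δ ≤ 1 := by rw [hδ, div_le_one hC]; exact hrC
  set n : ℤ := ⌈B / δ⌉ with hn
  have hn0 : 0 ≤ n := Int.ceil_nonneg (by positivity)
  set cells := Fintype.piFinset fun _ : J => Finset.Icc (-n) n
  set q : Euc d → J → ℤ := fun y k => ⌊T y k / δ⌋
  have hcells : ∀ y ∈ F, q y ∈ cells := fun y hy => by
    refine Fintype.mem_piFinset.2 fun k => ?_
    have h1 : |T y k / δ| ≤ B / δ := by
      rw [abs_div, abs_of_pos hδ0]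
      gcongr
      exact (norm_le_pi_norm (T y) k).trans (hbd y hy)
    have h2 := abs_le.1 (h1.trans (Int.le_ceil (B / δ)))
    rw [Finset.mem_Icc]
    refine ⟨Int.le_floor.2 (by push_cast; exact h2.1), ?_⟩
    exact_mod_cast (Int.floor_le (T y k / δ)).trans h2.2
  have hcell : ∀ p, μ (F ∩ {y | q y = p}) ≤ φ r := by
    intro p
    rcases (F ∩ {y | q y = p}).eq_empty_or_nonempty with he | ⟨y, hy, hyp⟩
    · simp [he]
    · rw [← h.2.2 y (hF hy).2 r hr]
      refine measure_mono fun y' hy' => ?_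
      rw [mem_closedBall, dist_eq_norm]
      have hTy : ‖T y' - T y‖ ≤ δ := by
        refine (pi_norm_le_iff_of_nonneg hδ0.le).2 fun k => ?_
        have hk : ⌊T y' k / δ⌋ = ⌊T y k / δ⌋ := congrFun (hy'.2.trans hyp.symm) k
        have := Int.abs_sub_lt_one_of_floor_eq_floor hk
        rw [← sub_div, abs_div, abs_of_pos hδ0, div_lt_one hδ0] at this
        exact this.le
      calc ‖y' - y‖ ≤ C * ‖T y' - T y‖ := hT _ hy'.1 _ hy
        _ ≤ C * δ := by gcongr
        _ = r := by rw [hδ]; field_simp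
  have hcard : (cells.card : ℝ) ≤ (D / δ) ^ Fintype.card J := by
    simp only [cells, Fintype.card_piFinset, Finset.prod_const, Finset.card_univ, Int.card_Icc]
    push_cast
    gcongr
    have h1 : ((n + 1 - -n).toNat : ℝ) = 2 * n + 1 := by
      have : ((n + 1 - -n).toNat : ℤ) = 2 * n + 1 := by omega
      exact_mod_cast this
    rw [h1, le_div_iff₀ hδ0]
    have h2 : (n : ℝ) * δ < B + δ := by
      have := mul_lt_mul_of_pos_right (Int.ceil_lt_add_one (B / δ)) hδ0
      rwa [add_mul, div_mul_cancel₀ _ hδ0.ne', one_mul] at this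
    simp only [D]
    nlinarith
  have hsum : μ F ≤ cells.card * φ r := by
    calc μ F ≤ μ (⋃ p ∈ cells, F ∩ {y | q y = p}) :=
          measure_mono fun y hy => mem_iUnion₂.2 ⟨q y, hcells y hy, hy, rfl⟩
      _ ≤ ∑ p ∈ cells, μ (F ∩ {y | q y = p}) := measure_biUnion_finset_le _ _
      _ ≤ ∑ _p ∈ cells, φ r := Finset.sum_le_sum fun p _ => hcell p
      _ = _ := by simp
  have hφtop := (h.2.1 r hr).2.ne
  have hmf : m ≤ (D / δ) ^ Fintype.card J * (φ r).toReal := by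
    have h1 := ENNReal.toReal_mono (ENNReal.mul_ne_top (ENNReal.natCast_ne_top _) hφtop) hsum
    rw [ENNReal.toReal_mul, ENNReal.toReal_natCast] at h1
    exact h1.trans (mul_le_mul_of_nonneg_right hcard ENNReal.toReal_nonneg)
  refine ENNReal.ofReal_le_of_le_toReal ?_
  have hδr : 1 / (C * D) * r = (D / δ)⁻¹ := by rw [hδ]; field_simp
  rw [mul_assoc, ← mul_pow, hδr, inv_pow, ← div_eq_mul_inv, div_le_iff₀ (by positivity)]
  linarith [hmf]

lemma le_of_mul_pow_le_mul_pow {c C r₀ : ℝ} {m n : ℕ} (hc : 0 < c) (hr₀ : 0 < r₀)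
    (h : ∀ r, 0 < r → r ≤ r₀ → c * r ^ n ≤ C * r ^ m) : m ≤ n := by
  by_contra! hlt
  obtain ⟨k, rfl⟩ := Nat.exists_eq_add_of_lt hlt
  have h1 : ∀ r, 0 < r → r ≤ r₀ → c ≤ C * r ^ (k + 1) := fun r hr hr' => by
    have := h r hr hr'
    rw [add_assoc, pow_add, mul_left_comm, mul_comm] at this
    exact le_of_mul_le_mul_left this (pow_pos hr n)
  have h2 : Tendsto (fun r : ℝ => C * r ^ (k + 1)) (nhdsWithin 0 (Ioi 0)) (nhds 0) := by
    have : Continuous fun r : ℝ => C * r ^ (k + 1) := by fun_prop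
    simpa using (this.tendsto 0).mono_left nhdsWithin_le_nhds
  have h3 : c ≤ 0 := by
    refine ge_of_tendsto h2 ?_
    filter_upwards [Ioc_mem_nhdsGT hr₀] with r hr using h1 r hr.1 hr.2
  linarith

/-- The distribution function is comparable to `r ^ n` at small scales. -/
def HasPowerGrowth (φ : ℝ → ENNReal) (n : ℕ) : Prop :=
  ∃ c > 0, ∃ C > 0, ∃ r₀ > 0, ∀ r, 0 < r → r ≤ r₀ →
    ENNReal.ofReal (c * r ^ n) ≤ φ r ∧ φ r ≤ ENNReal.ofReal (C * r ^ n)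

lemma HasPowerGrowth.le {m n : ℕ} (hm : HasPowerGrowth φ m) (hn : HasPowerGrowth φ n) :
    m ≤ n := by
  obtain ⟨_, _, C, _, r₁, hr₁, h₁⟩ := hm
  obtain ⟨c, hc, _, _, r₂, hr₂, h₂⟩ := hn
  refine le_of_mul_pow_le_mul_pow (C := C) hc (lt_min hr₁ hr₂) fun r hr hr' => ?_
  exact (ENNReal.ofReal_le_ofReal_iff (by positivity)).1
    ((h₂ r hr (hr'.trans (min_le_right _ _))).1.trans (h₁ r hr (hr'.trans (min_le_left _ _))).2)

lemma HasPowerGrowth.eq {m n : ℕ} (hm : HasPowerGrowth φ m) (hn : HasPowerGrowth φ n) : m = n :=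
  le_antisymm (hm.le hn) (hn.le hm)

/-- The big-piece condition for `μ` at the points of `s`, with scales bounded by some constant. -/
def HasLipschitzPieces (μ : Measure (Euc d)) (n : ℕ) (s : Set (Euc d)) : Prop :=
  ∃ R₀ θ M : ℝ, 0 < R₀ ∧ 0 < θ ∧ 0 < M ∧ ∀ x ∈ s, ∀ R : ℝ, 0 < R → R ≤ R₀ →
    ∃ g : EuclideanSpace ℝ (Fin n) → Euc d, LipschitzWith (Real.toNNReal M) g ∧
      ENNReal.ofReal (θ * R ^ n) ≤ μ (closedBall x R ∩ range g)

lemma HasLipschitzPieces.mono {n : ℕ} {s t : Set (Euc d)} (hst : s ⊆ t)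
    (ht : HasLipschitzPieces μ n t) : HasLipschitzPieces μ n s := by
  obtain ⟨R₀, θ, M, h1, h2, h3, h⟩ := ht
  exact ⟨R₀, θ, M, h1, h2, h3, fun x hx => h x (hst hx)⟩

lemma HasLipschitzPieces.union {n : ℕ} {s t : Set (Euc d)} (hs : HasLipschitzPieces μ n s)
    (ht : HasLipschitzPieces μ n t) : HasLipschitzPieces μ n (s ∪ t) := by
  obtain ⟨R₁, θ₁, M₁, hR₁, hθ₁, hM₁, h₁⟩ := hs
  obtain ⟨R₂, θ₂, M₂, hR₂, hθ₂, hM₂, h₂⟩ := ht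
  refine ⟨min R₁ R₂, min θ₁ θ₂, max M₁ M₂, lt_min hR₁ hR₂, lt_min hθ₁ hθ₂,
    lt_max_of_lt_left hM₁, fun x hx R hR hR' => ?_⟩
  rcases hx with hx | hx
  · obtain ⟨g, hg, hμ⟩ := h₁ x hx R hR (hR'.trans (min_le_left _ _))
    refine ⟨g, hg.weaken (Real.toNNReal_le_toNNReal (le_max_left _ _)), le_trans ?_ hμ⟩
    gcongr
    exact min_le_left _ _
  · obtain ⟨g, hg, hμ⟩ := h₂ x hx R hR (hR'.trans (min_le_right _ _))
    refine ⟨g, hg.weaken (Real.toNNReal_le_toNNReal (le_max_right _ _)), le_trans ?_ hμ⟩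
    gcongr
    exact min_le_right _ _

theorem IsDistributionFunction.exists_local_pieces [IsLocallyFiniteMeasure μ]
    (h : IsDistributionFunction μ φ) {x₀ : Euc d} (hx₀ : x₀ ∈ msupport μ) :
    ∃ n ≤ d, HasPowerGrowth φ n ∧
      ∃ r > 0, HasLipschitzPieces μ n (msupport μ ∩ closedBall x₀ r) := by
  obtain ⟨S, e, N, P, hD, y, hy⟩ := h.exists_local_noether hx₀
  obtain ⟨C, hC, rC, hrC, hup⟩ := h.exists_le_of_open_projection hx₀
    ((offS S).comp (e : Euc d →L[ℝ] (Fin d → ℝ))) (y := y) hy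
  obtain ⟨r₁, hr₁, K, C₁, hC₁, C₂, hC₂, hpiece⟩ := hD.exists_bilipschitz
  have hlow : ∃ c > 0, ∃ r₀ > 0, ∀ r, 0 < r → r ≤ r₀ →
      ENNReal.ofReal (c * r ^ Fintype.card {j // j ∉ S}) ≤ φ r := by
    obtain ⟨T, -, F, hF, -, hμF, hT⟩ := hpiece x₀ hx₀ (by simp [hr₁.le]) r₁ hr₁ le_rfl
    refine h.le_of_bilipschitz hC₂ hF (fun h0 => ?_) hT
    rw [h0, mul_zero] at hμF
    exact (hx₀ r₁ hr₁).not_ge hμF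
  obtain ⟨c, hc, rc, hrc, hlow⟩ := hlow
  refine ⟨Fintype.card {j // j ∉ S}, ?_, ⟨c, hc, C, hC, min rC rc, lt_min hrC hrc,
    fun r hr hr' => ⟨hlow r hr (hr'.trans (min_le_right _ _)),
      hup r hr (hr'.trans (min_le_left _ _))⟩⟩, r₁, hr₁, ?_⟩
  · simpa using Fintype.card_subtype_le fun j => j ∉ S
  obtain ⟨M, hM, hext⟩ := exists_lipschitz_range_superset (d := d) (J := {j // j ∉ S}) C₂
  refine ⟨min r₁ rc, c / (K + 1), M, lt_min hr₁ hrc, by positivity, hM,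
    fun x hx R hR hR' => ?_⟩
  obtain ⟨T, -, F, hF, -, hμF, hT⟩ := hpiece x hx.1 hx.2 R hR (hR'.trans (min_le_left _ _))
  obtain ⟨g, hg, hFg⟩ := hext T F hT
  refine ⟨g, hg, le_trans ?_
    (measure_mono (subset_inter (hF.trans inter_subset_left) hFg))⟩
  have h1 : ENNReal.ofReal (c * R ^ Fintype.card {j // j ∉ S}) ≤ ((K + 1 : ℕ) : ENNReal) * μ F := by
    refine (hlow R hR (hR'.trans (min_le_right _ _))).trans ?_
    rw [← h.2.2 x hx.1 R hR]
    refine hμF.trans ?_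
    gcongr
    exact Nat.le_succ K
  rw [div_mul_eq_mul_div, ENNReal.ofReal_div_of_pos (by positivity)]
  refine ENNReal.div_le_of_le_mul (h1.trans (le_of_eq ?_))
  rw [mul_comm]
  congr 1
  rw [← Nat.cast_succ, ENNReal.ofReal_natCast]

end

theorem uniformly_distributed_locally_uniformly_rectifiable {d : ℕ}
    (μ : Measure (Euc d)) [IsLocallyFiniteMeasure μ]
    (hμ : UniformlyDistributed μ) :
    ∃ n : ℕ, n ≤ d ∧ LocUnifRectifiable n μ := by
  obtain ⟨φ, h⟩ := hμ
  obtain ⟨x₀, hx₀⟩ := h.1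
  obtain ⟨n, hnd, hn, -⟩ := h.exists_local_pieces hx₀
  refine ⟨n, hnd, fun K _ => ?_, fun K hK => ?_⟩
  · obtain ⟨c, hc, C, hC, r₀, hr₀, hr⟩ := hn
    refine ⟨max C c⁻¹, lt_max_of_lt_left hC, r₀, hr₀, fun x hx r hr0 hrr => ?_⟩
    rw [h.2.2 x hx.1 r hr0]
    refine ⟨le_trans ?_ (hr r hr0 hrr).1, (hr r hr0 hrr).2.trans ?_⟩
    · gcongr
      exact inv_le_of_inv_le₀ hc (le_max_right _ _)
    · gcongr
      exact le_max_left _ _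
  · refine (hK.inter_left (isClosed_msupport (μ := μ))).induction_on
      (p := fun s => HasLipschitzPieces μ n s) ?_ (fun s t hst => HasLipschitzPieces.mono hst)
      (fun s t => HasLipschitzPieces.union) fun x hx => ?_
    · exact ⟨1, 1, 1, one_pos, one_pos, one_pos, fun x hx => absurd hx (notMem_empty x)⟩
    · obtain ⟨m, -, hm, r, hr, hpieces⟩ := h.exists_local_pieces hx.1
      rw [hm.eq hn] at hpieces
      refine ⟨_, ?_, hpieces⟩
      exact mem_nhdsWithin_iff_exists_mem_nhds_inter.2 ⟨closedBall x r, closedBall_mem_nhds x hr,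
        fun z hz => ⟨hz.2.1, hz.1⟩⟩
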